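/- Let d ≥ 2. There exist constants c₁ > 0 and C₁ > 0 depending only on the dimension d such that, almost surely, for all n large enough, B[n(1 − C₁ n^{−c₁})] ⊆ A_{b_n}, where A_{b_n} is the uIDLA aggregate with b_n particles started from {0}. -/

import Mathlib

open MeasureTheory Filter
open scoped ENNReal

noncomputable section

/-- The `k`-th binary digit of `x ∈ [0,1)` (after the binary point). -/
def bit (x : ℝ) (k : ℕ) : Bool := ⌊x * 2 ^ (k + 1)⌋ % 2 == 1

/-- From one uniform sample on `[0,1]`, extract countably many independent uniform
samples on `[0,1]`, using disjoint subsequences of binary digits. -/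
def uSlice (x : ℝ) (i : ℕ) : ℝ :=
  ∑' j : ℕ, if bit x (Nat.pair i j) then ((2 : ℝ) ^ (-(j : ℤ) - 1)) else 0

/-- The base probability space: Lebesgue measure restricted to `[0,1]`. -/
def μ0 : Measure ℝ := volume.restrict (Set.Icc 0 1)

/-- The vertex set of the lattice `ℤ^d`. -/
abbrev V (d : ℕ) := Fin d → ℤ

instance (d : ℕ) : MeasurableSpace (Finset (V d)) := ⊤

open Classical in
/-- `B[r]`: the Euclidean ball of radius `r` in `ℤ^d`, as a `Finset`. -/
def ball (d : ℕ) (r : ℝ) : Finset (V d) :=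
  (Finset.Icc (fun _ => -⌈r⌉) (fun _ => ⌈r⌉)).filter
    (fun y => Real.sqrt (∑ i, ((y i : ℝ)) ^ 2) ≤ r)

/-- `b_n`: the number of lattice points in the Euclidean ball of radius `n`. -/
def bn (d n : ℕ) : ℕ := (ball d n).card

/-- The `2d` unit vectors of `ℤ^d` (the possible steps of the simple random walk). -/
def unitVecs (d : ℕ) : Finset (V d) :=
  Finset.image
    (fun p : Fin d × Bool => fun j => if j = p.1 then (if p.2 then 1 else -1) else 0)
    Finset.univ

/-- Given `u` uniform on `[0,1]`, `pick S u` is a uniformly chosen element of `S`. -/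
def pick {d : ℕ} (S : Finset (V d)) (u : ℝ) : V d :=
  if h : S.Nonempty then
    (S.equivFin.symm ⟨(⌊u * S.card⌋).toNat % S.card,
      Nat.mod_lt _ (Finset.card_pos.mpr h)⟩).val
  else 0

/-- Position at time `t` of the simple random walk started at `x`, driven by the
random seed `ω`: the steps `pick (unitVecs d) (uSlice ω i)` are i.i.d. uniform on
the `2d` unit vectors when `ω` is uniform on `[0,1]`. -/
def walk {d : ℕ} (x : V d) (ω : ℝ) (t : ℕ) : V d :=
  x + ∑ i ∈ Finset.range t, pick (unitVecs d) (uSlice ω i)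

/-- `t_S`: the first time the walk started at `x` is outside `S`. -/
def exitT {d : ℕ} (S : Finset (V d)) (x : V d) (ω : ℝ) : ℕ :=
  sInf {t | walk x ω t ∉ S}

/-- The position `ξ(t_S)` at which the walk started at `x` first exits `S`. -/
def hitPt {d : ℕ} (S : Finset (V d)) (x : V d) (ω : ℝ) : V d :=
  walk x ω (exitT S x ω)

/-- `Add[ξ,S]`: add to `S` the exit point of a random walk started at `x`. -/
def addPt {d : ℕ} (S : Finset (V d)) (x : V d) (ω : ℝ) : Finset (V d) :=
  insert (hitPt S x ω) S

/-- `P_x(ξ(τ_A) = y)`: the probability that the walk started at `x` exits `A` at `y`. -/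
def hitProb {d : ℕ} (A : Finset (V d)) (x y : V d) : ℝ≥0∞ :=
  μ0 {ω | hitPt A x ω = y}

/-- The outer boundary `∂A`: vertices outside `A` with a neighbour in `A`. -/
def outb {d : ℕ} (A : Finset (V d)) : Finset (V d) :=
  (A.biUnion fun x => (unitVecs d).image (fun e => x + e)) \ A

/-- `DA_X(S)`: the IDLA aggregate obtained from `S` by launching one particle from each
point of the list `xs` in turn (driven by independent slices of the seed `ω`). -/
def daFrom {d : ℕ} : Finset (V d) → List (V d) → ℝ → Finset (V d)
  | S, [], _ => S
  | S, x :: xs, ω => daFrom (addPt S x (uSlice ω 0)) xs (uSlice ω 1)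

/-- The law of the IDLA aggregate `DA_X(S)`. -/
def daLaw {d : ℕ} (S : Finset (V d)) (xs : List (V d)) : Measure (Finset (V d)) :=
  μ0.map (fun ω => daFrom S xs ω)

/-- One uIDLA step: launch a particle from a uniformly chosen point of `S`. -/
def uStep {d : ℕ} (S : Finset (V d)) (ω : ℝ) : Finset (V d) :=
  addPt S (pick S (uSlice ω 0)) (uSlice ω 1)

/-- `A_k(S)`: the uIDLA aggregate obtained by adding `k` particles to `S`,
each started at a uniform point of the current aggregate. -/
def uAggFrom {d : ℕ} (S : Finset (V d)) (ω : ℝ) : ℕ → Finset (V d)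
  | 0 => S
  | k + 1 => uStep (uAggFrom S ω k) (uSlice ω k)

/-- The law of the uIDLA aggregate `A_k(S)`. -/
def uLaw {d : ℕ} (S : Finset (V d)) (k : ℕ) : Measure (Finset (V d)) :=
  μ0.map (fun ω => uAggFrom S ω k)

/-- One step of the subset uIDLA `A_·(E;m)`: at step `k`, perform a uIDLA step
with probability `|E|/(m+k)` and otherwise do nothing. -/
def subStep {d : ℕ} (m k : ℕ) (E : Finset (V d)) (ω : ℝ) : Finset (V d) :=
  if uSlice ω 0 * ((m : ℝ) + k) ≤ E.card then uStep E (uSlice ω 1) else E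

/-- The subset uIDLA `A_n(E;m)`. -/
def subAggFrom {d : ℕ} (E : Finset (V d)) (m : ℕ) (ω : ℝ) : ℕ → Finset (V d)
  | 0 => E
  | k + 1 => subStep m k (subAggFrom E m ω k) (uSlice ω k)

/-- The law of the subset uIDLA `A_n(E;m)`. -/
def subLaw {d : ℕ} (E : Finset (V d)) (m k : ℕ) : Measure (Finset (V d)) :=
  μ0.map (fun ω => subAggFrom E m ω k)

/-- Stochastic domination of random finite subsets of `ℤ^d`: `μ` dominates `ν` if
there is a coupling under which the sample of `ν` is a.s. contained in that of `μ`. -/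
def StochDom {d : ℕ} (μ ν : Measure (Finset (V d))) : Prop :=
  ∃ π : Measure (Finset (V d) × Finset (V d)), IsProbabilityMeasure π ∧
    π.map Prod.fst = μ ∧ π.map Prod.snd = ν ∧ π {p | p.2 ⊆ p.1} = 1

/-- A `Geometric(1/2)` sample (taking value `j ≥ 0` with probability `2^{-(j+1)}`)
produced from a uniform sample `u` on `[0,1]` by inverting the CDF. -/
def geom (u : ℝ) : ℕ := sInf {j : ℕ | u ≤ 1 - (2 : ℝ) ^ (-(j : ℤ) - 1)}

/-- The parent of vertex `j ≥ 1` in the uniform random recursive tree (vertex `0` is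
the root): uniform on `{0, …, j-1}` when the seed is uniform on `[0,1]`. -/
def parent (ω : ℝ) (j : ℕ) : ℕ := (⌊uSlice ω (Nat.pair 0 j) * j⌋).toNat % j

/-- The reaching time of vertex `j` in a uniform random recursive tree whose edges
carry i.i.d. `Geometric(1/2)` weights: the sum of the weights on the path from the
root to `j`. (The `min` is a.s. inoperative, since a.s. `parent ω (j+1) ≤ j`.) -/
def reach (ω : ℝ) : ℕ → ℕ
  | 0 => 0
  | j + 1 => reach ω (min (parent ω (j + 1)) j) + geom (uSlice ω (Nat.pair 1 (j + 1)))
termination_by j => j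
decreasing_by exact Nat.lt_succ_of_le (min_le_right _ _)

end

open MeasureTheory Filter
open scoped ENNReal

namespace IDLA
open ProbabilityTheory

lemma mu0_eq : μ0 = volume.restrict (Set.Ico (0:ℝ) 1) := by
  unfold μ0
  exact (Measure.restrict_congr_set Ico_ae_eq_Icc).symm

instance mu0_prob : IsProbabilityMeasure μ0 := by
  constructor
  simp [μ0]

lemma measurable_bit (k : ℕ) : Measurable (fun x : ℝ => bit x k) := by
  unfold bit
  have h1 : Measurable (fun x : ℝ => ⌊x * 2 ^ (k + 1)⌋) := by fun_prop
  exact (measurable_from_top (f := fun z : ℤ => (z % 2 == 1))).comp h1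

lemma bit_zero_lo {x : ℝ} (h0 : 0 ≤ x) (h1 : x < 1/2) : bit x 0 = false := by
  have : ⌊x * 2 ^ (0+1)⌋ = 0 := by
    rw [Int.floor_eq_iff]; constructor <;> norm_num <;> linarith
  simp only [bit, this]; decide

lemma bit_zero_hi {x : ℝ} (h0 : 1/2 ≤ x) (h1 : x < 1) : bit x 0 = true := by
  have : ⌊x * 2 ^ (0+1)⌋ = 1 := by
    rw [Int.floor_eq_iff]; constructor <;> norm_num <;> linarith
  simp only [bit, this]; decide

lemma bit_succ_lo (x : ℝ) (k : ℕ) : bit x (k+1) = bit (2*x) k := by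
  have : x * 2 ^ (k+1+1) = 2 * x * 2 ^ (k+1) := by ring
  simp only [bit, this]

lemma bit_succ_hi (x : ℝ) (k : ℕ) : bit x (k+1) = bit (2*x-1) k := by
  simp only [bit]
  have : (2*x-1) * 2^(k+1) = x * 2^(k+1+1) - ((2 * 2^k : ℤ) : ℝ) := by push_cast; ring
  rw [this, Int.floor_sub_intCast]
  congr 1
  omega

/-- a fair coin -/
noncomputable def coin : Measure Bool := (2⁻¹ : ℝ≥0∞) • Measure.dirac true + (2⁻¹ : ℝ≥0∞) • Measure.dirac false

instance : IsProbabilityMeasure coin := by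
  constructor
  simp [coin, ENNReal.inv_two_add_inv_two]

lemma coin_apply (t : Set Bool) : coin t = 2⁻¹ * t.indicator 1 true + 2⁻¹ * t.indicator 1 false := by
  simp [coin, Measure.dirac_apply' _ (MeasurableSet.of_discrete (s := t))]

def EE (t : ℕ → Set Bool) (m : ℕ) : Set ℝ := {x | ∀ i < m, bit x i ∈ t i}

lemma measurable_EE (t : ℕ → Set Bool) (m : ℕ) : MeasurableSet (EE t m) := by
  have : EE t m = ⋂ i ∈ Set.Iio m, (fun x => bit x i) ⁻¹' t i := by
    ext x; simp [EE]
  rw [this]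
  exact MeasurableSet.biInter (Set.to_countable _) fun i _ => measurable_bit i .of_discrete

lemma vol_half (c : ℝ) (E : Set ℝ) : volume ((fun x : ℝ => 2 * x - c) ⁻¹' E) = 2⁻¹ * volume E := by
  have : (fun x : ℝ => 2 * x - c) ⁻¹' E = (fun x => 2 * x) ⁻¹' ((fun x => x - c) ⁻¹' E) := rfl
  rw [this, Real.volume_preimage_mul_left (by norm_num), show volume ((fun x : ℝ => x - c) ⁻¹' E) = volume E by
      simp [sub_eq_add_neg]]
  congr 1
  rw [abs_of_pos (by norm_num), ENNReal.ofReal_inv_of_pos (by norm_num)]; norm_num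

lemma vol_EE (m : ℕ) : ∀ t : ℕ → Set Bool, volume (EE t m ∩ Set.Ico 0 1) = ∏ i ∈ Finset.range m, coin (t i) := by
  induction m with
  | zero => intro t; simp [EE]
  | succ m ih =>
    intro t
    have key : EE t (m+1) ∩ Set.Ico 0 1 =
        ({x : ℝ | false ∈ t 0} ∩ (fun x : ℝ => 2 * x - 0) ⁻¹' (EE (fun i => t (i+1)) m ∩ Set.Ico 0 1)) ∪
        ({x : ℝ | true ∈ t 0} ∩ (fun x : ℝ => 2 * x - 1) ⁻¹' (EE (fun i => t (i+1)) m ∩ Set.Ico 0 1)) := by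
      ext x
      simp only [EE, Set.mem_inter_iff, Set.mem_ofPred_eq, Set.mem_Ico, Set.mem_union, Set.mem_preimage]
      constructor
      · rintro ⟨h, h0, h1⟩
        rcases lt_or_ge x (1/2) with hx | hx
        · left
          refine ⟨bit_zero_lo h0 hx ▸ h 0 (by omega), fun i hi => ?_, by linarith, by linarith⟩
          rw [sub_zero, ← bit_succ_lo]; exact h (i+1) (by omega)
        · right
          refine ⟨bit_zero_hi hx h1 ▸ h 0 (by omega), fun i hi => ?_, by linarith, by linarith⟩
          rw [← bit_succ_hi]; exact h (i+1) (by omega)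
      · rintro (⟨h, h', h0, h1⟩ | ⟨h, h', h0, h1⟩)
        · refine ⟨fun i hi => ?_, by linarith, by linarith⟩
          cases i with
          | zero => rw [bit_zero_lo (by linarith) (by linarith)]; exact h
          | succ i => rw [bit_succ_lo]; have := h' i (by omega); rwa [sub_zero] at this
        · refine ⟨fun i hi => ?_, by linarith, by linarith⟩
          cases i with
          | zero => rw [bit_zero_hi (by linarith) (by linarith)]; exact h
          | succ i => rw [bit_succ_hi]; exact h' i (by omega)
    have hm := (measurable_EE (fun i => t (i+1)) m).inter (measurableSet_Ico (a := (0:ℝ)) (b := 1))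
    rw [key, measure_union, Finset.prod_range_succ', ← ih, coin_apply]
    · have e : ∀ (P : Prop) (F : Set ℝ), volume ({x : ℝ | P} ∩ F) = ({b : Bool | P}.indicator (1 : Bool → ℝ≥0∞) true) * volume F := by
        intro P F; by_cases hP : P <;> simp [hP]
      rw [e, e, vol_half, vol_half]
      have e2 : ∀ b : Bool, ({_b : Bool | b ∈ t 0}.indicator (1 : Bool → ℝ≥0∞) true) = (t 0).indicator 1 b := by
        intro b; by_cases hb : b ∈ t 0 <;> simp [hb]
      rw [e2, e2]; ring
    · rw [Set.disjoint_left]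
      rintro x ⟨_, _, h1⟩ ⟨_, _, h2⟩
      simp only [Set.mem_Ico] at h1 h2; linarith
    · exact (MeasurableSet.const _).inter (hm.preimage (by fun_prop))

lemma map_bits : μ0.map (fun x k => bit x k) = Measure.infinitePi (fun _ : ℕ => coin) := by
  have hmeas : Measurable (fun (x:ℝ) (k:ℕ) => bit x k) := measurable_pi_lambda _ measurable_bit
  classical
  refine Measure.eq_infinitePi _ fun s t ht => ?_
  obtain ⟨m, hm⟩ : ∃ m, s ⊆ Finset.range m := s.exists_nat_subset_range
  rw [Measure.map_apply hmeas (.pi s.countable_toSet fun i _ => ht i), mu0_eq,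
    Measure.restrict_apply ((MeasurableSet.pi s.countable_toSet fun i _ => ht i).preimage hmeas)]
  have := vol_EE m (fun i => if i ∈ s then t i else Set.univ)
  convert this using 1
  · congr 2
    ext x
    simp only [Set.mem_preimage, Set.mem_pi, EE, Set.mem_ofPred_eq]
    constructor
    · intro h i hi; split_ifs with h'
      · exact h i h'
      · trivial
    · intro h i hi
      have := h i (Finset.mem_range.mp (hm hi))
      rwa [if_pos (by exact hi)] at this
  · rw [← Finset.prod_subset hm]
    · exact Finset.prod_congr rfl fun i hi => by rw [if_pos hi]
    · intro i _ hi; rw [if_neg hi]; exact measure_univ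

/-- binary sum -/
noncomputable def bsum (f : ℕ → Bool) : ℝ := ∑' j : ℕ, if f j then ((2 : ℝ) ^ (-(j : ℤ) - 1)) else 0

lemma bsum_bit {x : ℝ} (hx : x ∈ Set.Ico (0:ℝ) 1) : bsum (fun k => bit x k) = x := by
  have := Real.ofDigits_digits (b := 2) (by norm_num) hx
  conv_rhs => rw [← this]
  unfold bsum Real.ofDigits
  congr 1; ext j
  unfold Real.ofDigitsTerm Real.digits
  have h2 : (2 : ℝ) ^ (-(j : ℤ) - 1) = ((2:ℝ)^(j+1))⁻¹ := by
    rw [← zpow_natCast, ← zpow_neg]; congr 1; push_cast; ring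
  have hnn : 0 ≤ x * 2 ^ (j+1) := by have := hx.1; positivity
  have h3 : (⌊x * 2 ^ (j+1)⌋) = ((⌊x * 2^(j+1)⌋₊ : ℕ) : ℤ) := by
    rw [Int.natCast_floor_eq_floor hnn]
  rw [h2]
  simp only [bit, h3]
  push_cast
  rcases Nat.mod_two_eq_zero_or_one (⌊x * 2^(j+1)⌋₊) with h | h
  · have : ((⌊x * 2^(j+1)⌋₊ : ℕ) : ℤ) % 2 = 0 := by omega
    simp [this, Fin.ofNat, h]
  · have : ((⌊x * 2^(j+1)⌋₊ : ℕ) : ℤ) % 2 = 1 := by omega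
    simp [this, Fin.ofNat, h]

lemma measurable_bsum : Measurable bsum := by
  have hs : Summable (fun j : ℕ => (2:ℝ)^(-(j:ℤ)-1)) := by
    have : (fun j : ℕ => (2:ℝ)^(-(j:ℤ)-1)) = fun j : ℕ => (1/2) * (1/2:ℝ)^j := by
      ext j
      rw [zpow_sub₀ (by norm_num), zpow_neg, zpow_natCast]; 
      rw [one_div, inv_pow]; ring
    rw [this]; exact (summable_geometric_of_lt_one (by norm_num) (by norm_num)).mul_left _
  have hs' : ∀ f : ℕ → Bool, Summable (fun j : ℕ => if f j then ((2 : ℝ) ^ (-(j : ℤ) - 1)) else 0) := by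
    intro f
    refine Summable.of_nonneg_of_le (fun j => ?_) (fun j => ?_) hs <;> split_ifs <;> first | positivity | exact le_rfl
  refine measurable_of_tendsto_metrizable (f := fun n (f : ℕ → Bool) => ∑ j ∈ Finset.range n, if f j then ((2 : ℝ) ^ (-(j : ℤ) - 1)) else 0) (fun n => ?_) ?_
  · refine Finset.measurable_sum _ fun j _ => ?_
    exact (measurable_from_top (f := fun b : Bool => if b then ((2 : ℝ) ^ (-(j : ℤ) - 1)) else 0)).comp (measurable_pi_apply j)
  · rw [tendsto_pi_nhds]
    exact fun f => (hs' f).hasSum.tendsto_sum_nat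

lemma map_bsum : (Measure.infinitePi (fun _ : ℕ => coin)).map bsum = μ0 := by
  rw [← map_bits, Measure.map_map measurable_bsum (measurable_pi_lambda _ measurable_bit)]
  have : (bsum ∘ fun x k => bit x k) =ᵐ[μ0] id := by
    rw [mu0_eq]
    filter_upwards [ae_restrict_mem measurableSet_Ico] with x hx
    exact bsum_bit hx
  rw [Measure.map_congr this, Measure.map_id]

lemma uSlice_eq (x : ℝ) (i : ℕ) : uSlice x i = bsum (fun j => bit x (Nat.pair i j)) := rfl

lemma measurable_uSlice (i : ℕ) : Measurable (fun x => uSlice x i) :=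
  measurable_bsum.comp (measurable_pi_lambda _ fun _ => measurable_bit _)

/-- the seed sequence is i.i.d. -/
lemma map_slices : μ0.map (fun x i => uSlice x i) = Measure.infinitePi (fun _ : ℕ => μ0) := by
  have h1 : (fun (x:ℝ) (i:ℕ) => uSlice x i) = (fun (F : ℕ → ℕ → Bool) i => bsum (F i)) ∘
      (MeasurableEquiv.curry ℕ ℕ Bool) ∘ (fun (f : ℕ → Bool) (p : ℕ × ℕ) => f (Nat.pairEquiv p)) ∘
      (fun x k => bit x k) := by
    ext x i; rfl
  have h2 : (Measure.infinitePi (fun _ : ℕ => coin)).map (fun (f : ℕ → Bool) (p : ℕ × ℕ) => f (Nat.pairEquiv p))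
      = Measure.infinitePi (fun _ : ℕ × ℕ => coin) :=
    Measure.map_infinitePi_infinitePi_of_inj (P := fun _ : ℕ => coin) (f := fun p : ℕ × ℕ => Nat.pairEquiv p)
      Nat.pairEquiv.injective
  rw [h1, ← Measure.map_map, ← Measure.map_map, ← Measure.map_map, map_bits, h2,
    Measure.infinitePi_map_curry (fun _ _ => coin), Measure.infinitePi_map_pi _ (fun _ => measurable_bsum)]
  · simp only [map_bsum]
  · fun_prop
  · exact measurable_pi_lambda _ measurable_bit
  · fun_prop
  · exact measurable_pi_lambda _ fun p => measurable_bit _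
  · exact measurable_pi_lambda _ fun i => measurable_bsum.comp (measurable_pi_apply i)
  · exact (MeasurableEquiv.measurable _).comp (measurable_pi_lambda _ fun p => measurable_bit _)

lemma map_uSlice (i : ℕ) : μ0.map (fun x => uSlice x i) = μ0 := by
  have := congrArg (Measure.map (fun f : ℕ → ℝ => f i)) map_slices
  rw [Measure.map_map (by fun_prop) (measurable_pi_lambda _ measurable_uSlice), Measure.infinitePi_map_eval] at this
  exact this

lemma iIndep_uSlice : iIndepFun (fun i x => uSlice x i) μ0 := by
  rw [iIndepFun_iff_map_fun_eq_infinitePi_map measurable_uSlice]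
  rw [map_slices]; congr 1; ext1 i; rw [map_uSlice]

end IDLA

open MeasureTheory Filter
open scoped ENNReal

namespace IDLA

/-- unit vector -/
def E {d : ℕ} (i : Fin d) : V d := Pi.single i 1

noncomputable def lap {d : ℕ} (f : V d → ℝ) (x : V d) : ℝ :=
  (∑ i, (f (x + E i) + f (x - E i))) / (2 * d) - f x

noncomputable def nsq {d : ℕ} (x : V d) : ℝ := ∑ i, (x i : ℝ) ^ 2

lemma nsq_nonneg {d : ℕ} (x : V d) : 0 ≤ nsq x := Finset.sum_nonneg fun _ _ => sq_nonneg _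

lemma nsq_zero {d : ℕ} : nsq (0 : V d) = 0 := by simp [nsq]

lemma coord_sq_le {d : ℕ} (x : V d) (i : Fin d) : (x i : ℝ)^2 ≤ nsq x :=
  Finset.single_le_sum (f := fun i => (x i : ℝ)^2) (fun _ _ => sq_nonneg _) (Finset.mem_univ i)

lemma E_same {d : ℕ} (i : Fin d) : (E i : V d) i = 1 := by simp [E]
lemma E_ne {d : ℕ} {i j : Fin d} (h : j ≠ i) : (E i : V d) j = 0 := by simp [E, h]

lemma nsq_add_E {d : ℕ} (x : V d) (i : Fin d) : nsq (x + E i) = nsq x + 2 * x i + 1 := by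
  unfold nsq
  rw [← Finset.add_sum_erase _ _ (Finset.mem_univ i), ← Finset.add_sum_erase _ _ (Finset.mem_univ i)]
  have : ∀ j ∈ Finset.univ.erase i, (((x + E i) j : ℤ) : ℝ)^2 = (x j : ℝ)^2 := by
    intro j hj
    simp [E_ne (Finset.ne_of_mem_erase hj)]
  rw [Finset.sum_congr rfl this]
  simp only [Pi.add_apply, E_same]; push_cast; ring

lemma nsq_sub_E {d : ℕ} (x : V d) (i : Fin d) : nsq (x - E i) = nsq x - 2 * x i + 1 := by
  unfold nsq
  rw [← Finset.add_sum_erase _ _ (Finset.mem_univ i), ← Finset.add_sum_erase _ _ (Finset.mem_univ i)]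
  have : ∀ j ∈ Finset.univ.erase i, (((x - E i) j : ℤ) : ℝ)^2 = (x j : ℝ)^2 := by
    intro j hj
    simp [E_ne (Finset.ne_of_mem_erase hj)]
  rw [Finset.sum_congr rfl this]
  simp only [Pi.sub_apply, E_same]; push_cast; ring

lemma mem_ball {d : ℕ} {r : ℝ} (hr : 0 ≤ r) (y : V d) : y ∈ ball d r ↔ nsq y ≤ r^2 := by
  classical
  unfold ball
  rw [Finset.mem_filter]
  change _ ∧ Real.sqrt (nsq y) ≤ r ↔ _
  rw [Real.sqrt_le_left hr]
  constructor
  · exact fun h => h.2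
  · intro h
    refine ⟨?_, h⟩
    have hc : ∀ i, |(y i : ℝ)| ≤ r := fun i => abs_le_of_sq_le_sq ((coord_sq_le y i).trans h) hr
    rw [Finset.mem_Icc]
    constructor <;> intro i
    · have := (abs_le.mp (hc i)).1
      have h2 := Int.le_ceil r
      have : (-⌈r⌉ : ℝ) ≤ y i := by linarith
      exact_mod_cast this
    · have := (abs_le.mp (hc i)).2
      have h2 := Int.le_ceil r
      have : (y i : ℝ) ≤ ⌈r⌉ := by linarith
      exact_mod_cast this

lemma lap_nsq {d : ℕ} (hd : 0 < d) (x : V d) : lap nsq x = 1 := by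
  unfold lap
  simp only [nsq_add_E, nsq_sub_E]
  have : ∀ i : Fin d, nsq x + 2 * (x i : ℝ) + 1 + (nsq x - 2 * x i + 1) = 2 * nsq x + 2 := fun i => by ring
  simp only [this, Finset.sum_const, Finset.card_univ, Fintype.card_fin, nsmul_eq_mul]
  have : (d : ℝ) ≠ 0 := by positivity
  field_simp; ring

lemma lap_add {d : ℕ} (f g : V d → ℝ) (x : V d) : lap (fun y => f y + g y) x = lap f x + lap g x := by
  unfold lap
  have : ∑ i, (f (x + E i) + g (x + E i) + (f (x - E i) + g (x - E i))) =
    ∑ i, (f (x + E i) + f (x - E i)) + ∑ i, (g (x + E i) + g (x - E i)) := by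
    rw [← Finset.sum_add_distrib]; exact Finset.sum_congr rfl fun _ _ => by ring
  rw [this]; ring

lemma lap_const_mul {d : ℕ} (c : ℝ) (f : V d → ℝ) (x : V d) : lap (fun y => c * f y) x = c * lap f x := by
  unfold lap
  have : ∑ i, (c * f (x + E i) + c * f (x - E i)) = c * ∑ i, (f (x + E i) + f (x - E i)) := by
    rw [Finset.mul_sum]; exact Finset.sum_congr rfl fun _ _ => by ring
  rw [this]; ring

lemma lap_sub {d : ℕ} (f g : V d → ℝ) (x : V d) : lap (fun y => f y - g y) x = lap f x - lap g x := by
  have h : (fun y => f y - g y) = fun y => f y + (-1) * g y := by ext; ring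
  rw [h, lap_add, lap_const_mul]; ring

lemma lap_const {d : ℕ} (hd : 0 < d) (c : ℝ) (x : V d) : lap (fun _ => c) x = 0 := by
  unfold lap
  have : (d : ℝ) ≠ 0 := by positivity
  simp only [Finset.sum_const, Finset.card_univ, Fintype.card_fin, nsmul_eq_mul]
  field_simp; ring

lemma lap_sum {d : ℕ} {ι : Type*} (s : Finset ι) (f : ι → V d → ℝ) (x : V d) :
    lap (fun y => ∑ k ∈ s, f k y) x = ∑ k ∈ s, lap (f k) x := by
  classical
  induction s using Finset.induction_on with
  | empty => simp [lap]
  | insert a s ha ih =>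
    simp only [Finset.sum_insert ha]
    rw [lap_add (f a) (fun y => ∑ k ∈ s, f k y), ih]

lemma lap_translate {d : ℕ} (f : V d → ℝ) (a x : V d) : lap (fun y => f (y - a)) x = lap f (x - a) := by
  unfold lap
  have h1 : ∀ i, x + E i - a = x - a + E i := fun i => by abel
  have h2 : ∀ i, x - E i - a = x - a - E i := fun i => by abel
  simp only [h1, h2]

/-- lower bound of the Laplacian by a comparison of neighbours -/
lemma lap_mono {d : ℕ} (f g : V d → ℝ) (x : V d) (hx : f x = g x) (h : ∀ y, g y ≤ f y) : lap g x ≤ lap f x := by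
  unfold lap
  rw [hx]
  gcongr with i
  · exact h _
  · exact h _

/-- maximum principle -/
lemma max_principle {d : ℕ} (hd : 0 < d) (S : Finset (V d)) (v : V d → ℝ)
    (h1 : ∀ x ∈ S, 0 ≤ lap v x) (h2 : ∀ x, x ∉ S → (∃ i, x - E i ∈ S ∨ x + E i ∈ S) → v x ≤ 0) :
    ∀ x ∈ S, v x ≤ 0 := by
  classical
  by_contra! hcon
  obtain ⟨x0, hx0, hpos⟩ := hcon
  obtain ⟨m, hmS, hm⟩ := S.exists_max_image v ⟨x0, hx0⟩
  let i0 : Fin d := ⟨0, hd⟩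
  let T := S.filter (fun x => v x = v m)
  obtain ⟨y, hyT, hy⟩ := T.exists_max_image (fun x => x i0) ⟨m, by simp [T, hmS]⟩
  obtain ⟨hyS, hyv⟩ := Finset.mem_filter.mp hyT
  have hmpos : 0 < v m := hpos.trans_le (hm x0 hx0)
  have hle : ∀ i, v (y + E i) ≤ v m ∧ v (y - E i) ≤ v m := by
    intro i
    constructor
    · by_cases h : y + E i ∈ S
      · exact hm _ h
      · exact (h2 _ h ⟨i, Or.inl (by simpa using hyS)⟩).trans hmpos.le
    · by_cases h : y - E i ∈ S
      · exact hm _ h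
      · exact (h2 _ h ⟨i, Or.inr (by simpa using hyS)⟩).trans hmpos.le
  have hlt : v (y + E i0) < v m := by
    by_cases h : y + E i0 ∈ S
    · refine lt_of_le_of_ne (hle i0).1 fun heq => ?_
      have := hy (y + E i0) (by simp [T, h, heq])
      simp [E_same] at this
    · exact (h2 _ h ⟨i0, Or.inl (by simpa using hyS)⟩).trans_lt hmpos
  have hsum : ∑ i, (v (y + E i) + v (y - E i)) < ∑ i : Fin d, (2 * v m) := by
    refine Finset.sum_lt_sum (fun i _ => by linarith [hle i]) ⟨i0, Finset.mem_univ _, by linarith [(hle i0).2]⟩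
  have := h1 y hyS
  unfold lap at this
  rw [hyv] at this
  simp only [Finset.sum_const, Finset.card_univ, Fintype.card_fin, nsmul_eq_mul] at hsum
  have hd' : (0:ℝ) < 2 * d := by positivity
  have h3 : v m ≤ (∑ i, (v (y + E i) + v (y - E i))) / (2 * d) := by linarith
  rw [le_div_iff₀ hd'] at h3
  linarith

lemma max_principle' {d : ℕ} (hd : 0 < d) (S : Finset (V d)) (u v : V d → ℝ)
    (h1 : ∀ x ∈ S, lap u x ≤ lap v x) (h2 : ∀ x, x ∉ S → (∃ i, x - E i ∈ S ∨ x + E i ∈ S) → v x ≤ u x) :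
    ∀ x ∈ S, v x ≤ u x := by
  have := max_principle hd S (fun x => v x - u x) (fun x hx => by rw [lap_sub]; linarith [h1 x hx])
    (fun x hx h => by linarith [h2 x hx h])
  intro x hx; linarith [this x hx]

/-- Dirichlet problem -/
lemma dirichlet {d : ℕ} (hd : 0 < d) (S : Finset (V d)) (f r : V d → ℝ) :
    ∃ w : V d → ℝ, (∀ x, x ∉ S → w x = f x) ∧ ∀ x ∈ S, lap w x = r x := by
  classical
  let ext : (S → ℝ) → V d → ℝ := fun g x => if h : x ∈ S then g ⟨x, h⟩ else 0
  have ext_add : ∀ g1 g2, ext (g1 + g2) = fun x => ext g1 x + ext g2 x := by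
    intro g1 g2; ext x; simp only [ext]; split_ifs <;> simp
  have ext_smul : ∀ (c : ℝ) g, ext (c • g) = fun x => c * ext g x := by
    intro c g; ext x; simp only [ext]; split_ifs <;> simp
  let L : (S → ℝ) →ₗ[ℝ] (S → ℝ) :=
    { toFun := fun g x => lap (ext g) x
      map_add' := fun g1 g2 => by ext x; simp only [ext_add, lap_add, Pi.add_apply]
      map_smul' := fun c g => by ext x; simp only [ext_smul, lap_const_mul]; simp }
  have hinj : Function.Injective L := by
    rw [← LinearMap.ker_eq_bot, LinearMap.ker_eq_bot']
    intro g hg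
    have hz : ∀ x ∈ S, lap (ext g) x = 0 := fun x hx => congrFun hg ⟨x, hx⟩
    have hoff : ∀ x, x ∉ S → ext g x = 0 := fun x hx => by simp [ext, hx]
    have a1 := max_principle' hd S (fun _ => 0) (ext g) (fun x hx => by rw [hz x hx, lap_const hd])
      (fun x hx _ => (hoff x hx).le)
    have a2 := max_principle' hd S (ext g) (fun _ => 0) (fun x hx => by rw [hz x hx, lap_const hd])
      (fun x hx _ => (hoff x hx).ge)
    ext ⟨x, hx⟩
    have := le_antisymm (a1 x hx) (a2 x hx)
    simpa [ext, hx] using this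
  have hsurj := LinearMap.injective_iff_surjective.mp hinj
  let f' : V d → ℝ := fun x => if x ∈ S then 0 else f x
  obtain ⟨g, hg⟩ := hsurj (fun x => r x - lap f' x)
  refine ⟨fun x => ext g x + f' x, fun x hx => by simp [ext, f', hx], fun x hx => ?_⟩
  rw [lap_add]
  have := congrFun hg ⟨x, hx⟩
  change lap (ext g) x = r x - lap f' x at this
  rw [this]; ring

/-- closure -/
def cl {d : ℕ} (S : Finset (V d)) : Finset (V d) :=
  S ∪ Finset.univ.biUnion (fun i => S.image (fun x => x + E i) ∪ S.image (fun x => x - E i))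

lemma subset_cl {d : ℕ} (S : Finset (V d)) : S ⊆ cl S := Finset.subset_union_left

lemma add_mem_cl {d : ℕ} {S : Finset (V d)} {x : V d} (hx : x ∈ S) (i : Fin d) : x + E i ∈ cl S := by
  unfold cl
  simp only [Finset.mem_union, Finset.mem_biUnion, Finset.mem_univ, true_and, Finset.mem_image]
  exact Or.inr ⟨i, Or.inl ⟨x, hx, rfl⟩⟩

lemma sub_mem_cl {d : ℕ} {S : Finset (V d)} {x : V d} (hx : x ∈ S) (i : Fin d) : x - E i ∈ cl S := by
  unfold cl
  simp only [Finset.mem_union, Finset.mem_biUnion, Finset.mem_univ, true_and, Finset.mem_image]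
  exact Or.inr ⟨i, Or.inr ⟨x, hx, rfl⟩⟩

lemma mem_cl {d : ℕ} {S : Finset (V d)} {x : V d} (hx : x ∈ cl S) : x ∈ S ∨ ∃ i, x - E i ∈ S ∨ x + E i ∈ S := by
  unfold cl at hx
  simp only [Finset.mem_union, Finset.mem_biUnion, Finset.mem_univ, true_and, Finset.mem_image] at hx
  rcases hx with h | ⟨i, ⟨y, hy, rfl⟩ | ⟨y, hy, rfl⟩⟩
  · exact Or.inl h
  · exact Or.inr ⟨i, Or.inl (by simpa using hy)⟩
  · exact Or.inr ⟨i, Or.inr (by simpa using hy)⟩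

lemma shift_sum {d : ℕ} (S S' : Finset (V d)) (u φ : V d → ℝ) (hu : ∀ x, x ∉ S → u x = 0) (e : V d)
    (h : ∀ x ∈ S, x - e ∈ S') : ∑ x ∈ S', φ x * u (x + e) = ∑ x ∈ S, u x * φ (x - e) := by
  classical
  have h1 : ∑ x ∈ S, u x * φ (x - e) = ∑ x ∈ S.image (fun x => x - e), φ x * u (x + e) := by
    rw [Finset.sum_image (fun a _ b _ hab => by simpa using hab)]
    exact Finset.sum_congr rfl fun x _ => by rw [sub_add_cancel]; ring
  rw [h1]
  symm
  refine Finset.sum_subset ?_ ?_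
  · intro y hy
    obtain ⟨x, hx, rfl⟩ := Finset.mem_image.mp hy
    exact h x hx
  · intro x _ hx
    rw [hu, mul_zero]
    intro hmem
    exact hx (Finset.mem_image.mpr ⟨x + e, hmem, by simp⟩)

lemma green {d : ℕ} (S : Finset (V d)) (u φ : V d → ℝ) (hu : ∀ x, x ∉ S → u x = 0) :
    ∑ x ∈ cl S, φ x * lap u x = ∑ x ∈ S, u x * lap φ x := by
  have a1 : ∀ i, ∑ x ∈ cl S, φ x * u (x + E i) = ∑ x ∈ S, u x * φ (x - E i) := fun i =>
    shift_sum S (cl S) u φ hu (E i) fun x hx => sub_mem_cl hx i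
  have a2 : ∀ i, ∑ x ∈ cl S, φ x * u (x - E i) = ∑ x ∈ S, u x * φ (x + E i) := fun i => by
    have := shift_sum S (cl S) u φ hu (-E i) fun x hx => by simpa using add_mem_cl hx i
    simpa [← sub_eq_add_neg] using this
  have a3 : ∑ x ∈ cl S, φ x * u x = ∑ x ∈ S, u x * φ x := by
    rw [← Finset.sum_subset (subset_cl S)]
    · exact Finset.sum_congr rfl fun x _ => mul_comm _ _
    · intro x _ hx; rw [hu x hx, mul_zero]
  have e1 : ∀ x, φ x * lap u x = (∑ i, (φ x * u (x + E i) + φ x * u (x - E i))) / (2 * d) - φ x * u x := by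
    intro x; unfold lap; rw [mul_sub, ← mul_div_assoc, Finset.mul_sum]; simp only [mul_add]
  have e2 : ∀ x, u x * lap φ x = (∑ i, (u x * φ (x + E i) + u x * φ (x - E i))) / (2 * d) - u x * φ x := by
    intro x; unfold lap; rw [mul_sub, ← mul_div_assoc, Finset.mul_sum]; simp only [mul_add]
  simp only [e1, e2, Finset.sum_sub_distrib, a3, ← Finset.sum_div]
  congr 2
  rw [Finset.sum_comm, Finset.sum_comm (s := S)]
  refine Finset.sum_congr rfl fun i _ => ?_
  rw [Finset.sum_add_distrib, Finset.sum_add_distrib, a1, a2, add_comm]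

lemma green' {d : ℕ} (S : Finset (V d)) (u v : V d → ℝ) (hu : ∀ x, x ∉ S → u x = 0) (hv : ∀ x, x ∉ S → v x = 0) :
    ∑ x ∈ S, v x * lap u x = ∑ x ∈ S, u x * lap v x := by
  rw [← green S u v hu]
  refine Finset.sum_subset (subset_cl S) fun x _ hx => ?_
  rw [hv x hx, zero_mul]

end IDLA

open MeasureTheory Filter
open scoped ENNReal

namespace IDLA
open ProbabilityTheory

instance (d : ℕ) : Countable (V d) := inferInstanceAs (Countable (Fin d → ℤ))
instance (d : ℕ) : MeasurableSingletonClass (V d) := inferInstanceAs (MeasurableSingletonClass (Fin d → ℤ))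
instance (d : ℕ) : DiscreteMeasurableSpace (V d) := MeasurableSingletonClass.toDiscreteMeasurableSpace

lemma pick_mem {d : ℕ} {S : Finset (V d)} (h : S.Nonempty) (u : ℝ) : pick S u ∈ S := by
  unfold pick; rw [dif_pos h]; exact Subtype.prop _

lemma measurable_pick {d : ℕ} (S : Finset (V d)) : Measurable (pick S) := by
  by_cases h : S.Nonempty
  · have : pick S = (fun z : ℤ => ((S.equivFin.symm ⟨z.toNat % S.card,
      Nat.mod_lt _ (Finset.card_pos.mpr h)⟩).val : V d)) ∘ (fun u : ℝ => ⌊u * S.card⌋) := by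
      ext u; simp [pick, h]
    rw [this]
    exact (measurable_from_top).comp (Int.measurable_floor.comp (by fun_prop))
  · have : pick S = fun _ => 0 := by ext u; simp [pick, h]
    rw [this]; exact measurable_const

lemma prob_pick {d : ℕ} {S : Finset (V d)} {y : V d} (hy : y ∈ S) :
    μ0 {u | pick S u = y} = (S.card : ℝ≥0∞)⁻¹ := by
  have h : S.Nonempty := ⟨y, hy⟩
  have hc : 0 < S.card := Finset.card_pos.mpr h
  have hc' : (0:ℝ) < S.card := by exact_mod_cast hc
  set j := S.equivFin ⟨y, hy⟩ with hj
  have hms : MeasurableSet {u | pick S u = y} := measurable_pick S (measurableSet_singleton y)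
  rw [mu0_eq, Measure.restrict_apply hms]
  have : {u | pick S u = y} ∩ Set.Ico (0:ℝ) 1 = Set.Ico ((j:ℝ) / S.card) (((j:ℝ)+1) / S.card) := by
    ext u
    simp only [Set.mem_inter_iff, Set.mem_ofPred_eq, Set.mem_Ico]
    have hjlt : ((j:ℕ):ℝ) + 1 ≤ S.card := by exact_mod_cast j.2
    have hj0 : (0:ℝ) ≤ (j:ℕ) := Nat.cast_nonneg _
    have key : ∀ u, 0 ≤ u → u < 1 → (pick S u = y ↔ ⌊u * S.card⌋ = ((j:ℕ):ℤ)) := by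
      intro u h0 h1
      have hf0 : 0 ≤ ⌊u * S.card⌋ := Int.floor_nonneg.mpr (by positivity)
      have hf1 : ⌊u * S.card⌋ < S.card := Int.floor_lt.mpr (by push_cast; nlinarith)
      have hm : (⌊u * S.card⌋).toNat % S.card = (⌊u * S.card⌋).toNat := Nat.mod_eq_of_lt (by omega)
      unfold pick
      rw [dif_pos h]
      have : y = ((⟨y, hy⟩ : S) : V d) := rfl
      conv_lhs => rw [this, ← Subtype.ext_iff, Equiv.symm_apply_eq, ← hj, Fin.ext_iff]
      simp only [hm]
      omega
    constructor
    · rintro ⟨h1, h2, h3⟩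
      rw [key u h2 h3, Int.floor_eq_iff] at h1
      push_cast at h1
      exact ⟨by rw [div_le_iff₀ hc']; exact h1.1, by rw [lt_div_iff₀ hc']; exact h1.2⟩
    · rintro ⟨h1, h2⟩
      have h3 : 0 ≤ u := le_trans (by positivity) h1
      have h4 : u < 1 := lt_of_lt_of_le h2 (by rw [div_le_one hc']; exact hjlt)
      rw [key u h3 h4, Int.floor_eq_iff]
      push_cast
      rw [div_le_iff₀ hc'] at h1; rw [lt_div_iff₀ hc'] at h2
      exact ⟨⟨h1, h2⟩, h3, h4⟩
  rw [this, Real.volume_Ico, ← sub_div, add_sub_cancel_left, one_div, ENNReal.ofReal_inv_of_pos hc',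
    ENNReal.ofReal_natCast]

lemma pick_indep {d : ℕ} {X Y : Type*} [MeasurableSpace X] [MeasurableSpace Y] (m : Measure X)
    {T : Finset (V d)} (hT : T.Nonempty) {a : X → ℝ} {b : X → Y} (ha : Measurable a) (hb : Measurable b)
    (hmap : m.map a = μ0) (hind : IndepFun a b m) (G : V d → Set Y) (hG : ∀ y, MeasurableSet (G y)) :
    m {x | b x ∈ G (pick T (a x))} = ∑ y ∈ T, (T.card : ℝ≥0∞)⁻¹ * m (b ⁻¹' (G y)) := by
  have h1 : {x | b x ∈ G (pick T (a x))} = ⋃ y ∈ T, (a ⁻¹' {u | pick T u = y} ∩ b ⁻¹' (G y)) := by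
    ext x
    simp only [Set.mem_ofPred_eq, Set.mem_iUnion, Set.mem_inter_iff, Set.mem_preimage, exists_prop]
    constructor
    · intro h; exact ⟨_, pick_mem hT (a x), rfl, h⟩
    · rintro ⟨y, _, rfl, h⟩; exact h
  have hmp : ∀ y, MeasurableSet {u | pick T u = y} := fun y => measurable_pick T (measurableSet_singleton y)
  rw [h1, measure_biUnion_finset]
  · refine Finset.sum_congr rfl fun y hy => ?_
    rw [hind.measure_inter_preimage_eq_mul _ _ (hmp y) (hG y), ← Measure.map_apply ha (hmp y), hmap, prob_pick hy]
  · intro y _ y' _ hne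
    refine Set.disjoint_left.mpr ?_
    rintro x ⟨h1, _⟩ ⟨h2, _⟩
    exact hne (h1.symm.trans h2)
  · exact fun y _ => (ha (hmp y)).inter (hb (hG y))

lemma card_unitVecs_sum {d : ℕ} {M : Type*} [AddCommMonoid M] (f : V d → M) :
    ∑ e ∈ unitVecs d, f e = ∑ i, (f (E i) + f (-E i)) := by
  unfold unitVecs
  rw [Finset.sum_image]
  · rw [Fintype.sum_prod_type]
    refine Finset.sum_congr rfl fun i _ => ?_
    rw [Fintype.sum_bool]
    congr 2
    · ext j; by_cases h : j = i
      · subst h; simp [E]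
      · simp [E, h]
    · ext j; by_cases h : j = i
      · subst h; simp [E]
      · simp [E, h]
  · rintro ⟨i, b⟩ _ ⟨i', b'⟩ _ h
    have h1 := congrFun h i
    have hii : i = i' := by
      by_contra hne
      simp only [if_neg hne] at h1
      cases b <;> simp at h1
    subst hii
    simp at h1
    cases b <;> cases b' <;> simp_all

lemma card_unitVecs {d : ℕ} : (unitVecs d).card = 2 * d := by
  have := card_unitVecs_sum (d := d) (fun _ => 1)
  simp at this; omega

lemma unitVecs_nonempty {d : ℕ} (hd : 0 < d) : (unitVecs d).Nonempty :=
  Finset.card_pos.mp (by rw [card_unitVecs]; omega)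

/-! walks on sequence space -/

noncomputable def walkS {d : ℕ} (x : V d) (s : ℕ → ℝ) (t : ℕ) : V d :=
  x + ∑ i ∈ Finset.range t, pick (unitVecs d) (s i)

noncomputable def exS {d : ℕ} (S : Finset (V d)) (x : V d) (s : ℕ → ℝ) : ℕ := sInf {t | walkS x s t ∉ S}

noncomputable def hitS {d : ℕ} (S : Finset (V d)) (x : V d) (s : ℕ → ℝ) : V d :=
  walkS x s (exS S x s)

def shft (s : ℕ → ℝ) : ℕ → ℝ := fun i => s (i+1)

lemma hitPt_eq {d : ℕ} (S : Finset (V d)) (x : V d) (ω : ℝ) : hitPt S x ω = hitS S x (fun i => uSlice ω i) := rfl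

lemma walkS_succ {d : ℕ} (x : V d) (s : ℕ → ℝ) (t : ℕ) :
    walkS x s (t+1) = walkS (x + pick (unitVecs d) (s 0)) (shft s) t := by
  unfold walkS shft; rw [Finset.sum_range_succ']; abel

lemma walkS_zero {d : ℕ} (x : V d) (s : ℕ → ℝ) : walkS x s 0 = x := by simp [walkS]

lemma measurable_walkS {d : ℕ} (x : V d) (t : ℕ) : Measurable (fun s => walkS x s t) := by
  unfold walkS
  refine measurable_const.add ?_
  refine Finset.measurable_sum _ fun i _ => (measurable_pick _).comp (measurable_pi_apply i)

lemma measurable_exS {d : ℕ} (S : Finset (V d)) (x : V d) : Measurable (exS S x) := by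
    refine measurable_to_countable' fun t => ?_
    have hm : ∀ t, MeasurableSet {s | walkS x s t ∈ S} := fun t =>
      measurable_walkS x t (Set.Finite.measurableSet S.finite_toSet)
    by_cases h0 : t = 0
    · have : exS S x ⁻¹' {t} = {s | walkS x s 0 ∈ S}ᶜ ∪ ⋂ t, {s | walkS x s t ∈ S} := by
        ext s
        simp only [Set.mem_preimage, Set.mem_singleton_iff, exS, h0, Nat.sInf_eq_zero, Set.mem_union, Set.mem_compl_iff,
          Set.mem_ofPred_eq, Set.mem_iInter, Set.eq_empty_iff_forall_notMem, not_not]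
      rw [this]
      exact (hm 0).compl.union (MeasurableSet.iInter hm)
    · have : exS S x ⁻¹' {t} = {s | walkS x s t ∈ S}ᶜ ∩ ⋂ j ∈ Finset.range t, {s | walkS x s j ∈ S} := by
        ext s
        simp only [Set.mem_preimage, Set.mem_singleton_iff, exS, Set.mem_inter_iff, Set.mem_compl_iff,
          Set.mem_ofPred_eq, Set.mem_iInter, Finset.mem_range]
        constructor
        · intro h
          have hne : {t | walkS x s t ∉ S}.Nonempty := by
            by_contra hne
            rw [Set.not_nonempty_iff_eq_empty] at hne
            rw [hne, Nat.sInf_empty] at h; exact h0 h.symm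
          refine ⟨h ▸ Nat.sInf_mem hne, fun j hj => ?_⟩
          have := Nat.notMem_of_lt_sInf (h.symm ▸ hj)
          simpa using this
        · rintro ⟨h1, h2⟩
          refine le_antisymm (Nat.sInf_le h1) ?_
          by_contra hlt
          push Not at hlt
          have hmem := Nat.sInf_mem (s := {t | walkS x s t ∉ S}) ⟨t, h1⟩
          exact hmem (h2 _ hlt)
      rw [this]
      exact (hm t).compl.inter (MeasurableSet.biInter (Finset.countable_toSet _) fun j _ => hm j)

lemma measurable_hitS {d : ℕ} (S : Finset (V d)) (x : V d) : Measurable (hitS S x) := by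
  refine measurable_to_countable' fun y => ?_
  have : hitS S x ⁻¹' {y} = ⋃ t, exS S x ⁻¹' {t} ∩ (fun s => walkS x s t) ⁻¹' {y} := by
    ext s
    simp only [Set.mem_preimage, Set.mem_singleton_iff, Set.mem_iUnion, Set.mem_inter_iff, hitS]
    constructor
    · intro h; exact ⟨_, rfl, h⟩
    · rintro ⟨t, rfl, h⟩; exact h
  rw [this]
  exact MeasurableSet.iUnion fun t => (measurable_exS S x (measurableSet_singleton t)).inter
    (measurable_walkS x t (measurableSet_singleton y))

end IDLA

open MeasureTheory Filter
open scoped ENNReal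

namespace IDLA
open ProbabilityTheory

/-- sigma algebra of slices with index in `I` -/
@[reducible] noncomputable def sig (I : Set ℕ) : MeasurableSpace ℝ := ⨆ i ∈ I, MeasurableSpace.comap (fun x => uSlice x i) inferInstance

lemma sig_le (I : Set ℕ) : sig I ≤ (inferInstance : MeasurableSpace ℝ) :=
  iSup₂_le fun i _ => (measurable_uSlice i).comap_le

lemma sig_mono {I J : Set ℕ} (h : I ⊆ J) : sig I ≤ sig J :=
  iSup₂_le fun i hi => le_iSup₂_of_le i (h hi) le_rfl

lemma sig_uSlice {I : Set ℕ} {i : ℕ} (hi : i ∈ I) : Measurable[sig I] (fun x => uSlice x i) := by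
  rw [measurable_iff_comap_le]
  exact le_iSup₂_of_le (f := fun i (_ : i ∈ I) => MeasurableSpace.comap (fun x => uSlice x i) inferInstance) i hi le_rfl

lemma sig_indep {I J : Set ℕ} (h : Disjoint I J) : Indep (sig I) (sig J) μ0 :=
  indep_iSup_of_disjoint (fun i => (measurable_uSlice i).comap_le) iIndep_uSlice h

lemma indep_of_sig {Y Z : Type*} [MeasurableSpace Y] [MeasurableSpace Z] {I J : Set ℕ} (h : Disjoint I J)
    {a : ℝ → Y} {b : ℝ → Z} (ha : Measurable[sig I] a) (hb : Measurable[sig J] b) : IndepFun a b μ0 := by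
  rw [IndepFun_iff_Indep]
  exact indep_of_indep_of_le_left (indep_of_indep_of_le_right (sig_indep h) (measurable_iff_comap_le.mp hb))
    (measurable_iff_comap_le.mp ha)

/-- law of the seed sequence -/
noncomputable def PS : Measure (ℕ → ℝ) := Measure.infinitePi (fun _ : ℕ => μ0)

instance : IsProbabilityMeasure PS := by unfold PS; infer_instance

lemma map_PS : μ0.map (fun x i => uSlice x i) = PS := map_slices

lemma meas_seq : Measurable (fun x i => uSlice x i) := measurable_pi_lambda _ measurable_uSlice
lemma meas_seq' : Measurable (fun x i => uSlice x (i+1)) := measurable_pi_lambda _ fun i => measurable_uSlice (i+1)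

lemma map_PS' : μ0.map (fun x i => uSlice x (i+1)) = PS := by
  have h : (fun (x:ℝ) (i:ℕ) => uSlice x (i+1)) = (fun (f : ℕ → ℝ) (i : ℕ) => f (i+1)) ∘ (fun x i => uSlice x i) := rfl
  rw [h, ← Measure.map_map (measurable_pi_lambda _ fun i => measurable_pi_apply _) meas_seq, map_slices]
  exact Measure.map_infinitePi_infinitePi_of_inj (P := fun _ : ℕ => μ0) (f := fun i : ℕ => i+1)
    (fun a b h => by simpa using h)

/-- first step analysis -/
lemma first_step {d : ℕ} (hd : 0 < d) (G : V d → Set (ℕ → ℝ)) (hG : ∀ y, MeasurableSet (G y)) (x : V d)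
    (H : Set (ℕ → ℝ)) (hH : MeasurableSet H)
    (heq : ∀ s, s ∈ H ↔ shft s ∈ G (x + pick (unitVecs d) (s 0))) :
    lap (fun y => (PS (G y)).toReal) x = (PS H).toReal - (PS (G x)).toReal := by
  have h1 : PS H = ∑ e ∈ unitVecs d, ((unitVecs d).card : ℝ≥0∞)⁻¹ * PS (G (x + e)) := by
    rw [← map_PS, Measure.map_apply meas_seq hH, map_PS]
    have : (fun x i => uSlice x i) ⁻¹' H =
      {ω : ℝ | (fun i => uSlice ω (i+1)) ∈ (fun e => G (x + e)) (pick (unitVecs d) (uSlice ω 0))} := by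
      ext ω
      exact heq (fun i => uSlice ω i)
    rw [this]
    refine (pick_indep μ0 (unitVecs_nonempty hd) (measurable_uSlice 0) meas_seq' (map_uSlice 0) ?_ (fun e => G (x + e)) ?_).trans ?_
    rotate_right
    · refine Finset.sum_congr rfl fun e _ => ?_
      rw [← Measure.map_apply meas_seq' (hG _), map_PS']
    · refine indep_of_sig (I := {0}) (J := {i | 0 < i}) (by simp) (sig_uSlice rfl) ?_
      exact @measurable_pi_lambda _ _ _ (sig _) _ _ (fun i => sig_uSlice (Nat.succ_pos i))
    · exact fun y => hG _
  rw [h1, ENNReal.toReal_sum]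
  · simp only [ENNReal.toReal_mul, card_unitVecs, ENNReal.toReal_inv, ENNReal.toReal_natCast]
    rw [← Finset.mul_sum, card_unitVecs_sum (fun e => (PS (G (x+e))).toReal)]
    unfold lap
    simp only [sub_eq_add_neg]
    push_cast
    rw [div_eq_inv_mul]
  · intro e _
    exact ENNReal.mul_ne_top (by simp [card_unitVecs]; omega) (measure_ne_top _ _)

/-- the walk leaves `S` -/
lemma exits {d : ℕ} (hd : 0 < d) (S : Finset (V d)) (x : V d) : PS {s | ∀ t, walkS x s t ∈ S} = 0 := by
  have hm : ∀ x, MeasurableSet {s | ∀ t, walkS x s t ∈ S} := fun x => by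
    have : {s | ∀ t, walkS x s t ∈ S} = ⋂ t, (fun s => walkS x s t) ⁻¹' S := by ext; simp
    rw [this]
    exact MeasurableSet.iInter fun t => measurable_walkS x t (Set.Finite.measurableSet S.finite_toSet)
  have h0 : ∀ x, x ∉ S → {s | ∀ t, walkS x s t ∈ S} = ∅ := by
    intro x hx
    ext s
    simp only [Set.mem_ofPred_eq, Set.mem_empty_iff_false, iff_false, not_forall]
    exact ⟨0, by rwa [walkS_zero]⟩
  by_cases hx : x ∈ S
  · have := max_principle hd S (fun y => (PS {s | ∀ t, walkS y s t ∈ S}).toReal) (fun x hx => by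
      rw [first_step hd (fun y => {s | ∀ t, walkS y s t ∈ S}) hm x {s | ∀ t, walkS x s t ∈ S} (hm x)]
      · simp
      · intro s
        simp only [Set.mem_ofPred_eq]
        constructor
        · intro h t; rw [← walkS_succ]; exact h _
        · intro h t
          cases t with
          | zero => rwa [walkS_zero]
          | succ t => rw [walkS_succ]; exact h _) (fun x hx _ => by rw [h0 x hx]; simp) x hx
    have h2 := le_antisymm this ENNReal.toReal_nonneg
    exact (ENNReal.toReal_eq_zero_iff _).mp h2 |>.resolve_right (measure_ne_top _ _)
  · rw [h0 x hx]; simp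

lemma exS_zero {d : ℕ} {S : Finset (V d)} {x : V d} (hx : x ∉ S) (s : ℕ → ℝ) : exS S x s = 0 := by
  unfold exS
  exact Nat.sInf_eq_zero.mpr (Or.inl (by simpa [walkS_zero] using hx))

lemma hitS_step {d : ℕ} {S : Finset (V d)} {x : V d} (hx : x ∈ S) (s : ℕ → ℝ) (h : ∃ t, walkS x s t ∉ S) :
    hitS S x s = hitS S (x + pick (unitVecs d) (s 0)) (shft s) := by
  have h' : ∃ t, walkS (x + pick (unitVecs d) (s 0)) (shft s) t ∉ S := by
    obtain ⟨t, ht⟩ := h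
    cases t with
    | zero => rw [walkS_zero] at ht; exact absurd hx ht
    | succ t => exact ⟨t, by rwa [← walkS_succ]⟩
  have : exS S x s = exS S (x + pick (unitVecs d) (s 0)) (shft s) + 1 := by
    unfold exS
    have h1 := Nat.sInf_mem (s := {t | walkS (x + pick (unitVecs d) (s 0)) (shft s) t ∉ S}) h'
    apply le_antisymm
    · refine Nat.sInf_le ?_
      rw [Set.mem_ofPred_eq, walkS_succ]; exact h1
    · have h2 := Nat.sInf_mem (s := {t | walkS x s t ∉ S}) h
      set k := sInf {t | walkS x s t ∉ S}
      cases hk : k with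
      | zero => rw [hk, Set.mem_ofPred_eq, walkS_zero] at h2; exact absurd hx h2
      | succ k' =>
        rw [hk, Set.mem_ofPred_eq, walkS_succ] at h2
        exact Nat.succ_le_succ (Nat.sInf_le h2)
  unfold hitS
  rw [this, walkS_succ]

noncomputable def qx {d : ℕ} (S : Finset (V d)) (x y : V d) : ℝ := (PS {s | hitS S x s = y}).toReal

lemma qx_off {d : ℕ} {S : Finset (V d)} {x : V d} (hx : x ∉ S) (y : V d) : qx S x y = if x = y then 1 else 0 := by
  unfold qx
  have : ∀ s, hitS S x s = x := fun s => by rw [hitS, exS_zero hx, walkS_zero]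
  simp only [this]
  split_ifs with h <;> simp [h]

lemma qx_lap {d : ℕ} (hd : 0 < d) {S : Finset (V d)} {x : V d} (hx : x ∈ S) (y : V d) :
    lap (fun x => qx S x y) x = 0 := by
  have hm : ∀ x, MeasurableSet {s | hitS S x s = y} := fun x => measurable_hitS S x (measurableSet_singleton y)
  have hms : Measurable shft := measurable_pi_lambda _ fun i => measurable_pi_apply (i+1)
  have hH : MeasurableSet {s | shft s ∈ {s' | hitS S (x + pick (unitVecs d) (s 0)) s' = y}} := by
    have : {s | shft s ∈ {s' | hitS S (x + pick (unitVecs d) (s 0)) s' = y}} =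
        ⋃ e : V d, ((fun s : ℕ → ℝ => s 0) ⁻¹' (pick (unitVecs d) ⁻¹' {e})) ∩ shft ⁻¹' {s' | hitS S (x + e) s' = y} := by
      ext s
      simp
    rw [this]
    exact MeasurableSet.iUnion fun e => ((measurable_pi_apply 0) (measurable_pick _ (measurableSet_singleton e))).inter
      (hms (hm _))
  have := first_step hd (fun x => {s | hitS S x s = y}) hm x _ hH (fun s => Iff.rfl)
  unfold qx
  rw [this, sub_eq_zero]
  congr 1
  apply measure_congr
  have hex := exits hd S x
  rw [← compl_compl {s | ∀ t, walkS x s t ∈ S}, ← mem_ae_iff] at hex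
  filter_upwards [hex] with s hs
  have hs' : ∃ t, walkS x s t ∉ S := by simpa using hs
  apply propext
  change hitS S (x + pick (unitVecs d) (s 0)) (shft s) = y ↔ hitS S x s = y
  rw [hitS_step hx s hs']

lemma qx_nonneg {d : ℕ} (S : Finset (V d)) (x y : V d) : 0 ≤ qx S x y := ENNReal.toReal_nonneg

lemma qx_sum {d : ℕ} (hd : 0 < d) (S : Finset (V d)) (f w : V d → ℝ) (hw : ∀ x, x ∉ S → w x = f x)
    (hl : ∀ x ∈ S, lap w x = 0) {x : V d} (hx : x ∈ S) : ∑ y ∈ cl S \ S, qx S x y * f y = w x := by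
  have h1 : ∀ x ∈ S, lap (fun x => ∑ y ∈ cl S \ S, qx S x y * f y) x = 0 := by
    intro x hx
    rw [lap_sum]
    refine Finset.sum_eq_zero fun y _ => ?_
    have : (fun x => qx S x y * f y) = fun x => f y * qx S x y := by ext; ring
    rw [this, lap_const_mul, qx_lap hd hx, mul_zero]
  have h2 : ∀ x, x ∉ S → (∃ i, x - E i ∈ S ∨ x + E i ∈ S) → ∑ y ∈ cl S \ S, qx S x y * f y = w x := by
    intro x hx hn
    have hc : x ∈ cl S \ S := by
      refine Finset.mem_sdiff.mpr ⟨?_, hx⟩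
      obtain ⟨i, h | h⟩ := hn
      · simpa using add_mem_cl h i
      · simpa using sub_mem_cl h i
    rw [hw x hx]
    simp only [qx_off hx, ite_mul, one_mul, zero_mul, Finset.sum_ite_eq, hc, if_true]
  exact le_antisymm (max_principle' hd S w _ (fun x hx => by rw [hl x hx, h1 x hx]) (fun x hx hn => (h2 x hx hn).le) x hx)
    (max_principle' hd S _ w (fun x hx => by rw [hl x hx, h1 x hx]) (fun x hx hn => (h2 x hx hn).ge) x hx)

/-- law of the new point -/
noncomputable def q {d : ℕ} (S : Finset (V d)) (y : V d) : ℝ := (∑ x ∈ S, qx S x y) / S.card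

lemma q_nonneg {d : ℕ} (S : Finset (V d)) (y : V d) : 0 ≤ q S y :=
  div_nonneg (Finset.sum_nonneg fun _ _ => qx_nonneg _ _ _) (Nat.cast_nonneg _)

lemma q_sum {d : ℕ} (hd : 0 < d) (S : Finset (V d)) (f w : V d → ℝ) (hw : ∀ x, x ∉ S → w x = f x)
    (hl : ∀ x ∈ S, lap w x = 0) : ∑ y ∈ cl S \ S, q S y * f y = (∑ x ∈ S, w x) / S.card := by
  have : ∀ y, q S y * f y = (∑ x ∈ S, qx S x y * f y) / S.card := by
    intro y; unfold q; rw [div_mul_eq_mul_div, Finset.sum_mul]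
  simp only [this]
  rw [← Finset.sum_div, Finset.sum_comm]
  congr 1
  exact Finset.sum_congr rfl fun x hx => qx_sum hd S f w hw hl hx

lemma q_total {d : ℕ} (hd : 0 < d) {S : Finset (V d)} (hS : S.Nonempty) : ∑ y ∈ cl S \ S, q S y = 1 := by
  have := q_sum hd S (fun _ => 1) (fun _ => 1) (fun _ _ => rfl) (fun x _ => lap_const hd 1 x)
  simp only [mul_one, Finset.sum_const, nsmul_eq_mul] at this
  rw [this, div_self]
  exact_mod_cast (Finset.card_pos.mpr hS).ne'

/-- subharmonic functions increase -/
lemma q_sub {d : ℕ} (hd : 0 < d) (S : Finset (V d)) (f : V d → ℝ) (hf : ∀ x ∈ S, 0 ≤ lap f x) :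
    (∑ x ∈ S, f x) / S.card ≤ ∑ y ∈ cl S \ S, q S y * f y := by
  obtain ⟨w, hw, hl⟩ := dirichlet hd S f (fun _ => 0)
  rw [q_sum hd S f w hw hl]
  gcongr with x hx
  exact max_principle' hd S w f (fun x hx => by rw [hl x hx]; exact hf x hx) (fun x hx _ => (hw x hx).ge) x hx

lemma q_nbr {d : ℕ} (hd : 0 < d) (S : Finset (V d)) {z w : V d} (hz : z ∉ S) (hw : w ∈ S)
    (hn : ∃ i, z = w + E i ∨ z = w - E i) : 1 / (2 * d * S.card) ≤ q S z := by
  have hzc : z ∈ cl S \ S := by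
    refine Finset.mem_sdiff.mpr ⟨?_, hz⟩
    obtain ⟨i, rfl | rfl⟩ := hn
    · exact add_mem_cl hw i
    · exact sub_mem_cl hw i
  have hdp : (0:ℝ) < d := by exact_mod_cast hd
  have hcp : (0:ℝ) < S.card := by exact_mod_cast Finset.card_pos.mpr ⟨w, hw⟩
  obtain ⟨v, hv, hl⟩ := dirichlet hd S (fun y => if y = z then (1:ℝ) else 0) (fun _ => 0)
  have hsum := q_sum hd S _ v hv hl
  simp only [mul_ite, mul_one, mul_zero, Finset.sum_ite_eq', hzc, if_true] at hsum
  rw [hsum, div_eq_mul_inv, div_eq_mul_inv, mul_inv, one_mul]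
  gcongr
  have hv0 : ∀ x, 0 ≤ v x := by
    intro x
    by_cases hx : x ∈ S
    · refine le_trans ?_ (max_principle' hd S v (fun _ => 0) (fun x hx => by rw [hl x hx, lap_const hd]) (fun x hx _ => ?_) x hx)
      · rfl
      · rw [hv x hx]; split_ifs <;> norm_num
    · rw [hv x hx]; split_ifs <;> norm_num
  have hvw : ((2:ℝ) * d)⁻¹ ≤ v w := by
    have h := hl w hw
    unfold lap at h
    have hvz : v z = 1 := by rw [hv z hz]; simp
    have h2 : 1 ≤ ∑ i, (v (w + E i) + v (w - E i)) := by
      obtain ⟨i, hi⟩ := hn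
      refine le_trans ?_ (Finset.single_le_sum (f := fun i => v (w + E i) + v (w - E i)) (fun j _ => add_nonneg (hv0 _) (hv0 _)) (Finset.mem_univ i))
      rcases hi with rfl | rfl
      · simp only [hvz]; linarith [hv0 (w - E i)]
      · simp only [hvz]; linarith [hv0 (w + E i)]
    have : v w = (∑ i, (v (w + E i) + v (w - E i))) / (2 * d) := by linarith
    rw [this, inv_eq_one_div]
    gcongr
  exact hvw.trans (Finset.single_le_sum (fun x _ => hv0 x) hw)

end IDLA

open MeasureTheory Filter
open scoped ENNReal

namespace IDLA
open ProbabilityTheory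

instance (d : ℕ) : Countable (Finset (V d)) := inferInstance
instance (d : ℕ) : DiscreteMeasurableSpace (Finset (V d)) := ⟨fun _ => trivial⟩

lemma measurable_hitPt {d : ℕ} (S : Finset (V d)) (x : V d) : Measurable (hitPt S x) :=
  (measurable_hitS S x).comp meas_seq

noncomputable def newPt {d : ℕ} (S : Finset (V d)) (ω : ℝ) : V d := hitPt S (pick S (uSlice ω 0)) (uSlice ω 1)

lemma uStep_eq {d : ℕ} (S : Finset (V d)) (ω : ℝ) : uStep S ω = insert (newPt S ω) S := rfl

lemma measurable_newPt {d : ℕ} (S : Finset (V d)) : Measurable (newPt S) := by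
  refine measurable_to_countable' fun y => ?_
  have : newPt S ⁻¹' {y} = ⋃ x : V d, ((fun ω => uSlice ω 0) ⁻¹' (pick S ⁻¹' {x})) ∩
      ((fun ω => uSlice ω 1) ⁻¹' (hitPt S x ⁻¹' {y})) := by
    ext ω; simp [newPt]
  rw [this]
  exact MeasurableSet.iUnion fun x => ((measurable_uSlice 0) (measurable_pick _ (measurableSet_singleton x))).inter
    ((measurable_uSlice 1) (measurable_hitPt S x (measurableSet_singleton y)))

lemma law_newPt {d : ℕ} {S : Finset (V d)} (hS : S.Nonempty) (y : V d) :
    μ0 {ω | newPt S ω = y} = ENNReal.ofReal (q S y) := by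
  have h := pick_indep (Y := ℝ) μ0 hS (measurable_uSlice 0) (measurable_uSlice 1) (map_uSlice 0)
    (indep_of_sig (I := {0}) (J := {1}) (by simp) (sig_uSlice rfl) (sig_uSlice rfl))
    (fun x => {ω' | hitPt S x ω' = y}) (fun x => measurable_hitPt S x (measurableSet_singleton y))
  have h0 : ∀ x, μ0 ((fun ω => uSlice ω 1) ⁻¹' {ω' | hitPt S x ω' = y}) = ENNReal.ofReal (qx S x y) := by
    intro x
    have hm : MeasurableSet {ω' | hitPt S x ω' = y} := measurable_hitPt S x (measurableSet_singleton y)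
    have hm' : MeasurableSet {s | hitS S x s = y} := measurable_hitS S x (measurableSet_singleton y)
    rw [← Measure.map_apply (measurable_uSlice 1) hm, map_uSlice, qx, ENNReal.ofReal_toReal (measure_ne_top _ _),
      ← map_PS, Measure.map_apply meas_seq hm']
    rfl
  refine Eq.trans ?_ (h.trans ?_)
  · rfl
  · simp only [h0]
    unfold q
    rw [← Finset.mul_sum, ENNReal.ofReal_div_of_pos (by exact_mod_cast Finset.card_pos.mpr hS),
      ENNReal.ofReal_natCast, ENNReal.ofReal_sum_of_nonneg (fun x _ => qx_nonneg _ _ _), ENNReal.div_eq_inv_mul]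

lemma newPt_mem {d : ℕ} (hd : 0 < d) {S : Finset (V d)} (hS : S.Nonempty) :
    ∀ᵐ ω ∂μ0, newPt S ω ∈ cl S \ S := by
  have hm : ∀ y, MeasurableSet {ω | newPt S ω = y} := fun y => measurable_newPt S (measurableSet_singleton y)
  have hU : {ω | newPt S ω ∈ cl S \ S} = ⋃ y ∈ cl S \ S, {ω | newPt S ω = y} := by ext; simp
  have hp : μ0 {ω | newPt S ω ∈ cl S \ S} = 1 := by
    rw [hU, measure_biUnion_finset]
    · simp only [law_newPt hS]
      rw [← ENNReal.ofReal_sum_of_nonneg (fun y _ => q_nonneg S y), q_total hd hS, ENNReal.ofReal_one]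
    · intro y _ y' _ hne
      refine Set.disjoint_left.mpr ?_
      intro x h1 h2
      exact hne (Eq.trans (Eq.symm h1) h2)
    · exact fun y _ => hm y
  exact (prob_compl_eq_zero_iff (measurable_newPt S (Set.Finite.measurableSet (Finset.finite_toSet _)))).mpr hp

lemma step_lint {d : ℕ} (hd : 0 < d) {S : Finset (V d)} (hS : S.Nonempty) (F : Finset (V d) → ℝ≥0∞) :
    ∫⁻ ω, F (uStep S ω) ∂μ0 = ∑ y ∈ cl S \ S, ENNReal.ofReal (q S y) * F (insert y S) := by
  have hm : ∀ y, MeasurableSet {ω | newPt S ω = y} := fun y => measurable_newPt S (measurableSet_singleton y)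
  have h1 : ∫⁻ ω, F (uStep S ω) ∂μ0 = ∫⁻ ω, ∑ y ∈ cl S \ S, {ω | newPt S ω = y}.indicator (fun _ => F (insert y S)) ω ∂μ0 := by
    apply lintegral_congr_ae
    filter_upwards [newPt_mem hd hS] with ω hω
    rw [uStep_eq]
    simp only [Set.indicator_apply, Set.mem_ofPred_eq, Finset.sum_ite_eq, hω, if_true]
  rw [h1, lintegral_finsetSum]
  · refine Finset.sum_congr rfl fun y _ => ?_
    rw [lintegral_indicator (hm y), setLIntegral_const, law_newPt hS, mul_comm]
  · exact fun y _ => measurable_const.indicator (hm y)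

lemma measurable_uStep {d : ℕ} (S : Finset (V d)) : Measurable (uStep S) := by
  have : uStep S = (fun y => insert y S) ∘ newPt S := rfl
  rw [this]
  exact (Measurable.of_discrete).comp (measurable_newPt S)

lemma measurable_agg {d : ℕ} (S : Finset (V d)) (k : ℕ) : Measurable[sig (Set.Iio k)] (fun ω => uAggFrom S ω k) := by
  induction k with
  | zero => exact @measurable_const _ _ _ (sig _) S
  | succ k ih =>
    intro s _
    have : (fun ω => uAggFrom S ω (k+1)) ⁻¹' s = ⋃ B : Finset (V d), ((fun ω => uAggFrom S ω k) ⁻¹' {B}) ∩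
        ((fun ω => uSlice ω k) ⁻¹' (uStep B ⁻¹' s)) := by
      ext ω; simp [uAggFrom]
    rw [this]
    refine @MeasurableSet.iUnion _ _ (sig _) _ _ fun B => ?_
    refine @MeasurableSet.inter _ (sig _) _ _ ?_ ?_
    · exact sig_mono (fun i hi => Nat.lt_succ_of_lt hi) _ (ih (measurableSet_singleton B))
    · exact sig_uSlice (I := Set.Iio (k+1)) (i := k) (Set.mem_Iio.mpr (Nat.lt_succ_self k)) (measurable_uStep B trivial)

lemma measurable_agg' {d : ℕ} (S : Finset (V d)) (k : ℕ) : Measurable (fun ω => uAggFrom S ω k) :=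
  (measurable_agg S k).mono (sig_le _) le_rfl

lemma agg_mono {d : ℕ} (S : Finset (V d)) (ω : ℝ) : Monotone (uAggFrom S ω) :=
  monotone_nat_of_le_succ fun k => by
    change uAggFrom S ω k ⊆ uStep (uAggFrom S ω k) (uSlice ω k)
    rw [uStep_eq]; exact Finset.subset_insert _ _

lemma step_agg {d : ℕ} (hd : 0 < d) {S : Finset (V d)} (hS : S.Nonempty) (k : ℕ) (F : Finset (V d) → ℝ≥0∞) :
    ∫⁻ ω, F (uAggFrom S ω (k+1)) ∂μ0 =
    ∫⁻ ω, ∑ y ∈ cl (uAggFrom S ω k) \ (uAggFrom S ω k), ENNReal.ofReal (q (uAggFrom S ω k) y) * F (insert y (uAggFrom S ω k)) ∂μ0 := by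
  have hind : IndepFun (fun ω => uAggFrom S ω k) (fun ω => uSlice ω k) μ0 :=
    indep_of_sig (I := Set.Iio k) (J := {k}) (by simp) (measurable_agg S k) (sig_uSlice rfl)
  rw [indepFun_iff_map_prod_eq_prod_map_map (measurable_agg' S k).aemeasurable (measurable_uSlice k).aemeasurable,
    map_uSlice] at hind
  have hG : Measurable (fun p : Finset (V d) × ℝ => F (uStep p.1 p.2)) :=
    measurable_from_prod_countable_right fun B => (Measurable.of_discrete (f := F)).comp (measurable_uStep B)
  have h1 : ∫⁻ ω, F (uAggFrom S ω (k+1)) ∂μ0 = ∫⁻ p, F (uStep p.1 p.2) ∂(μ0.map (fun ω => (uAggFrom S ω k, uSlice ω k))) := by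
    rw [lintegral_map hG ((measurable_agg' S k).prodMk (measurable_uSlice k))]
    rfl
  rw [h1, hind, lintegral_prod _ hG.aemeasurable, lintegral_map Measurable.of_discrete (measurable_agg' S k)]
  refine lintegral_congr fun ω => ?_
  exact step_lint hd (hS.mono (agg_mono S ω (Nat.zero_le k))) F

lemma ae_good {d : ℕ} (hd : 0 < d) {S : Finset (V d)} (hS : S.Nonempty) : ∀ᵐ ω ∂μ0, ∀ k,
    ∃ y ∈ cl (uAggFrom S ω k) \ (uAggFrom S ω k), uAggFrom S ω (k+1) = insert y (uAggFrom S ω k) := by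
  have h1 : ∀ B : Finset (V d), ∀ k, ∀ᵐ ω ∂μ0, B.Nonempty → newPt B (uSlice ω k) ∈ cl B \ B := by
    intro B k
    by_cases hB : B.Nonempty
    · have := newPt_mem hd hB
      rw [← map_uSlice k] at this
      filter_upwards [ae_of_ae_map (measurable_uSlice k).aemeasurable this] with ω h _ using h
    · exact Eventually.of_forall fun ω h => absurd h hB
  have h2 := ae_all_iff.mpr fun B => ae_all_iff.mpr (h1 B)
  filter_upwards [h2] with ω h k
  exact ⟨_, h _ k (hS.mono (agg_mono S ω (Nat.zero_le k))), uStep_eq _ _⟩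

def l1 {d : ℕ} (x : V d) : ℤ := ∑ i, |x i|

lemma l1_add_E {d : ℕ} (x : V d) (i : Fin d) : l1 (x + E i) ≤ l1 x + 1 := by
  unfold l1
  have : ∀ j, |(x + E i) j| ≤ |x j| + if j = i then 1 else 0 := by
    intro j
    by_cases h : j = i
    · subst h; simp [E_same]; exact (abs_add_le _ _).trans (by simp)
    · simp [E_ne h, h]
  refine (Finset.sum_le_sum fun j _ => this j).trans ?_
  rw [Finset.sum_add_distrib]; simp

lemma l1_sub_E {d : ℕ} (x : V d) (i : Fin d) : l1 (x - E i) ≤ l1 x + 1 := by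
  unfold l1
  have : ∀ j, |(x - E i) j| ≤ |x j| + if j = i then 1 else 0 := by
    intro j
    by_cases h : j = i
    · subst h; simp [E_same]; exact (abs_sub _ _).trans (by simp)
    · simp [E_ne h, h]
  refine (Finset.sum_le_sum fun j _ => this j).trans ?_
  rw [Finset.sum_add_distrib]; simp

lemma ae_struct {d : ℕ} (hd : 0 < d) : ∀ᵐ ω ∂μ0, ∀ k, (uAggFrom ({0} : Finset (V d)) ω k).card = k + 1 ∧
    (0 ∈ uAggFrom ({0} : Finset (V d)) ω k) ∧ ∀ x ∈ uAggFrom ({0} : Finset (V d)) ω k, l1 x ≤ k := by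
  filter_upwards [ae_good hd (S := {0}) ⟨0, by simp⟩] with ω h k
  refine ⟨?_, agg_mono {0} ω (Nat.zero_le k) (by simp [uAggFrom]), ?_⟩
  · induction k with
    | zero => simp [uAggFrom]
    | succ k ih =>
      obtain ⟨y, hy, he⟩ := h k
      rw [he, Finset.card_insert_of_notMem (Finset.mem_sdiff.mp hy).2, ih]
  · induction k with
    | zero => simp [uAggFrom, l1]
    | succ k ih =>
      obtain ⟨y, hy, he⟩ := h k
      rw [he]
      intro x hx
      push_cast
      rcases Finset.mem_insert.mp hx with rfl | hx
      · rcases mem_cl (Finset.mem_sdiff.mp hy).1 with h1 | ⟨i, h1 | h1⟩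
        · exact absurd h1 (Finset.mem_sdiff.mp hy).2
        · have := l1_add_E (x - E i) i
          rw [sub_add_cancel] at this
          linarith [ih _ h1]
        · have := l1_sub_E (x + E i) i
          rw [add_sub_cancel_right] at this
          linarith [ih _ h1]
      · linarith [ih x hx]

end IDLA

open MeasureTheory Filter
open scoped ENNReal

namespace IDLA
open ProbabilityTheory

/-- one step of the chain, remembering an earlier configuration -/
lemma step_agg2 {d : ℕ} (hd : 0 < d) {S : Finset (V d)} (hS : S.Nonempty) {j k : ℕ} (hjk : j ≤ k)
    (F : Finset (V d) → Finset (V d) → ℝ≥0∞) :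
    ∫⁻ ω, F (uAggFrom S ω j) (uAggFrom S ω (k+1)) ∂μ0 =
    ∫⁻ ω, ∑ y ∈ cl (uAggFrom S ω k) \ (uAggFrom S ω k), ENNReal.ofReal (q (uAggFrom S ω k) y) *
      F (uAggFrom S ω j) (insert y (uAggFrom S ω k)) ∂μ0 := by
  have hmj : Measurable[sig (Set.Iio k)] (fun ω => uAggFrom S ω j) :=
    (measurable_agg S j).mono (sig_mono (fun i hi => lt_of_lt_of_le hi hjk)) le_rfl
  have hmp : Measurable[sig (Set.Iio k)] (fun ω => (uAggFrom S ω j, uAggFrom S ω k)) :=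
    @Measurable.prodMk ℝ (sig (Set.Iio k)) _ _ _ _ _ _ hmj (measurable_agg S k)
  have hmp' : Measurable (fun ω => (uAggFrom S ω j, uAggFrom S ω k)) := (measurable_agg' S j).prodMk (measurable_agg' S k)
  have hind : IndepFun (fun ω => (uAggFrom S ω j, uAggFrom S ω k)) (fun ω => uSlice ω k) μ0 :=
    indep_of_sig (I := Set.Iio k) (J := {k}) (by simp) hmp (sig_uSlice rfl)
  rw [indepFun_iff_map_prod_eq_prod_map_map hmp'.aemeasurable (measurable_uSlice k).aemeasurable,
    map_uSlice] at hind
  have hG : Measurable (fun p : (Finset (V d) × Finset (V d)) × ℝ => F p.1.1 (uStep p.1.2 p.2)) :=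
    measurable_from_prod_countable_right fun B => (Measurable.of_discrete (f := F B.1)).comp (measurable_uStep B.2)
  have h1 : ∫⁻ ω, F (uAggFrom S ω j) (uAggFrom S ω (k+1)) ∂μ0 =
      ∫⁻ p, F p.1.1 (uStep p.1.2 p.2) ∂(μ0.map (fun ω => ((uAggFrom S ω j, uAggFrom S ω k), uSlice ω k))) := by
    rw [lintegral_map hG (hmp'.prodMk (measurable_uSlice k))]
    rfl
  rw [h1, hind, lintegral_prod _ hG.aemeasurable, lintegral_map Measurable.of_discrete hmp']
  refine lintegral_congr fun ω => ?_
  exact step_lint hd (hS.mono (agg_mono S ω (Nat.zero_le k))) (F (uAggFrom S ω j))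

/-- the aggregate started at the origin -/
noncomputable abbrev A (d : ℕ) (ω : ℝ) (k : ℕ) : Finset (V d) := uAggFrom ({0} : Finset (V d)) ω k

lemma l1_dec {d : ℕ} {z : V d} (hz : z ≠ 0) : ∃ i, (0 < z i ∧ l1 (z - E i) = l1 z - 1) ∨
    (z i < 0 ∧ l1 (z + E i) = l1 z - 1) := by
  obtain ⟨i, hi⟩ := Function.ne_iff.mp hz
  refine ⟨i, ?_⟩
  rw [Pi.zero_apply] at hi
  rcases lt_or_gt_of_ne hi with h | h
  · right
    refine ⟨h, ?_⟩
    unfold l1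
    rw [← Finset.add_sum_erase _ _ (Finset.mem_univ i), ← Finset.add_sum_erase _ (fun j => |z j|) (Finset.mem_univ i)]
    have : ∀ j ∈ Finset.univ.erase i, |(z + E i) j| = |z j| := by
      intro j hj; simp [E_ne (Finset.ne_of_mem_erase hj)]
    rw [Finset.sum_congr rfl this, Pi.add_apply, E_same, abs_of_neg h, abs_of_nonpos (by omega)]; ring
  · left
    refine ⟨h, ?_⟩
    unfold l1
    rw [← Finset.add_sum_erase _ _ (Finset.mem_univ i), ← Finset.add_sum_erase _ (fun j => |z j|) (Finset.mem_univ i)]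
    have : ∀ j ∈ Finset.univ.erase i, |(z - E i) j| = |z j| := by
      intro j hj; simp [E_ne (Finset.ne_of_mem_erase hj)]
    rw [Finset.sum_congr rfl this, Pi.sub_apply, E_same, abs_of_pos h, abs_of_nonneg (by omega)]; ring

lemma l1_nonneg {d : ℕ} (z : V d) : 0 ≤ l1 z := Finset.sum_nonneg fun _ _ => abs_nonneg _

lemma lattice_induct {d : ℕ} (R : V d → Prop) (h0 : R 0) (ha : ∀ z i, R z → R (z + E i)) (hs : ∀ z i, R z → R (z - E i)) :
    ∀ z, R z := by
  have : ∀ n : ℕ, ∀ z : V d, l1 z ≤ n → R z := by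
    intro n
    induction n with
    | zero =>
      intro z hz
      by_cases h : z = 0
      · rwa [h]
      · obtain ⟨i, ⟨_, h1⟩ | ⟨_, h1⟩⟩ := l1_dec h
        · have := l1_nonneg (z - E i); push_cast at hz; omega
        · have := l1_nonneg (z + E i); push_cast at hz; omega
    | succ n ih =>
      intro z hz
      by_cases h : z = 0
      · rwa [h]
      · push_cast at hz
        obtain ⟨i, ⟨_, h1⟩ | ⟨_, h1⟩⟩ := l1_dec h
        · simpa using ha _ i (ih (z - E i) (by omega))
        · simpa using hs _ i (ih (z + E i) (by omega))
  exact fun z => this (l1 z).toNat z (by rw [Int.toNat_of_nonneg (l1_nonneg z)])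

open Classical in
lemma cover_nbr {d : ℕ} (hd : 0 < d) {z w : V d} (hn : ∃ i, z = w + E i ∨ z = w - E i) (j : ℕ) :
    ∀ᵐ ω ∂μ0, w ∈ A d ω j → ∃ k, z ∈ A d ω k := by
  have hdp : (0:ℝ) < d := by exact_mod_cast hd
  let F : Finset (V d) → Finset (V d) → ℝ≥0∞ := fun B C => if w ∈ B ∧ z ∉ C then 1 else 0
  let W : ℕ → ℝ≥0∞ := fun k => ∫⁻ ω, F (A d ω j) (A d ω k) ∂μ0
  let c : ℕ → ℝ := fun k => 1 / (2 * d * ((k:ℝ)+1))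
  have hstep : ∀ k, j ≤ k → W (k+1) ≤ ENNReal.ofReal (Real.exp (- c k)) * W k := by
    intro k hk
    change ∫⁻ ω, F (A d ω j) (A d ω (k+1)) ∂μ0 ≤ _
    have hmF : Measurable (fun ω => F (A d ω j) (A d ω k)) :=
      (Measurable.of_discrete (f := fun p : Finset (V d) × Finset (V d) => F p.1 p.2)).comp
        ((measurable_agg' {0} j).prodMk (measurable_agg' {0} k))
    rw [step_agg2 hd (by simp) hk F, ← lintegral_const_mul _ hmF]
    apply lintegral_mono_ae
    filter_upwards [ae_struct hd] with ω hω
    obtain ⟨hcard, -, -⟩ := hω k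
    have hjk : A d ω j ⊆ A d ω k := agg_mono _ ω hk
    set B := A d ω k with hB
    change ∑ y ∈ cl B \ B, ENNReal.ofReal (q B y) * F (A d ω j) (insert y B) ≤ _ * F (A d ω j) B
    by_cases hcond : w ∈ A d ω j ∧ z ∉ B
    · have hFB : F (A d ω j) B = 1 := if_pos hcond
      rw [hFB, mul_one]
      have hne : B.Nonempty := ⟨w, hjk hcond.1⟩
      have hqz := q_nbr hd B hcond.2 (hjk hcond.1) hn
      rw [hcard] at hqz
      have hzc : z ∈ cl B \ B := by
        refine Finset.mem_sdiff.mpr ⟨?_, hcond.2⟩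
        obtain ⟨i, rfl | rfl⟩ := hn
        · exact add_mem_cl (hjk hcond.1) i
        · exact sub_mem_cl (hjk hcond.1) i
      have htot := q_total hd hne
      rw [← Finset.add_sum_erase _ _ hzc] at htot
      have : ∑ y ∈ cl B \ B, ENNReal.ofReal (q B y) * F (A d ω j) (insert y B) ≤ ∑ y ∈ (cl B \ B).erase z, ENNReal.ofReal (q B y) := by
        rw [← Finset.add_sum_erase _ _ hzc]
        have : F (A d ω j) (insert z B) = 0 := if_neg (by simp)
        rw [this, mul_zero, zero_add]
        refine Finset.sum_le_sum fun y _ => ?_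
        have : F (A d ω j) (insert y B) ≤ 1 := by simp only [F]; split_ifs <;> simp
        calc _ ≤ ENNReal.ofReal (q B y) * 1 := by gcongr
          _ = _ := mul_one _
      refine this.trans ?_
      rw [← ENNReal.ofReal_sum_of_nonneg (fun y _ => q_nonneg B y)]
      apply ENNReal.ofReal_le_ofReal
      have h2 := Real.add_one_le_exp (- c k)
      have : c k ≤ q B z := by simp only [c]; push_cast at hqz; exact hqz
      linarith
    · have : ∀ y, F (A d ω j) (insert y B) = 0 := fun y => if_neg (by
        rintro ⟨h1, h2⟩
        exact hcond ⟨h1, fun h => h2 (Finset.mem_insert_of_mem h)⟩)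
      simp [this]
  have hW : ∀ k, W (j + k) ≤ ENNReal.ofReal (Real.exp (- ∑ i ∈ Finset.range k, c (j + i))) := by
    intro k
    induction k with
    | zero =>
      simp only [add_zero, Finset.range_zero, Finset.sum_empty, neg_zero, Real.exp_zero, ENNReal.ofReal_one]
      calc W j ≤ ∫⁻ ω, 1 ∂μ0 := lintegral_mono fun ω => by simp only [F]; split_ifs <;> simp
        _ = 1 := by simp
    | succ k ih =>
      refine (hstep (j+k) (by omega)).trans ?_
      rw [Finset.sum_range_succ, neg_add, add_comm (-∑ i ∈ Finset.range k, c (j+i)), Real.exp_add, ENNReal.ofReal_mul (Real.exp_nonneg _)]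
      gcongr
  have hdiv : Tendsto (fun k => ∑ i ∈ Finset.range k, c (j+i)) atTop atTop := by
    have h1 := Real.tendsto_sum_range_one_div_nat_succ_atTop
    have h2 : ∀ k, ∑ i ∈ Finset.range k, (1:ℝ) / ((i:ℝ)+1) * (1 / (2 * d * (j+1))) ≤ ∑ i ∈ Finset.range k, c (j+i) := by
      intro k
      refine Finset.sum_le_sum fun i _ => ?_
      simp only [c]
      rw [div_mul_div_comm, one_mul]
      apply one_div_le_one_div_of_le (by positivity)
      push_cast
      nlinarith [mul_nonneg (Nat.cast_nonneg (α := ℝ) i) (Nat.cast_nonneg (α := ℝ) j), mul_nonneg hdp.le (mul_nonneg (Nat.cast_nonneg (α := ℝ) i) (Nat.cast_nonneg (α := ℝ) j))]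
    refine tendsto_atTop_mono h2 ?_
    simp only [← Finset.sum_mul]
    exact h1.atTop_mul_const (by positivity)
  have hlim : Tendsto (fun k => ENNReal.ofReal (Real.exp (- ∑ i ∈ Finset.range k, c (j + i)))) atTop (nhds 0) := by
    have := ENNReal.tendsto_ofReal (Real.tendsto_exp_neg_atTop_nhds_zero.comp hdiv)
    simpa using this
  rw [ae_iff]
  refine le_antisymm (ge_of_tendsto' hlim fun k => ?_) zero_le
  refine le_trans ?_ (hW k)
  have : W (j+k) = μ0 {ω | w ∈ A d ω j ∧ z ∉ A d ω (j+k)} := by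
    have hms : MeasurableSet {ω | w ∈ A d ω j ∧ z ∉ A d ω (j+k)} := by
      have h1 : MeasurableSet {ω | w ∈ A d ω j} := measurable_agg' {0} j (t := {B | w ∈ B}) trivial
      have h2 : MeasurableSet {ω | z ∉ A d ω (j+k)} := measurable_agg' {0} (j+k) (t := {B | z ∉ B}) trivial
      exact h1.inter h2
    rw [← lintegral_indicator_one hms]
    refine lintegral_congr fun ω => ?_
    simp only [F, Set.indicator_apply, Set.mem_ofPred_eq, Pi.one_apply]
  rw [this]
  apply measure_mono
  intro ω hω
  simp only [Set.mem_ofPred_eq, not_forall, not_exists, exists_prop] at hω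
  exact ⟨hω.1, hω.2 _⟩

lemma cover_all {d : ℕ} (hd : 0 < d) : ∀ᵐ ω ∂μ0, ∀ z, ∃ k, z ∈ A d ω k := by
  rw [ae_all_iff]
  refine lattice_induct _ ?_ ?_ ?_
  · exact Eventually.of_forall fun ω => ⟨0, by simp [uAggFrom]⟩
  · intro w i hw
    filter_upwards [hw, ae_all_iff.mpr (cover_nbr hd (z := w + E i) (w := w) ⟨i, Or.inl rfl⟩)] with ω ⟨k, hk⟩ h2
    exact h2 k hk
  · intro w i hw
    filter_upwards [hw, ae_all_iff.mpr (cover_nbr hd (z := w - E i) (w := w) ⟨i, Or.inr rfl⟩)] with ω ⟨k, hk⟩ h2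
    exact h2 k hk

end IDLA

open MeasureTheory Filter
open scoped ENNReal

namespace IDLA
open ProbabilityTheory

lemma exp_neg_le_quad {y : ℝ} (hy : 0 ≤ y) : Real.exp (-y) ≤ 1 - y + y^2/2 := by
  have h := Real.quadratic_le_exp_of_nonneg hy
  rw [Real.exp_neg]
  rw [inv_le_iff_one_le_mul₀ (Real.exp_pos y)]
  have : 0 ≤ 1 - y + y^2/2 := by nlinarith [sq_nonneg (y-1)]
  nlinarith [mul_le_mul_of_nonneg_left h this, sq_nonneg (y^2)]

/-- one step exponential supermartingale estimate -/
lemma conc_step {d : ℕ} (hd : 0 < d) (z : V d) (h : V d → ℝ) (H : ℝ) (h0 : ∀ x, 0 ≤ h x) (hH : ∀ x, h x ≤ H)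
    (hsub : ∀ x, x ≠ z → 0 ≤ lap h x) (B : Finset (V d)) (hB : B.Nonempty) (hz : z ∉ B) (l : ℝ) (hl : 0 ≤ l) (hlH : l * H ≤ 2) :
    ∑ y ∈ cl B \ B, q B y * Real.exp (-(l * ∑ x ∈ insert y B, h x)) ≤
      Real.exp (-(l * (1 + (1 - l * H / 2) / B.card) * ∑ x ∈ B, h x)) := by
  have hc : (0:ℝ) < B.card := by exact_mod_cast Finset.card_pos.mpr hB
  set Φ := ∑ x ∈ B, h x with hΦ
  have hΦ0 : 0 ≤ Φ := Finset.sum_nonneg fun x _ => h0 x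
  have h1 : ∀ y ∈ cl B \ B, q B y * Real.exp (-(l * ∑ x ∈ insert y B, h x)) ≤
      Real.exp (-(l*Φ)) * (q B y - l * (1 - l * H/2) * (q B y * h y)) := by
    intro y hy
    rw [Finset.sum_insert (Finset.mem_sdiff.mp hy).2, ← hΦ]
    have e1 : -(l * (h y + Φ)) = -(l*Φ) + -(l * h y) := by ring
    rw [e1, Real.exp_add]
    have e2 := exp_neg_le_quad (mul_nonneg hl (h0 y))
    have e3 : Real.exp (-(l * h y)) ≤ 1 - l * (1 - l * H/2) * h y := by
      have : (l * h y)^2 ≤ l^2 * H * h y := by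
        have := mul_le_mul_of_nonneg_left (hH y) (mul_nonneg (sq_nonneg l) (h0 y))
        nlinarith
      nlinarith
    calc q B y * (Real.exp (-(l*Φ)) * Real.exp (-(l * h y)))
        = Real.exp (-(l*Φ)) * (q B y * Real.exp (-(l * h y))) := by ring
      _ ≤ Real.exp (-(l*Φ)) * (q B y * (1 - l * (1 - l * H/2) * h y)) := by
        gcongr
        exact q_nonneg B y
      _ = _ := by ring
  refine (Finset.sum_le_sum h1).trans ?_
  rw [← Finset.mul_sum, Finset.sum_sub_distrib, q_total hd hB, ← Finset.mul_sum]
  have hs := q_sub hd B h (fun x hx => hsub x (by rintro rfl; exact hz hx))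
  rw [← hΦ] at hs
  have hp : 0 ≤ l * (1 - l * H/2) := mul_nonneg hl (by linarith)
  have h2 : 1 - l * (1 - l * H/2) * ∑ y ∈ cl B \ B, q B y * h y ≤ Real.exp (-(l * (1 - l*H/2) * (Φ / B.card))) := by
    have := mul_le_mul_of_nonneg_left hs hp
    have h3 := Real.add_one_le_exp (-(l * (1 - l*H/2) * (Φ / B.card)))
    linarith
  calc _ ≤ Real.exp (-(l*Φ)) * Real.exp (-(l * (1 - l*H/2) * (Φ / B.card))) := by gcongr
    _ = _ := by
      rw [← Real.exp_add]; congr 1; field_simp; ring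

open Classical in
lemma conc {d : ℕ} (hd : 0 < d) (z : V d) (h : V d → ℝ) (H : ℝ) (h0 : ∀ x, 0 ≤ h x) (hH : ∀ x, h x ≤ H)
    (hsub : ∀ x, x ≠ z → 0 ≤ lap h x) (D : Finset (V d) → Prop) (j m : ℕ) (hjm : j ≤ m) (θ δ γ : ℝ)
    (hθ : 0 ≤ θ) (hθH : θ * H ≤ j + 1) (hδ0 : 0 ≤ δ)
    (hD : ∀ B : Finset (V d), D B → B.card = j + 1 → (1 - δ) * (j+1) ≤ ∑ x ∈ B, h x)
    (hend : ∀ B : Finset (V d), B.card = m + 1 → ∑ x ∈ B, h x ≤ (1 - γ) * (m+1)) :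
    μ0 {ω | D (A d ω j) ∧ z ∉ A d ω m} ≤ ENNReal.ofReal (Real.exp (-(θ * (γ - δ - θ * H / (j+1))))) := by
  have hH0 : 0 ≤ H := (h0 0).trans (hH 0)
  let th : ℕ → ℝ := fun k => θ * (1 - θ * H / (k+1))
  let la : ℕ → ℝ := fun k => th k / (k+1)
  have hth : ∀ k, j ≤ k → 0 ≤ th k ∧ th k ≤ θ := by
    intro k hk
    have hk' : (j:ℝ) ≤ k := by exact_mod_cast hk
    have hk0 : (0:ℝ) < (k:ℝ) + 1 := by positivity
    have h1 : 0 ≤ θ * H / (k+1) := by positivity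
    have h2 : θ * H / (k+1) ≤ 1 := by rw [div_le_one hk0]; linarith
    exact ⟨mul_nonneg hθ (by linarith), by simp only [th]; nlinarith⟩
  have hla0 : ∀ k, j ≤ k → 0 ≤ la k := fun k hk => div_nonneg (hth k hk).1 (by positivity)
  have hlaH : ∀ k, j ≤ k → la k * H ≤ 2 := by
    intro k hk
    have hk' : (j:ℝ) ≤ k := by exact_mod_cast hk
    have hk0 : (0:ℝ) < (k:ℝ) + 1 := by positivity
    simp only [la]
    rw [div_mul_eq_mul_div, div_le_iff₀ hk0]
    nlinarith [mul_le_mul_of_nonneg_right (hth k hk).2 hH0]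
  have hrec : ∀ k, j ≤ k → la k ≤ la (k+1) * (1 + (1 - la (k+1) * H / 2) / (k+1)) := by
    intro k hk
    have hk0 : (0:ℝ) < (k:ℝ) + 1 := by positivity
    obtain ⟨t0, t1⟩ := hth (k+1) (by omega)
    have e : la (k+1) * (1 + (1 - la (k+1) * H / 2) / (k+1)) - la k =
        (th (k+1) - th k - (th (k+1))^2 * H / (2 * (k+2)^2)) / (k+1) := by
      simp only [la]
      have : (k:ℝ) + 1 + 1 ≠ 0 := by positivity
      have h3 : (k:ℝ) + 2 ≠ 0 := by positivity
      have h4 : (k:ℝ) + 1 ≠ 0 := by positivity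
      push_cast
      have h5 : (k:ℝ) + 1 + 1 = k + 2 := by ring
      rw [h5]
      field_simp
      ring
    have e2 : th (k+1) - th k = θ^2 * H / ((k+1) * (k+2)) := by
      simp only [th]
      push_cast
      have h5 : (k:ℝ) + 1 + 1 = k + 2 := by ring
      rw [h5]
      have h3 : (k:ℝ) + 2 ≠ 0 := by positivity
      field_simp
      ring
    have e3 : (th (k+1))^2 * H / (2 * ((k:ℝ)+2)^2) ≤ θ^2 * H / ((k+1) * (k+2)) := by
      have : (th (k+1))^2 ≤ θ^2 := by gcongr
      have hk2 : (0:ℝ) ≤ k := Nat.cast_nonneg k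
      refine div_le_div₀ (by positivity) (by gcongr) (by positivity) (by nlinarith)
    have : 0 ≤ la (k+1) * (1 + (1 - la (k+1) * H / 2) / (k+1)) - la k := by
      rw [e, e2]
      exact div_nonneg (by linarith) hk0.le
    linarith
  let F : ℕ → Finset (V d) → Finset (V d) → ℝ≥0∞ := fun k B C =>
    if D B ∧ z ∉ C then ENNReal.ofReal (Real.exp (-(la k * ∑ x ∈ C, h x))) else 0
  have hstep : ∀ k, j ≤ k → ∫⁻ ω, F (k+1) (A d ω j) (A d ω (k+1)) ∂μ0 ≤ ∫⁻ ω, F k (A d ω j) (A d ω k) ∂μ0 := by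
    intro k hk
    rw [step_agg2 hd (by simp) hk (F (k+1))]
    apply lintegral_mono_ae
    filter_upwards [ae_struct hd] with ω hω
    obtain ⟨hcard, hzero, -⟩ := hω k
    set B := A d ω k with hB
    change ∑ y ∈ cl B \ B, ENNReal.ofReal (q B y) * F (k+1) (A d ω j) (insert y B) ≤ F k (A d ω j) B
    by_cases hcond : D (A d ω j) ∧ z ∉ B
    · have hFB : F k (A d ω j) B = _ := if_pos hcond
      rw [hFB]
      have hcs := conc_step hd z h H h0 hH hsub B ⟨0, hzero⟩ hcond.2 (la (k+1)) (hla0 _ (by omega)) (hlaH _ (by omega))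
      rw [hcard] at hcs
      calc _ ≤ ∑ y ∈ cl B \ B, ENNReal.ofReal (q B y * Real.exp (-(la (k+1) * ∑ x ∈ insert y B, h x))) := by
            refine Finset.sum_le_sum fun y _ => ?_
            rw [ENNReal.ofReal_mul (q_nonneg B y)]
            gcongr
            simp only [F]
            split_ifs
            · exact le_rfl
            · exact zero_le
        _ = ENNReal.ofReal (∑ y ∈ cl B \ B, q B y * Real.exp (-(la (k+1) * ∑ x ∈ insert y B, h x))) := by
            rw [ENNReal.ofReal_sum_of_nonneg]
            exact fun y _ => mul_nonneg (q_nonneg B y) (Real.exp_nonneg _)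
        _ ≤ _ := by
            apply ENNReal.ofReal_le_ofReal
            refine hcs.trans ?_
            apply Real.exp_le_exp.mpr
            apply neg_le_neg
            have := hrec k hk
            push_cast
            exact mul_le_mul_of_nonneg_right this (Finset.sum_nonneg fun x _ => h0 x)
    · have : ∀ y, F (k+1) (A d ω j) (insert y B) = 0 := fun y => if_neg (by
        rintro ⟨h1, h2⟩
        exact hcond ⟨h1, fun h => h2 (Finset.mem_insert_of_mem h)⟩)
      simp [this]
  have hall : ∀ k, j ≤ k → ∫⁻ ω, F k (A d ω j) (A d ω k) ∂μ0 ≤ ∫⁻ ω, F j (A d ω j) (A d ω j) ∂μ0 := by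
    intro k hk
    induction k, hk using Nat.le_induction with
    | base => exact le_rfl
    | succ k hk ih => exact (hstep k hk).trans ih
  have hj0 : (0:ℝ) < (j:ℝ) + 1 := by positivity
  have hm0 : (0:ℝ) < (m:ℝ) + 1 := by positivity
  have hstart : ∫⁻ ω, F j (A d ω j) (A d ω j) ∂μ0 ≤ ENNReal.ofReal (Real.exp (-(th j * (1-δ)))) := by
    calc _ ≤ ∫⁻ ω, ENNReal.ofReal (Real.exp (-(th j * (1-δ)))) ∂μ0 := by
          apply lintegral_mono_ae
          filter_upwards [ae_struct hd] with ω hω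
          obtain ⟨hcard, -, -⟩ := hω j
          simp only [F]
          split_ifs with hc
          · apply ENNReal.ofReal_le_ofReal
            apply Real.exp_le_exp.mpr
            apply neg_le_neg
            have h1 := hD _ hc.1 hcard
            calc th j * (1 - δ) = la j * ((1-δ) * (j+1)) := by simp only [la]; field_simp
              _ ≤ _ := mul_le_mul_of_nonneg_left h1 (hla0 j le_rfl)
          · exact zero_le
      _ = _ := by simp
  have hms : MeasurableSet {ω | D (A d ω j) ∧ z ∉ A d ω m} := by
    have h1 : MeasurableSet {ω | D (A d ω j)} := measurable_agg' {0} j (t := {B | D B}) trivial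
    have h2 : MeasurableSet {ω | z ∉ A d ω m} := measurable_agg' {0} m (t := {B | z ∉ B}) trivial
    exact h1.inter h2
  have hfin : ENNReal.ofReal (Real.exp (-(θ * (1-γ)))) * μ0 {ω | D (A d ω j) ∧ z ∉ A d ω m} ≤
      ∫⁻ ω, F m (A d ω j) (A d ω m) ∂μ0 := by
    rw [← setLIntegral_const, ← lintegral_indicator hms]
    apply lintegral_mono_ae
    filter_upwards [ae_struct hd] with ω hω
    obtain ⟨hcard, -, -⟩ := hω m
    simp only [F, Set.indicator_apply, Set.mem_ofPred_eq]
    split_ifs with hc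
    · apply ENNReal.ofReal_le_ofReal
      apply Real.exp_le_exp.mpr
      apply neg_le_neg
      have h1 := hend _ hcard
      have hs0 : 0 ≤ ∑ x ∈ A d ω m, h x := Finset.sum_nonneg fun x _ => h0 x
      have hg : 0 ≤ 1 - γ := by
        by_contra hcon
        push Not at hcon
        nlinarith
      calc la m * ∑ x ∈ A d ω m, h x ≤ la m * ((1-γ) * (m+1)) := mul_le_mul_of_nonneg_left h1 (hla0 m hjm)
        _ = th m * (1-γ) := by simp only [la]; field_simp
        _ ≤ _ := mul_le_mul_of_nonneg_right (hth m hjm).2 hg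
    · exact le_rfl
  have hcomb := hfin.trans ((hall m hjm).trans hstart)
  have hmul := mul_le_mul_right hcomb (ENNReal.ofReal (Real.exp (θ * (1-γ))))
  rw [← mul_assoc, ← ENNReal.ofReal_mul (Real.exp_nonneg _), ← ENNReal.ofReal_mul (Real.exp_nonneg _), ← Real.exp_add,
    ← Real.exp_add, add_neg_cancel, Real.exp_zero, ENNReal.ofReal_one, one_mul] at hmul
  refine hmul.trans ?_
  apply ENNReal.ofReal_le_ofReal
  apply Real.exp_le_exp.mpr
  simp only [th]
  have : 0 ≤ θ * H / (j+1) := by positivity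
  nlinarith [mul_nonneg hθ (mul_nonneg this hδ0)]

end IDLA

open MeasureTheory Filter
open scoped ENNReal

namespace IDLA

/-- Bernoulli for negative exponents -/
lemma bern_neg {p v : ℝ} (hp : 0 ≤ p) (hv : -1 < v) : 1 - p * v ≤ (1 + v) ^ (-p) := by
  have h1 : 0 < 1 + v := by linarith
  rw [Real.rpow_def_of_pos h1]
  have h2 := Real.log_le_sub_one_of_pos h1
  have h3 := Real.add_one_le_exp (Real.log (1+v) * (-p))
  nlinarith

/-- tangent inequality for negative powers -/
lemma tangent_neg {p x y : ℝ} (hp : 0 ≤ p) (hx : 0 < x) (hy : 0 < y) :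
    x ^ (-p) - p * x ^ (-p-1) * (y - x) ≤ y ^ (-p) := by
  have h1 : -1 < (y - x)/x := by rw [lt_div_iff₀ hx]; linarith
  have h2 := bern_neg hp h1
  have h3 : 1 + (y-x)/x = y / x := by field_simp; ring
  rw [h3, Real.div_rpow hy.le hx.le] at h2
  have hxp : 0 < x ^ (-p) := Real.rpow_pos_of_pos hx _
  have h4 : x ^ (-p-1) = x^(-p) / x := by rw [Real.rpow_sub_one hx.ne']
  rw [h4]
  rw [le_div_iff₀ hxp] at h2
  calc _ = (1 - p * ((y-x)/x)) * x^(-p) := by field_simp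
    _ ≤ _ := h2

lemma second_diff_aux (ε p c : ℝ) (u0 : ℝ) (hu1 : u0 < 1) 
    (hM : ∀ t ∈ Set.Ioo 0 u0, 0 ≤ ε * ((c - ((1+t)^(-p-2) + (1-t)^(-p-2))) * (p*(p+1)))) :
    ∀ u ∈ Set.Icc 0 u0, 0 ≤ ε * (2 + p*(p+1)*c/2*u^2 - ((1+u)^(-p) + (1-u)^(-p))) := by
  have hd : ∀ (r : ℝ) (t : ℝ), t ∈ Set.Icc 0 u0 → HasDerivAt (fun t => (1+t)^r) (r * (1+t)^(r-1)) t := by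
    intro r t ht
    have := (((hasDerivAt_id t).const_add 1).rpow_const (p := r) (Or.inl (by have := ht.1; simp; linarith)))
    convert! this using 1; simp
  have hd' : ∀ (r : ℝ) (t : ℝ), t ∈ Set.Icc 0 u0 → HasDerivAt (fun t => (1-t)^r) (-(r * (1-t)^(r-1))) t := by
    intro r t ht
    have := (((hasDerivAt_id t).const_sub 1).rpow_const (p := r) (Or.inl (by have := ht.2; simp; linarith)))
    convert! this using 1; simp
  let φ' : ℝ → ℝ := fun u => ε * (p*(p+1)*c*u + p * ((1+u)^(-p-1) - (1-u)^(-p-1)))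
  have h2 : ∀ t ∈ Set.Icc 0 u0, HasDerivAt φ' (ε * ((c - ((1+t)^(-p-2) + (1-t)^(-p-2))) * (p*(p+1)))) t := by
    intro t ht
    have a1 := hd (-p-1) t ht
    have a2 := hd' (-p-1) t ht
    have := (((hasDerivAt_id t).const_mul (p*(p+1)*c)).add ((a1.sub a2).const_mul p)).const_mul ε
    refine (this.congr_deriv ?_)
    have e : -p - 1 - 1 = -p - 2 := by ring
    rw [e]; ring
  have hmono : MonotoneOn φ' (Set.Icc 0 u0) := by
    refine monotoneOn_of_hasDerivWithinAt_nonneg (convex_Icc _ _) (fun t ht => (h2 t ht).continuousAt.continuousWithinAt) 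
      (f' := fun t => ε * ((c - ((1+t)^(-p-2) + (1-t)^(-p-2))) * (p*(p+1)))) ?_ ?_
    · intro t ht; rw [interior_Icc] at ht ⊢; exact (h2 t ⟨ht.1.le, ht.2.le⟩).hasDerivWithinAt
    · intro t ht; rw [interior_Icc] at ht; exact hM t ht
  have hφ'0 : φ' 0 = 0 := by simp [φ']
  let φ : ℝ → ℝ := fun u => ε * (2 + p*(p+1)*c/2*u^2 - ((1+u)^(-p) + (1-u)^(-p)))
  have h1 : ∀ t ∈ Set.Icc 0 u0, HasDerivAt φ (φ' t) t := by
    intro t ht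
    have a1 := hd (-p) t ht
    have a2 := hd' (-p) t ht
    have := ((((hasDerivAt_pow 2 t).const_mul (p*(p+1)*c/2)).const_add 2).sub (a1.add a2)).const_mul ε
    refine (this.congr_deriv ?_)
    simp only [φ']; push_cast; ring
  have hmono2 : MonotoneOn φ (Set.Icc 0 u0) := by
    refine monotoneOn_of_hasDerivWithinAt_nonneg (convex_Icc _ _) (fun t ht => (h1 t ht).continuousAt.continuousWithinAt) 
      (f' := φ') ?_ ?_
    · intro t ht; rw [interior_Icc] at ht ⊢; exact (h1 t ⟨ht.1.le, ht.2.le⟩).hasDerivWithinAt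
    · intro t ht
      rw [interior_Icc] at ht
      rw [← hφ'0]
      exact hmono ⟨le_rfl, (ht.1.trans ht.2).le⟩ ⟨ht.1.le, ht.2.le⟩ ht.1.le
  intro u hu
  have := hmono2 ⟨le_rfl, hu.1.trans hu.2⟩ hu hu.1
  have h0 : φ 0 = 0 := by simp [φ]; norm_num
  rw [h0] at this
  exact this

/-- lower Taylor estimate of the symmetric second difference -/
lemma second_diff_lower {a u : ℝ} (ha : 0 ≤ a) (hu : |u| < 1) : 2 + a*(a+1)*u^2 ≤ (1+u)^(-a) + (1-u)^(-a) := by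
  have key : ∀ u : ℝ, 0 ≤ u → u < 1 → 2 + a*(a+1)*u^2 ≤ (1+u)^(-a) + (1-u)^(-a) := by
    intro u h0 h1
    have := second_diff_aux (-1) a 2 u h1 (by
      intro t ht
      have b1 := bern_neg (p := a+2) (v := t) (by linarith) (by linarith [ht.1])
      have b2 := bern_neg (p := a+2) (v := -t) (by linarith) (by linarith [ht.2])
      rw [show -(a+2) = -a-2 by ring] at b1 b2
      rw [← sub_eq_add_neg] at b2
      have h3 : 0 ≤ a*(a+1) := by positivity
      nlinarith) u ⟨h0, le_rfl⟩
    linarith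
  rcases le_total 0 u with h | h
  · exact key u h (by rwa [abs_of_nonneg h] at hu)
  · have := key (-u) (by linarith) (by rwa [abs_of_nonpos h] at hu)
    rw [← sub_eq_add_neg, sub_neg_eq_add, neg_sq] at this
    linarith


lemma second_diff_sgn (ε p η : ℝ) (hε : 0 ≤ ε * (p*(p+1))) (hη : 0 < η) : ∃ u0 : ℝ, 0 < u0 ∧ u0 < 1 ∧
    ∀ u : ℝ, |u| ≤ u0 → ε * ((1+u)^(-p) + (1-u)^(-p)) ≤ ε * (2 + p*(p+1)*(1+η)*u^2) := by
  have hcont : ContinuousAt (fun t : ℝ => (1+t)^(-p-2) + (1-t)^(-p-2)) 0 := by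
    apply ContinuousAt.add
    · exact ContinuousAt.rpow_const (by fun_prop) (Or.inl (by norm_num))
    · exact ContinuousAt.rpow_const (by fun_prop) (Or.inl (by norm_num))
  have h0 : (fun t : ℝ => (1+t)^(-p-2) + (1-t)^(-p-2)) 0 < 2*(1+η) := by
    simp; linarith
  have hev := hcont.eventually (gt_mem_nhds h0)
  obtain ⟨δ, hδ, hδ'⟩ := Metric.eventually_nhds_iff.mp hev
  refine ⟨min (δ/2) (1/2), by positivity, by linarith [min_le_right (δ/2) (1/2 : ℝ)], ?_⟩
  have key : ∀ u : ℝ, 0 ≤ u → u ≤ min (δ/2) (1/2) → ε * ((1+u)^(-p) + (1-u)^(-p)) ≤ ε * (2 + p*(p+1)*(1+η)*u^2) := by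
    intro u hu0 hu1
    have := second_diff_aux ε p (2*(1+η)) u (by linarith [min_le_right (δ/2) (1/2 : ℝ)]) (by
      intro t ht
      have := hδ' (y := t) (by
        rw [Real.dist_eq, sub_zero, abs_of_pos ht.1]
        linarith [min_le_left (δ/2) (1/2 : ℝ), ht.2])
      have h3 : 0 ≤ 2*(1+η) - ((1+t)^(-p-2) + (1-t)^(-p-2)) := by linarith
      nlinarith [mul_nonneg h3 hε]) u ⟨hu0, le_rfl⟩
    nlinarith
  intro u hu
  rcases le_total 0 u with h | h
  · exact key u h (by rwa [abs_of_nonneg h] at hu)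
  · have := key (-u) (by linarith) (by rwa [abs_of_nonpos h] at hu)
    rw [← sub_eq_add_neg, sub_neg_eq_add, neg_sq] at this
    linarith

/-- superharmonic kernel -/
lemma kernel {d : ℕ} (hd : 2 ≤ d) (ε s : ℝ) (hs1 : -1 < s) (hε : 0 < ε * s) (hsd : 2*(s+1) < d) :
    ∃ R : ℝ, 1 ≤ R ∧ (∀ x : V d, lap (fun x => ε * (nsq x + R)^(-s)) x ≤ 0) ∧
      lap (fun x : V d => ε * (nsq x + R)^(-s)) 0 < 0 := by
  have hdpos : (0:ℝ) < d := by positivity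
  set η : ℝ := d/(2*(s+1)) - 1 with hη
  have hη0 : 0 < η := by
    rw [hη]; rw [sub_pos, lt_div_iff₀ (by linarith)]; linarith
  have hη1 : 2*(s+1)*(1+η) = d := by
    have : s + 1 ≠ 0 := by linarith
    rw [hη]; field_simp; ring
  obtain ⟨u0, hu0, hu1, hu⟩ := second_diff_sgn ε s η (by nlinarith) hη0
  refine ⟨max 1 (1/u0^2), le_max_left _ _, ?_, ?_⟩
  · intro x
    set R := max 1 (1/u0^2) with hR
    have hR1 : 1 ≤ R := le_max_left _ _
    have hR2 : 1 ≤ R * u0^2 := by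
      have := le_max_right 1 (1/u0^2)
      rw [← hR, div_le_iff₀ (by positivity)] at this
      exact this
    set c := nsq x + R + 1 with hc
    have hx0 := nsq_nonneg x
    have hc0 : 2 ≤ c := by linarith
    have hui : ∀ i, |2 * (x i:ℝ) / c| ≤ u0 := by
      intro i
      rw [abs_div, abs_of_pos (by linarith : 0 < c), div_le_iff₀ (by linarith)]
      apply abs_le_of_sq_le_sq _ (by positivity)
      have h1 := coord_sq_le x i
      have h2 : (2 * (x i : ℝ))^2 ≤ 4 * nsq x := by nlinarith
      have h3 : 4 * nsq x * R ≤ c^2 := by nlinarith [sq_nonneg (nsq x - R)]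
      have h4 : 0 ≤ u0^2 := by positivity
      have h5 : nsq x ≤ nsq x * (R * u0^2) := le_mul_of_one_le_right hx0 hR2
      nlinarith [mul_le_mul_of_nonneg_right h3 h4]
    have hcs : 0 < c^(-s) := Real.rpow_pos_of_pos (by linarith) _
    have hterm : ∀ i, ε * (nsq (x + E i) + R)^(-s) + ε * (nsq (x - E i) + R)^(-s) ≤ 
        c^(-s) * (ε * (2 + d/2*s * (2 * (x i:ℝ)/c)^2)) := by
      intro i
      have h1 := hu _ (hui i)
      have hle := abs_le.mp (hui i)
      rw [nsq_add_E, nsq_sub_E]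
      have e1 : nsq x + 2 * (x i:ℝ) + 1 + R = c * (1 + 2*(x i:ℝ)/c) := by
        field_simp; rw [hc]; ring
      have e2 : nsq x - 2 * (x i:ℝ) + 1 + R = c * (1 - 2*(x i:ℝ)/c) := by
        field_simp; rw [hc]; ring
      rw [e1, e2, Real.mul_rpow (by linarith) (by linarith), Real.mul_rpow (by linarith) (by linarith)]
      have := mul_le_mul_of_nonneg_left h1 hcs.le
      calc _ = c^(-s) * (ε * ((1 + 2*(x i:ℝ)/c)^(-s) + (1 - 2*(x i:ℝ)/c)^(-s))) := by ring
        _ ≤ _ := this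
        _ = _ := by
          rw [← hη1]; ring
    have hsum := Finset.sum_le_sum (fun i (_ : i ∈ Finset.univ) => hterm i)
    have hrhs : ∑ i, c^(-s) * (ε * (2 + d/2*s * (2 * (x i:ℝ)/c)^2)) = c^(-s) * (ε * (2*d + 2*d*s*nsq x/c^2)) := by
      rw [← Finset.mul_sum, ← Finset.mul_sum, Finset.sum_add_distrib, ← Finset.mul_sum]
      congr 2
      have : ∑ i, (2 * (x i:ℝ)/c)^2 = 4/c^2 * nsq x := by
        unfold nsq; rw [Finset.mul_sum]; refine Finset.sum_congr rfl fun i _ => ?_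
        field_simp; ring
      rw [this]; simp; ring
    rw [hrhs] at hsum
    have hfin : c^(-s) * (ε * (1 + s * nsq x / c^2)) ≤ ε * (nsq x + R)^(-s) := by
      have e3 : nsq x + R = c * (1 + -1/c) := by field_simp; rw [hc]; ring
      have hc1 : 1/c ≤ 1/2 := one_div_le_one_div_of_le (by norm_num) hc0
      rw [e3, Real.mul_rpow (by linarith) (by rw [neg_div]; linarith)]
      have h4 : ε * (1 + s * nsq x / c^2) ≤ ε * (1 + s * (1/c)) := by
        have : nsq x / c^2 ≤ 1/c := by
          rw [div_le_div_iff₀ (by positivity) (by linarith)]; nlinarith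
        have := mul_le_mul_of_nonneg_left this hε.le
        rw [mul_div_assoc s]
        nlinarith
      have h5 : ε * (1 + s*(1/c)) ≤ ε * (1 + -1/c)^(-s) := by
        rcases lt_or_ge s 0 with h | h
        · have hε' : ε < 0 := by nlinarith
          apply mul_le_mul_of_nonpos_left _ hε'.le
          have := rpow_one_add_le_one_add_mul_self (s := -1/c) (p := -s) (by rw [neg_div]; linarith) (by linarith) (by linarith)
          refine this.trans (le_of_eq ?_); ring
        · have hε' : 0 < ε := by
            by_contra hh; push Not at hh; nlinarith
          apply mul_le_mul_of_nonneg_left _ hε'.le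
          have := bern_neg (p := s) (v := -1/c) h (by rw [neg_div]; linarith)
          refine le_trans (le_of_eq ?_) this; ring
      calc _ ≤ c^(-s) * (ε * (1 + -1/c)^(-s)) := mul_le_mul_of_nonneg_left (h4.trans h5) hcs.le
        _ = _ := by ring
    unfold lap
    rw [sub_nonpos]
    refine le_trans ?_ hfin
    rw [div_le_iff₀ (by positivity)]
    refine hsum.trans (le_of_eq ?_)
    ring
  · set R := max 1 (1/u0^2) with hR
    have hR1 : 1 ≤ R := le_max_left _ _
    unfold lap
    have : ∀ i : Fin d, ε * (nsq ((0:V d) + E i) + R)^(-s) + ε * (nsq ((0:V d) - E i) + R)^(-s) = 2 * (ε * (1 + R)^(-s)) := by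
      intro i
      rw [nsq_add_E, nsq_sub_E, nsq_zero]; simp; ring
    rw [Finset.sum_congr rfl (fun i _ => this i)]; beta_reduce; rw [nsq_zero]
    simp only [Finset.sum_const, Finset.card_univ, Fintype.card_fin, nsmul_eq_mul, zero_add]
    have e : (d:ℝ) * (2 * (ε * (1+R)^(-s))) / (2*d) = ε * (1+R)^(-s) := by field_simp
    rw [e]
    rcases lt_or_ge s 0 with h | h
    · have hε' : ε < 0 := by nlinarith
      have := Real.rpow_lt_rpow (x := R) (y := 1+R) (z := -s) (by linarith) (by linarith) (by linarith)
      nlinarith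
    · have hε' : 0 < ε := by
        by_contra hh; push Not at hh; nlinarith
      have hs0 : 0 < s := by
        rcases h.lt_or_eq with h | h
        · exact h
        · rw [← h] at hε; simp at hε
      have := Real.rpow_lt_rpow_of_neg (x := R) (y := 1+R) (z := -s) (by linarith) (by linarith) (by linarith)
      nlinarith

end IDLA

open MeasureTheory Filter
open scoped ENNReal

namespace IDLA

/-- `g` is the Green function of `S` with pole `z` -/
def IsGreen {d : ℕ} (S : Finset (V d)) (z : V d) (g : V d → ℝ) : Prop :=
  (∀ x, x ∉ S → g x = 0) ∧ (∀ x ∈ S, x ≠ z → lap g x = 0) ∧ (lap g z = -1)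

lemma green_exists {d : ℕ} (hd : 0 < d) (S : Finset (V d)) (z : V d) (hz : z ∈ S) : ∃ g, IsGreen S z g := by
  classical
  obtain ⟨w, h1, h2⟩ := dirichlet hd S (fun _ => 0) (fun x => if x = z then -1 else 0)
  refine ⟨w, h1, fun x hx hxz => ?_, ?_⟩
  · rw [h2 x hx, if_neg hxz]
  · rw [h2 z hz, if_pos rfl]

lemma green_nonneg {d : ℕ} (hd : 0 < d) {S : Finset (V d)} {z : V d} {g : V d → ℝ}
    (hg : IsGreen S z g) (x : V d) : 0 ≤ g x := by
  by_cases hx : x ∈ S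
  · refine max_principle' hd S g (fun _ => 0) (fun y hy => ?_) (fun y hy _ => (hg.1 y hy).ge) x hx
    rw [lap_const hd]
    by_cases h : y = z
    · rw [h, hg.2.2]; norm_num
    · rw [hg.2.1 y hy h]
  · exact (hg.1 x hx).ge

lemma green_lap_nonneg {d : ℕ} (hd : 0 < d) {S : Finset (V d)} {z : V d} {g : V d → ℝ}
    (hg : IsGreen S z g) (x : V d) (hx : x ≠ z) : 0 ≤ lap g x := by
  by_cases h : x ∈ S
  · rw [hg.2.1 x h hx]
  · unfold lap
    rw [hg.1 x h, sub_zero]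
    refine div_nonneg (Finset.sum_nonneg fun i _ => add_nonneg (green_nonneg hd hg _) (green_nonneg hd hg _)) (by positivity)

lemma nsq_sub_le {d : ℕ} (x y : V d) : nsq (x - y) ≤ 2 * nsq x + 2 * nsq y := by
  unfold nsq
  rw [Finset.mul_sum, Finset.mul_sum, ← Finset.sum_add_distrib]
  refine Finset.sum_le_sum fun i _ => ?_
  simp only [Pi.sub_apply]; push_cast
  nlinarith [sq_nonneg ((x i:ℝ) + y i)]

lemma nsq_nbr_le {d : ℕ} {r : ℝ} (hr : 0 ≤ r) (x : V d) (hx : nsq x ≤ r^2) (i : Fin d) :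
    nsq (x + E i) ≤ (r+1)^2 ∧ nsq (x - E i) ≤ (r+1)^2 := by
  have h1 := abs_le.mp (abs_le_of_sq_le_sq ((coord_sq_le x i).trans hx) hr)
  rw [nsq_add_E, nsq_sub_E]
  constructor <;> nlinarith [h1.1, h1.2]

lemma nsq_bdry {d : ℕ} {r : ℝ} (hr : 0 ≤ r) (x : V d) (hx : ∃ i, x - E i ∈ ball d r ∨ x + E i ∈ ball d r) :
    nsq x ≤ (r+1)^2 := by
  obtain ⟨i, h | h⟩ := hx
  · have := (nsq_nbr_le hr _ ((mem_ball hr _).mp h) i).1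
    rwa [sub_add_cancel] at this
  · have := (nsq_nbr_le hr _ ((mem_ball hr _).mp h) i).2
    rwa [add_sub_cancel_right] at this

lemma nsq_cl {d : ℕ} {r : ℝ} (hr : 0 ≤ r) (x : V d) (hx : x ∈ cl (ball d r)) :
    nsq x ≤ (r+1)^2 := by
  rcases mem_cl hx with h | h
  · have := (mem_ball hr _).mp h; nlinarith
  · exact nsq_bdry hr x h

lemma green_le_kernel {d : ℕ} (hd : 0 < d) {S : Finset (V d)} {z : V d} {g L : V d → ℝ} (M : ℝ)
    (hg : IsGreen S z g) (hL : ∀ x, lap L x ≤ 0) (κ : ℝ) (hκ : 0 < κ) (hL0 : lap L 0 = -κ)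
    (hM : ∀ x, x ∉ S → (∃ i, x - E i ∈ S ∨ x + E i ∈ S) → 0 ≤ L (x - z) + M) :
    ∀ x ∈ S, g x ≤ (L (x - z) + M) / κ := by
  have e : (fun x => (L (x - z) + M) / κ) = fun x => (1/κ) * L (x - z) + (1/κ) * M := by
    ext; ring
  have hl : ∀ x, lap (fun x => (L (x - z) + M) / κ) x = (1/κ) * lap L (x - z) := by
    intro x
    rw [e, lap_add (fun x => (1/κ) * L (x - z)) (fun _ => (1/κ)*M), lap_const hd, lap_const_mul (1/κ) (fun x => L (x - z)), lap_translate, add_zero]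
  refine max_principle' hd S (fun x => (L (x - z) + M) / κ) g (fun x hx => ?_) (fun x hx hb => ?_)
  · rw [hl]
    by_cases h : x = z
    · rw [h, hg.2.2, sub_self, hL0]; field_simp; exact le_rfl
    · rw [hg.2.1 x hx h]
      exact mul_nonpos_of_nonneg_of_nonpos (by positivity) (hL _)
  · rw [hg.1 x hx]; exact div_nonneg (hM x hx hb) hκ.le

lemma green_upper {d : ℕ} (hd : 2 ≤ d) (e : ℝ) (he : 0 < e) (he1 : e < 1) :
    ∃ C : ℝ, 0 < C ∧ ∀ n : ℕ, 1 ≤ n → ∀ z ∈ ball d n, ∀ g, IsGreen (ball d n) z g →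
      (∀ x, g x ≤ C * (n:ℝ)^e) ∧ 
      ∀ x, (n:ℝ)^2/64 ≤ nsq (x - z) → g x ≤ C * (n:ℝ)^(2 - (d:ℝ) + e) := by
  have hd0 : 0 < d := by omega
  rcases eq_or_lt_of_le hd with rfl | hd3
  · obtain ⟨R, hR, hK, hK0⟩ := kernel (d := 2) le_rfl (-1) (-e/2) (by linarith) (by linarith) (by push_cast; linarith)
    set L : V 2 → ℝ := fun x => -1 * (nsq x + R)^(-(-e/2)) with hL
    refine ⟨(10+R)^(e/2) / (-lap L 0), by apply div_pos (by positivity) (by linarith), ?_⟩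
    intro n hn z hz g hg
    have hn1 : (1:ℝ) ≤ n := by exact_mod_cast hn
    have hz2 := (mem_ball (by positivity) _).mp hz
    have key : ∀ x, g x ≤ (10+R)^(e/2) / (-lap L 0) * (n:ℝ)^e := by
      intro x
      by_cases hx : x ∈ ball 2 n
      · have := green_le_kernel hd0 ((10+R)^(e/2) * (n:ℝ)^e) hg hK (-lap L 0) (by linarith) (by ring) (by
          intro x _ hb
          have h1 := nsq_bdry (by positivity) x hb
          have h2 := nsq_sub_le x z
          have h3 : nsq (x - z) + R ≤ (10 + R) * (n:ℝ)^2 := by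
            have h6 : ((n:ℝ)+1)^2 ≤ 4 * (n:ℝ)^2 := by nlinarith
            have h7 : R ≤ R * (n:ℝ)^2 := le_mul_of_one_le_right (by linarith) (by nlinarith)
            linarith
          have h4 := Real.rpow_le_rpow (by have := nsq_nonneg (x-z); linarith) h3 (z := e/2) (by linarith)
          rw [Real.mul_rpow (by positivity) (by positivity), ← Real.rpow_natCast_mul (by positivity)] at h4
          rw [show ((2:ℕ):ℝ) * (e/2) = e by push_cast; ring] at h4
          simp only [hL]; rw [show -(-e/2) = e/2 by ring]; linarith) x hx
        refine this.trans ?_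
        rw [div_mul_eq_mul_div]
        have h5 : 0 ≤ (nsq (x-z) + R)^(-(-e/2)) := Real.rpow_nonneg (by have := nsq_nonneg (x-z); linarith) _
        apply div_le_div_of_nonneg_right _ (by linarith)
        simp only [hL]; linarith
      · rw [hg.1 x hx]
        apply mul_nonneg (div_nonneg (by positivity) (by linarith)) (by positivity)
    refine ⟨key, fun x _ => ?_⟩
    have := key x
    simpa using this
  · have hd3' : (3:ℝ) ≤ d := by exact_mod_cast hd3
    set s : ℝ := (d - 2 - e)/2 with hs
    have hs0 : 0 < s := by rw [hs]; linarith
    obtain ⟨R, hR, hK, hK0⟩ := kernel (d := d) hd 1 s (by linarith) (by linarith) (by rw [hs]; linarith)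
    set L : V d → ℝ := fun x => 1 * (nsq x + R)^(-s) with hL
    set κ := -lap L 0 with hκ
    have hκ0 : 0 < κ := by linarith
    refine ⟨64^s / κ, by positivity, ?_⟩
    intro n hn z hz g hg
    have hn1 : (1:ℝ) ≤ n := by exact_mod_cast hn
    have h64 : (1:ℝ) ≤ 64^s := Real.one_le_rpow (by norm_num) hs0.le
    have hbase : ∀ x, x ∈ ball d n → g x ≤ (nsq (x-z) + R)^(-s) / κ := by
      intro x hx
      have := green_le_kernel hd0 0 hg hK κ hκ0 (by rw [hκ]; ring) (by
        intro x _ _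
        simp only [hL]
        have := Real.rpow_nonneg (x := nsq (x-z) + R) (by have := nsq_nonneg (x-z); linarith) (-s)
        linarith) x hx
      simpa [hL] using this
    constructor
    · intro x
      by_cases hx : x ∈ ball d n
      · refine (hbase x hx).trans ?_
        rw [div_mul_eq_mul_div]
        apply div_le_div_of_nonneg_right _ hκ0.le
        have h1 : (nsq (x-z) + R)^(-s) ≤ 1 := 
          Real.rpow_le_one_of_one_le_of_nonpos (by have := nsq_nonneg (x-z); linarith) (by linarith)
        have h2 : (1:ℝ) ≤ (n:ℝ)^e := Real.one_le_rpow hn1 he.le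
        nlinarith
      · rw [hg.1 x hx]; positivity
    · intro x hfar
      by_cases hx : x ∈ ball d n
      · refine (hbase x hx).trans ?_
        rw [div_mul_eq_mul_div]
        apply div_le_div_of_nonneg_right _ hκ0.le
        have h1 : (nsq (x-z) + R)^(-s) ≤ ((n:ℝ)^2/64)^(-s) := 
          Real.rpow_le_rpow_of_nonpos (by positivity) (by linarith) (by linarith)
        refine h1.trans (le_of_eq ?_)
        rw [Real.div_rpow (by positivity) (by positivity), ← Real.rpow_natCast_mul (by positivity),
          Real.rpow_neg (by norm_num : (0:ℝ) ≤ 64), div_inv_eq_mul, mul_comm]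
        congr 2
        rw [hs]; push_cast; ring
      · rw [hg.1 x hx]; positivity

/-- total mass of the Green function -/
lemma green_mass {d : ℕ} (hd : 0 < d) {r : ℝ} (hr : 0 ≤ r) {z : V d} {g : V d → ℝ} (hz : z ∈ ball d r)
    (hg : IsGreen (ball d r) z g) : ∑ x ∈ ball d r, g x ≤ (r+1)^2 - nsq z := by
  classical
  have h1 := green (ball d r) g nsq hg.1
  have h2 := green (ball d r) g (fun _ => 1) hg.1
  simp only [lap_nsq hd, mul_one, lap_const hd, mul_zero, one_mul, Finset.sum_const_zero] at h1 h2
  rw [← h1]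
  have hzc : z ∈ cl (ball d r) := subset_cl _ hz
  rw [← Finset.add_sum_erase _ _ hzc, hg.2.2] at h2 ⊢
  have h3 : ∑ x ∈ (cl (ball d r)).erase z, nsq x * lap g x ≤ ∑ x ∈ (cl (ball d r)).erase z, (r+1)^2 * lap g x := by
    refine Finset.sum_le_sum fun x hx => ?_
    rw [Finset.mem_erase] at hx
    exact mul_le_mul_of_nonneg_right (nsq_cl hr x hx.2) (green_lap_nonneg hd hg x hx.1)
  rw [← Finset.mul_sum] at h3
  have : ∑ x ∈ (cl (ball d r)).erase z, lap g x = 1 := by linarith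
  rw [this] at h3
  linarith

end IDLA

open MeasureTheory Filter
open scoped ENNReal

namespace IDLA

/-- euclidean norm on `Fin d → ℝ` -/
noncomputable def en {d : ℕ} (x : Fin d → ℝ) : ℝ := ‖(WithLp.toLp 2 x : EuclideanSpace ℝ (Fin d))‖

lemma en_sq {d : ℕ} (x : Fin d → ℝ) : en x ^ 2 = ∑ i, x i ^ 2 := by
  unfold en
  rw [EuclideanSpace.norm_sq_eq]; simp

lemma en_add {d : ℕ} (x y : Fin d → ℝ) : en (x + y) ≤ en x + en y := by
  unfold en; rw [WithLp.toLp_add]; exact norm_add_le _ _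

lemma en_nonneg {d : ℕ} (x : Fin d → ℝ) : 0 ≤ en x := norm_nonneg _

lemma en_cont {d : ℕ} : Continuous (en : (Fin d → ℝ) → ℝ) := by
  unfold en; exact (PiLp.continuous_toLp 2 _).norm

lemma en_smul {d : ℕ} (c : ℝ) (x : Fin d → ℝ) : en (c • x) = |c| * en x := by
  unfold en; rw [WithLp.toLp_smul, norm_smul]; rfl

lemma en_frac {d : ℕ} (x : Fin d → ℝ) (hx : ∀ i, |x i| ≤ 1) : en x ≤ d := by
  apply le_of_sq_le_sq' _ (by positivity)
  rw [en_sq]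
  calc ∑ i, x i^2 ≤ ∑ i : Fin d, (1:ℝ) := Finset.sum_le_sum fun i _ => by
        have := hx i; rw [← sq_abs]; nlinarith [abs_nonneg (x i)]
    _ = d := by simp
    _ ≤ (d:ℝ)^2 := by
      rcases Nat.eq_zero_or_pos d with h | h
      · simp [h]
      · have : (1:ℝ) ≤ d := by exact_mod_cast h
        nlinarith
where
  le_of_sq_le_sq' {a b : ℝ} (h : a^2 ≤ b^2) (hb : 0 ≤ b) : a ≤ b := by
    exact (abs_le_of_sq_le_sq' h hb).2

lemma vol_fl {d : ℕ} (S : Finset (V d)) : volume {x : Fin d → ℝ | (fun i => ⌊x i⌋) ∈ S} = S.card := by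
  have : {x : Fin d → ℝ | (fun i => ⌊x i⌋) ∈ S} = ⋃ y ∈ S, Set.pi Set.univ (fun i => Set.Ico (y i : ℝ) (y i + 1)) := by
    ext x
    simp only [Set.mem_ofPred_eq, Set.mem_iUnion, Set.mem_pi, Set.mem_univ, true_imp_iff, Set.mem_Ico, ← Int.floor_eq_iff]
    constructor
    · intro h; exact ⟨_, h, fun i => rfl⟩
    · rintro ⟨y, hy, h⟩
      have : (fun i => ⌊x i⌋) = y := funext h
      rwa [this]
  rw [this, measure_biUnion_finset]
  · simp [Real.volume_pi_Ico]
  · intro y _ y' _ hyy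
    rw [Function.onFun, Set.disjoint_left]
    intro x hx hx'
    apply hyy
    ext i
    have h1 := hx i (Set.mem_univ i)
    have h2 := hx' i (Set.mem_univ i)
    rw [Set.mem_Ico, ← Int.floor_eq_iff] at h1 h2
    rw [← h1, ← h2]
  · intro y _
    exact MeasurableSet.univ_pi fun i => measurableSet_Ico

lemma vol_ball {d : ℕ} (r : ℝ) (hr : 0 < r) :
    volume {x : Fin d → ℝ | en x ≤ r} = ENNReal.ofReal (r^d) * volume {x : Fin d → ℝ | en x ≤ 1} := by
  have h := Measure.addHaar_smul (volume : Measure (Fin d → ℝ)) r {x | en x ≤ 1}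
  rw [Module.finrank_fin_fun, abs_of_nonneg (by positivity)] at h
  rw [← h]
  congr 1
  ext x
  rw [Set.mem_smul_set_iff_inv_smul_mem₀ hr.ne']
  simp only [Set.mem_ofPred_eq, en_smul]
  rw [abs_of_pos (by positivity), inv_mul_le_iff₀ hr, mul_one]

lemma count (d : ℕ) : ∃ w : ℝ, 0 < w ∧ (∀ r : ℝ, 0 ≤ r → ((ball d r).card : ℝ) ≤ w * (r + d)^d) ∧
    (∀ r : ℝ, d ≤ r → w * (r - d)^d ≤ (ball d r).card) := by
  rcases Nat.eq_zero_or_pos d with rfl | hd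
  · refine ⟨1, one_pos, fun r hr => ?_, fun r hr => ?_⟩
    · simp only [pow_zero, mul_one]
      have : (ball 0 r).card ≤ 1 := Finset.card_le_one_of_subsingleton _
      exact_mod_cast this
    · simp only [pow_zero, mul_one]
      have : (ball 0 r).Nonempty := ⟨0, by rw [mem_ball (by simpa using hr), nsq_zero]; positivity⟩
      have := this.card_pos
      exact_mod_cast this
  have hdR : (0:ℝ) < d := by exact_mod_cast hd
  have hfin : volume {x : Fin d → ℝ | en x ≤ 1} ≠ ⊤ := by
    have : {x : Fin d → ℝ | en x ≤ 1} ⊆ Set.Icc (fun _ => -1) (fun _ => 1) := by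
      intro x hx
      have h1 : en x ^2 ≤ 1 := by have := en_nonneg x; rw [Set.mem_ofPred_eq] at hx; nlinarith
      rw [en_sq] at h1
      have h2 : ∀ i, x i ^2 ≤ 1 := fun i => le_trans (Finset.single_le_sum (f := fun i => x i^2) (fun _ _ => sq_nonneg _) (Finset.mem_univ i)) h1
      exact ⟨fun i => (abs_le_of_sq_le_sq' (by simpa using h2 i) zero_le_one).1, fun i => (abs_le_of_sq_le_sq' (by simpa using h2 i) zero_le_one).2⟩
    exact ((measure_mono this).trans_lt (by rw [Real.volume_Icc_pi]; simp [ENNReal.ofReal_lt_top])).ne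
  have hpos : 0 < volume {x : Fin d → ℝ | en x ≤ 1} := by
    have : {x : Fin d → ℝ | en x < 1} ⊆ {x : Fin d → ℝ | en x ≤ 1} := by
      intro x hx; rw [Set.mem_ofPred_eq] at hx ⊢; exact hx.le
    refine lt_of_lt_of_le ?_ (measure_mono this)
    refine IsOpen.measure_pos _ (isOpen_lt en_cont continuous_const) ⟨0, ?_⟩
    simp [en]
  have hen : ∀ y : V d, en (fun i => (y i : ℝ))^2 = nsq y := fun y => by rw [en_sq]; rfl
  have hfl : ∀ x : Fin d → ℝ, en (fun i => (⌊x i⌋ : ℝ)) ≤ en x + d ∧ en x ≤ en (fun i => (⌊x i⌋ : ℝ)) + d := by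
    intro x
    constructor
    · have := en_add x (fun i => (⌊x i⌋ : ℝ) - x i)
      have h2 := en_frac (fun i => (⌊x i⌋ : ℝ) - x i) (fun i => by
        rw [abs_le]; constructor <;> linarith [Int.floor_le (x i), Int.lt_floor_add_one (x i)])
      have e : x + (fun i => (⌊x i⌋ : ℝ) - x i) = fun i => (⌊x i⌋ : ℝ) := by ext i; simp
      rw [e] at this; linarith
    · have := en_add (fun i => (⌊x i⌋ : ℝ)) (fun i => x i - (⌊x i⌋ : ℝ))
      have h2 := en_frac (fun i => x i - (⌊x i⌋ : ℝ)) (fun i => by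
        rw [abs_le]; constructor <;> linarith [Int.floor_le (x i), Int.lt_floor_add_one (x i)])
      have e : (fun i => (⌊x i⌋ : ℝ)) + (fun i => x i - (⌊x i⌋ : ℝ)) = x := by ext i; simp
      rw [e] at this; linarith
  have hmem : ∀ r : ℝ, 0 ≤ r → ∀ y : V d, y ∈ ball d r ↔ en (fun i => (y i : ℝ)) ≤ r := by
    intro r hr y
    rw [mem_ball hr, ← hen, sq_le_sq₀ (en_nonneg _) hr]
  refine ⟨(volume {x : Fin d → ℝ | en x ≤ 1}).toReal, ENNReal.toReal_pos hpos.ne' hfin, fun r hr => ?_, fun r hr => ?_⟩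
  · have h1 : {x : Fin d → ℝ | (fun i => ⌊x i⌋) ∈ ball d r} ⊆ {x | en x ≤ r + d} := by
      intro x hx
      rw [Set.mem_ofPred_eq, hmem r hr] at hx
      exact (hfl x).2.trans (by linarith)
    have h2 := measure_mono (μ := volume) h1
    rw [vol_fl, vol_ball _ (by positivity)] at h2
    have h3 := ENNReal.toReal_mono (ENNReal.mul_ne_top ENNReal.ofReal_ne_top hfin) h2
    rw [ENNReal.toReal_mul, ENNReal.toReal_ofReal (by positivity), ENNReal.toReal_natCast] at h3
    linarith
  · rcases hr.eq_or_lt with rfl | hr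
    · rw [sub_self, zero_pow hd.ne', mul_zero]; positivity
    have h1 : {x | en x ≤ r - d} ⊆ {x : Fin d → ℝ | (fun i => ⌊x i⌋) ∈ ball d r} := by
      intro x hx
      rw [Set.mem_ofPred_eq, hmem r (by linarith)]
      rw [Set.mem_ofPred_eq] at hx
      exact (hfl x).1.trans (by linarith)
    have h2 := measure_mono (μ := volume) h1
    rw [vol_fl, vol_ball _ (by linarith)] at h2
    have h3 := ENNReal.toReal_mono (by simp) h2
    rw [ENNReal.toReal_mul, ENNReal.toReal_ofReal (pow_nonneg (by linarith) _), ENNReal.toReal_natCast] at h3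
    linarith

end IDLA

open MeasureTheory Filter
open scoped ENNReal

namespace IDLA

/-- reflection exchanging `x i` and `s * x j` -/
def refl {d : ℕ} (i j : Fin d) (s : ℤ) (x : V d) : V d :=
  fun k => if k = i then s * x j else if k = j then s * x i else x k

lemma refl_add {d : ℕ} (i j : Fin d) (s : ℤ) (x y : V d) : refl i j s (x + y) = refl i j s x + refl i j s y := by
  ext k; simp only [refl, Pi.add_apply]; split_ifs <;> ring

lemma refl_sub {d : ℕ} (i j : Fin d) (s : ℤ) (x y : V d) : refl i j s (x - y) = refl i j s x - refl i j s y := by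
  ext k; simp only [refl, Pi.sub_apply]; split_ifs <;> ring

lemma refl_E {d : ℕ} {i j : Fin d} (hij : i ≠ j) (s : ℤ) (k : Fin d) : 
    refl i j s (E k) = (if k = i ∨ k = j then s else 1) • E (Equiv.swap i j k) := by
  by_cases h1 : k = i
  · subst h1
    ext m
    simp only [refl, E, Equiv.swap_apply_left, Pi.smul_apply, Pi.single_apply, true_or, if_true, smul_eq_mul]
    grind
  · by_cases h2 : k = j
    · subst h2
      ext m
      simp only [refl, E, Equiv.swap_apply_right, Pi.smul_apply, Pi.single_apply, or_true, if_true, smul_eq_mul]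
      grind
    · ext m
      rw [Equiv.swap_apply_of_ne_of_ne h1 h2]
      simp only [refl, E, Pi.smul_apply, Pi.single_apply, smul_eq_mul]
      grind

lemma lap_refl {d : ℕ} {i j : Fin d} (hij : i ≠ j) {s : ℤ} (hs : s = 1 ∨ s = -1) (u : V d → ℝ) (x : V d) :
    lap (fun y => u (refl i j s y)) x = lap u (refl i j s x) := by
  unfold lap
  congr 2
  rw [← Equiv.sum_comp (Equiv.swap i j) (fun k => u (refl i j s x + E k) + u (refl i j s x - E k))]
  refine Finset.sum_congr rfl fun k _ => ?_
  beta_reduce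
  rw [refl_add, refl_sub, refl_E hij]
  split_ifs
  · rcases hs with rfl | rfl
    · simp
    · simp [add_comm, sub_eq_add_neg]
  · simp

lemma nsq_refl {d : ℕ} {i j : Fin d} (hij : i ≠ j) {s : ℤ} (hs : s = 1 ∨ s = -1) (x : V d) :
    nsq (refl i j s x) = nsq x := by
  unfold nsq
  rw [← Equiv.sum_comp (Equiv.swap i j) (fun k => (x k : ℝ)^2)]
  refine Finset.sum_congr rfl fun k _ => ?_
  unfold refl
  have hs2 : ((s:ℤ):ℝ)^2 = 1 := by rcases hs with rfl | rfl <;> norm_num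
  split_ifs with h1 h2
  · subst h1; rw [Equiv.swap_apply_left]; push_cast; rw [mul_pow, hs2, one_mul]
  · subst h2; rw [Equiv.swap_apply_right]; push_cast; rw [mul_pow, hs2, one_mul]
  · rw [Equiv.swap_apply_of_ne_of_ne h1 h2]

/-- the linear form -/
def lf {d : ℕ} (i j : Fin d) (s : ℤ) (x : V d) : ℤ := x i - s * x j

lemma lf_E {d : ℕ} {i j : Fin d} (hij : i ≠ j) (s : ℤ) (k : Fin d) :
    lf i j s (E k) = if k = i then 1 else if k = j then -s else 0 := by
  simp only [lf, E, Pi.single_apply]; grind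

lemma lf_add {d : ℕ} (i j : Fin d) (s : ℤ) (x y : V d) : lf i j s (x + y) = lf i j s x + lf i j s y := by
  simp only [lf, Pi.add_apply]; ring
lemma lf_sub {d : ℕ} (i j : Fin d) (s : ℤ) (x y : V d) : lf i j s (x - y) = lf i j s x - lf i j s y := by
  simp only [lf, Pi.sub_apply]; ring

lemma lap_lf {d : ℕ} (hd : 0 < d) (i j : Fin d) (s : ℤ) (x : V d) : lap (fun y => (lf i j s y : ℝ)) x = 0 := by
  have : (d:ℝ) ≠ 0 := by positivity
  unfold lap
  have : ∀ k, ((lf i j s (x + E k) : ℤ) : ℝ) + (lf i j s (x - E k) : ℤ) = 2 * lf i j s x := by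
    intro k; rw [lf_add, lf_sub]; push_cast; ring
  simp only [this, Finset.sum_const, Finset.card_univ, Fintype.card_fin, nsmul_eq_mul]
  field_simp; ring

lemma lap_lf_sq {d : ℕ} (hd : 0 < d) {i j : Fin d} (hij : i ≠ j) {s : ℤ} (hs : s = 1 ∨ s = -1) (x : V d) :
    lap (fun y => (lf i j s y : ℝ)^2) x = 2 / d := by
  have hd' : (d:ℝ) ≠ 0 := by positivity
  have hs2 : ((s:ℤ):ℝ)^2 = 1 := by rcases hs with rfl | rfl <;> norm_num
  unfold lap
  have : ∀ k, ((lf i j s (x + E k) : ℤ) : ℝ)^2 + ((lf i j s (x - E k) : ℤ) : ℝ)^2 =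
      2 * (lf i j s x : ℝ)^2 + ((if k = i then 2 else 0) + (if k = j then 2 else 0)) := by
    intro k; rw [lf_add, lf_sub, lf_E hij]
    by_cases h1 : k = i
    · have : k ≠ j := fun h => hij (h1.symm.trans h)
      simp [h1, this, hij]; ring
    · by_cases h2 : k = j
      · simp [h2, hij.symm]; linear_combination 2 * hs2
      · simp [h1, h2]; ring
  simp only [this, Finset.sum_add_distrib, Finset.sum_const, Finset.card_univ, Fintype.card_fin, nsmul_eq_mul, Finset.sum_ite_eq', Finset.mem_univ, if_true]
  field_simp; ring

lemma grad1 {d : ℕ} (hd : 2 ≤ d) (u : V d → ℝ) (M R : ℝ) (hR : 1 ≤ R) 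
    (hu : ∀ x, nsq x ≤ R^2 → lap u x = 0) (hM : ∀ x, nsq x ≤ (R+1)^2 → 0 ≤ u x ∧ u x ≤ M)
    {i j : Fin d} (hij : i ≠ j) {s : ℤ} (hs : s = 1 ∨ s = -1) : u (E i) - u (s • E j) ≤ 3 * d * M / R := by
  classical
  have hd0 : 0 < d := by omega
  have hdR : (2:ℝ) ≤ d := by exact_mod_cast hd
  have hM0 : 0 ≤ M := by
    have := hM 0 (by rw [nsq_zero]; positivity); linarith
  have hs2 : ((s:ℤ):ℝ)^2 = 1 := by rcases hs with rfl | rfl <;> norm_num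
  set S := (ball d R).filter (fun x => 0 < lf i j s x) with hS
  have hSmem : ∀ x, x ∈ S ↔ nsq x ≤ R^2 ∧ 0 < lf i j s x := fun x => by
    rw [hS, Finset.mem_filter, mem_ball (by linarith)]
  set ψ : V d → ℝ := fun x => (M/R^2) * nsq x + ((-(M*d/2)/R^2) * (lf i j s x : ℝ)^2 + (M*(2*d)/R) * (lf i j s x : ℝ)) with hψ
  have hψlap : ∀ x, lap ψ x = 0 := by
    intro x
    rw [hψ, lap_add (fun x => (M/R^2) * nsq x), lap_add (fun x => (-(M*d/2)/R^2) * (lf i j s x : ℝ)^2),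
      lap_const_mul, lap_const_mul (-(M*d/2)/R^2) (fun x => (lf i j s x : ℝ)^2), lap_const_mul (M*(2*d)/R) (fun x => (lf i j s x : ℝ)), lap_nsq hd0, lap_lf hd0, lap_lf_sq hd0 hij hs]
    field_simp; ring
  have hlfsq : ∀ x : V d, (lf i j s x : ℝ)^2 ≤ 4 * nsq x := by
    intro x
    have h1 := coord_sq_le x i
    have h2 := coord_sq_le x j
    unfold lf; push_cast
    have : ((s:ℝ) * x j)^2 = (x j : ℝ)^2 := by rw [mul_pow, hs2, one_mul]
    nlinarith [sq_nonneg ((x i:ℝ) + s * x j)]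
  have key : ∀ x ∈ S, u x - u (refl i j s x) ≤ ψ x := by
    refine max_principle' hd0 S ψ (fun x => u x - u (refl i j s x)) (fun x hx => ?_) (fun x hx hb => ?_)
    · have := (hSmem x).mp hx
      rw [hψlap, lap_sub u (fun x => u (refl i j s x)), lap_refl hij hs, hu x this.1, hu _ (by rw [nsq_refl hij hs]; exact this.1)]
      simp
    · have hl0 : 0 ≤ lf i j s x := by
        have hEk : ∀ k, |lf i j s (E k)| ≤ 1 := by
          intro k; rw [lf_E hij]; rcases hs with rfl | rfl <;> split_ifs <;> norm_num
        obtain ⟨k, h | h⟩ := hb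
        · have := ((hSmem _).mp h).2; rw [lf_sub] at this
          have := abs_le.mp (hEk k); omega
        · have := ((hSmem _).mp h).2; rw [lf_add] at this
          have := abs_le.mp (hEk k); omega
      have hnx : nsq x ≤ (R+1)^2 := by
        refine nsq_bdry (by linarith) x ?_
        obtain ⟨k, h | h⟩ := hb
        · exact ⟨k, Or.inl (Finset.mem_filter.mp h).1⟩
        · exact ⟨k, Or.inr (Finset.mem_filter.mp h).1⟩
      rcases hl0.eq_or_lt with h | h
      · have hfix : refl i j s x = x := by
          have h' : x i = s * x j := by unfold lf at h; linarith
          ext k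
          unfold refl
          split_ifs with h1 h2
          · rw [h1, h']
          · rw [h2, h', ← mul_assoc]
            rcases hs with rfl | rfl <;> simp
          · rfl
        rw [hfix, sub_self]
        simp only [hψ, ← h]
        have := nsq_nonneg x
        simp; positivity
      · have hbig : R^2 < nsq x := by
          by_contra hc
          exact hx ((hSmem x).mpr ⟨by linarith, h⟩)
        have h1 := hM x hnx
        have h2 := hM (refl i j s x) (by rw [nsq_refl hij hs]; exact hnx)
        have h3 : M ≤ (M/R^2) * nsq x := by
          rw [div_mul_eq_mul_div, le_div_iff₀ (by positivity)]; nlinarith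
        have hlp : (0:ℝ) < lf i j s x := by exact_mod_cast h
        have hl4 : (lf i j s x : ℝ) ≤ 4 * R := by
          refine (abs_le_of_sq_le_sq' ?_ (by linarith)).2
          have := hlfsq x
          nlinarith
        have h4 : 0 ≤ (-(M*d/2)/R^2) * (lf i j s x : ℝ)^2 + (M*(2*d)/R) * (lf i j s x : ℝ) := by
          have : (-(M*d/2)/R^2) * (lf i j s x : ℝ)^2 + (M*(2*d)/R) * (lf i j s x : ℝ) = (M * d / 2 / R^2) * lf i j s x * (4 * R - lf i j s x) := by
            field_simp; ring
          rw [this]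
          have : 0 ≤ 4 * R - lf i j s x := by linarith
          positivity
        simp only [hψ]; linarith
  have hE1 : nsq (E i) = 1 := by
    have := nsq_add_E 0 i; rw [zero_add, nsq_zero] at this; simpa using this
  have hEl : lf i j s (E i) = 1 := by rw [lf_E hij]; simp
  have := key (E i) ((hSmem _).mpr ⟨by rw [hE1]; nlinarith, by rw [hEl]; norm_num⟩)
  rw [refl_E hij, Equiv.swap_apply_left] at this
  simp only [true_or, if_true, hψ, hE1, hEl] at this
  refine this.trans ?_
  push_cast
  have e : M / R^2 * 1 + (-(M*d/2)/R^2 * 1^2 + M * (2*d)/R * 1) = 3 * d * M / R - (M * d / R^2) * (R - 1) - (M/R^2) * (3*d/2 - 1) := by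
    field_simp; ring
  rw [e]
  have h1 : 0 ≤ (M * d / R^2) * (R - 1) := mul_nonneg (by positivity) (by linarith)
  have h2 : 0 ≤ (M/R^2) * (3*d/2 - 1) := mul_nonneg (by positivity) (by linarith)
  linarith

lemma lap_neg {d : ℕ} (u : V d → ℝ) (x : V d) : lap (fun y => u (-y)) x = lap u (-x) := by
  unfold lap
  congr 2
  refine Finset.sum_congr rfl fun k _ => ?_
  beta_reduce
  rw [add_comm, neg_add, neg_sub, sub_eq_add_neg (-x), sub_eq_add_neg, add_comm (E k)]

lemma nsq_neg {d : ℕ} (x : V d) : nsq (-x) = nsq x := by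
  unfold nsq; simp

lemma grad {d : ℕ} (hd : 2 ≤ d) (u : V d → ℝ) (M R : ℝ) (hR : 1 ≤ R) 
    (hu : ∀ x, nsq x ≤ R^2 → lap u x = 0) (hM : ∀ x, nsq x ≤ (R+1)^2 → 0 ≤ u x ∧ u x ≤ M)
    (i : Fin d) {a : ℤ} (ha : a = 1 ∨ a = -1) : |u (a • E i) - u 0| ≤ 6 * d * M / R := by
  have hd0 : 0 < d := by omega
  have hM0 : 0 ≤ M := by
    have := hM 0 (by rw [nsq_zero]; positivity); linarith
  have g2 : ∀ i j : Fin d, i ≠ j → ∀ a b : ℤ, (a = 1 ∨ a = -1) → (b = 1 ∨ b = -1) → 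
      u (a • E i) - u (b • E j) ≤ 3 * d * M / R := by
    intro i j hij a b ha hb
    rcases ha with rfl | rfl
    · rw [one_smul]; exact grad1 hd u M R hR hu hM hij hb
    · have := grad1 hd (fun x => u (-x)) M R hR (fun x hx => by rw [lap_neg]; exact hu _ (by rwa [nsq_neg]))
        (fun x hx => hM _ (by rwa [nsq_neg])) hij (s := -b) (by omega)
      simpa using this
  have g3 : ∀ i j : Fin d, ∀ a b : ℤ, (a = 1 ∨ a = -1) → (b = 1 ∨ b = -1) → 
      u (a • E i) - u (b • E j) ≤ 6 * d * M / R := by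
    intro i j a b ha hb
    by_cases hij : i = j
    · subst hij
      have : Nontrivial (Fin d) := Fin.nontrivial_iff_two_le.mpr hd
      obtain ⟨k, hk⟩ := exists_ne i
      have h1 := g2 i k hk.symm a 1 ha (Or.inl rfl)
      have h2 := g2 k i hk 1 b (Or.inl rfl) hb
      have : 6 * d * M / R = 3 * d * M / R + 3 * d * M / R := by ring
      linarith
    · refine (g2 i j hij a b ha hb).trans ?_
      have : 6 * d * M / R = 3 * d * M / R + 3 * d * M / R := by ring
      have : 0 ≤ 3 * d * M / R := by positivity
      linarith
  have h0 := hu 0 (by rw [nsq_zero]; positivity)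
  unfold lap at h0
  have hdR : (0:ℝ) < d := by positivity
  rw [sub_eq_zero, div_eq_iff (by positivity)] at h0
  set B := 6 * d * M / R with hB
  set w := u (a • E i) with hw
  have hk1 : ∀ k, u (0 + E k) + u (0 - E k) ≤ 2 * w + 2 * B := by
    intro k
    have h1 := g3 k i 1 a (Or.inl rfl) ha
    have h2 := g3 k i (-1) a (Or.inr rfl) ha
    simp only [one_smul, neg_smul] at h1 h2
    rw [zero_add, zero_sub]; linarith
  have hk2 : ∀ k, 2 * w - 2 * B ≤ u (0 + E k) + u (0 - E k) := by
    intro k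
    have h1 := g3 i k a 1 ha (Or.inl rfl)
    have h2 := g3 i k a (-1) ha (Or.inr rfl)
    simp only [one_smul, neg_smul] at h1 h2
    rw [zero_add, zero_sub]; linarith
  have s1 := Finset.sum_le_sum (fun k (_ : k ∈ Finset.univ) => hk1 k)
  have s2 := Finset.sum_le_sum (fun k (_ : k ∈ Finset.univ) => hk2 k)
  rw [h0] at s1 s2
  simp only [Finset.sum_const, Finset.card_univ, Fintype.card_fin, nsmul_eq_mul] at s1 s2
  rw [abs_le]
  constructor <;> nlinarith

lemma l1_sq {d : ℕ} (x : V d) : nsq x ≤ (l1 x : ℝ)^2 := by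
  unfold nsq l1
  push_cast
  have : ∀ s : Finset (Fin d), ∑ i ∈ s, (x i:ℝ)^2 ≤ (∑ i ∈ s, |(x i:ℝ)|)^2 := by
    intro s
    induction s using Finset.induction_on with
    | empty => simp
    | insert a s ha ih =>
      rw [Finset.sum_insert ha, Finset.sum_insert ha]
      have h1 : 0 ≤ ∑ i ∈ s, |(x i:ℝ)| := Finset.sum_nonneg fun _ _ => abs_nonneg _
      have h2 := abs_nonneg (x a : ℝ)
      have h3 := sq_abs (x a : ℝ)
      nlinarith
  exact this Finset.univ

lemma osc {d : ℕ} (hd : 2 ≤ d) (u : V d → ℝ) (M R : ℝ) (hR : 1 ≤ R) 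
    (hu : ∀ x, nsq x ≤ 16 * R^2 → lap u x = 0) (hM : ∀ x, nsq x ≤ 16 * R^2 → 0 ≤ u x ∧ u x ≤ M) :
    ∀ (m : ℕ) (x : V d), l1 x = m → (m:ℝ) ≤ R → |u x - u 0| ≤ m * (6 * d * M / R) := by
  intro m
  induction m with
  | zero =>
    intro x hx _
    have : nsq x ≤ 0 := by have := l1_sq x; rw [hx] at this; simpa using this
    have : x = 0 := by
      ext i
      have := (coord_sq_le x i).trans this
      have : (x i : ℝ) = 0 := by nlinarith
      exact_mod_cast this
    simp [this]
  | succ m ih =>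
    intro x hx hm
    push_cast at hm
    have hx0 : x ≠ 0 := by
      rintro rfl
      simp [l1] at hx; omega
    have step : ∀ y : V d, l1 y = m → ∀ (i : Fin d) (a : ℤ), (a = 1 ∨ a = -1) → x = y + a • E i → |u x - u 0| ≤ ((m+1:ℕ):ℝ) * (6 * d * M / R) := by
      intro y hy i a ha hxy
      have hny : nsq y ≤ R^2 := by
        refine (l1_sq y).trans ?_
        rw [hy]; push_cast
        have : (0:ℝ) ≤ m := by positivity
        nlinarith
      have hb : ∀ w : V d, nsq w ≤ (R+1)^2 → nsq (w - -y) ≤ 16 * R^2 := by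
        intro w hw
        have := nsq_sub_le w (-y)
        rw [nsq_neg] at this
        nlinarith
      have := grad hd (fun w => u (w - -y)) M R hR (fun w hw => by
        rw [lap_translate]; exact hu _ (hb w (by nlinarith))) (fun w hw => hM _ (hb w hw)) i ha
      simp only [sub_neg_eq_add, zero_add] at this
      rw [hxy, add_comm y]
      have h2 := ih y hy (by linarith)
      have h3 := abs_sub_le (u (a • E i + y)) (u y) (u 0)
      push_cast
      linarith
    obtain ⟨i, ⟨_, h⟩ | ⟨_, h⟩⟩ := l1_dec hx0
    · exact step (x - E i) (by rw [h, hx]; push_cast; ring) i 1 (Or.inl rfl) (by simp)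
    · exact step (x + E i) (by rw [h, hx]; push_cast; ring) i (-1) (Or.inr rfl) (by simp)

end IDLA

open MeasureTheory Filter
open scoped ENNReal

namespace IDLA

/-- powers of the norm slightly more singular than the Green function are subharmonic far away -/
lemma F_subharm {d : ℕ} (hd : 2 ≤ d) (η a : ℝ) (hη : 0 < η) (hη1 : η ≤ 1) (ha : 2 * (a+1) = d * (1+η))
    (x : V d) (hx : 4 * d ≤ η * nsq x) : 0 ≤ lap (fun y => (nsq y)^(-a)) x := by
  have hdR : (2:ℝ) ≤ d := by exact_mod_cast hd
  set s := nsq x with hs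
  have ha0 : 0 < a := by nlinarith
  have had : a + 1 ≤ d := by nlinarith
  have hs1 : 4 * d ≤ s := by nlinarith [nsq_nonneg x]
  set c := s + 1 with hc
  have hc0 : 0 < c := by linarith
  have hcs : 0 < c^(-a) := Real.rpow_pos_of_pos hc0 _
  have hui : ∀ i, |2 * (x i:ℝ) / c| < 1 := by
    intro i
    rw [abs_div, abs_of_pos hc0, div_lt_one hc0]
    apply abs_lt_of_sq_lt_sq _ hc0.le
    have h1 := coord_sq_le x i
    nlinarith
  have hterm : ∀ i, c^(-a) * (2 + a*(a+1) * (2 * (x i:ℝ)/c)^2) ≤ (nsq (x + E i))^(-a) + (nsq (x - E i))^(-a) := by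
    intro i
    have h1 := second_diff_lower ha0.le (hui i)
    have hle := abs_lt.mp (hui i)
    rw [nsq_add_E, nsq_sub_E]
    have e1 : nsq x + 2 * (x i:ℝ) + 1 = c * (1 + 2*(x i:ℝ)/c) := by
      field_simp; rw [hc, ← hs]; ring
    have e2 : nsq x - 2 * (x i:ℝ) + 1 = c * (1 - 2*(x i:ℝ)/c) := by
      field_simp; rw [hc, ← hs]; ring
    rw [e1, e2, Real.mul_rpow (by linarith) (by linarith), Real.mul_rpow (by linarith) (by linarith), ← mul_add]
    exact mul_le_mul_of_nonneg_left h1 hcs.le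
  have hsum := Finset.sum_le_sum (fun i (_ : i ∈ Finset.univ) => hterm i)
  have hlhs : ∑ i, c^(-a) * (2 + a*(a+1) * (2 * (x i:ℝ)/c)^2) = c^(-a) * (1 + a*(1+η)*s/c^2) * (2*d) := by
    rw [← Finset.mul_sum, Finset.sum_add_distrib, ← Finset.mul_sum]
    have : ∑ i, (2 * (x i:ℝ)/c)^2 = 4/c^2 * s := by
      rw [hs]; unfold nsq; rw [Finset.mul_sum]; refine Finset.sum_congr rfl fun i _ => ?_
      field_simp; ring
    have hcd : ∑ _i : Fin d, (2:ℝ) = 2 * d := by simp; ring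
    have hb : a * (a+1) = a * (d * (1+η)/2) := by rw [← ha]; ring
    rw [this, hcd, hb]; ring
  rw [hlhs] at hsum
  have hfin : s^(-a) ≤ c^(-a) * (1 + a*(1+η)*s/c^2) := by
    have hs0 : 0 < s := by linarith
    have e : s^(-a) = c^(-a) * (1 + 1/s)^a := by
      have : c = s * (1 + 1/s) := by field_simp; rw [hc]
      rw [this, Real.mul_rpow hs0.le (by positivity), mul_assoc, ← Real.rpow_add (by positivity)]
      simp
    rw [e]
    apply mul_le_mul_of_nonneg_left _ hcs.le
    have h1 : (1 + 1/s)^a ≤ Real.exp (a/s) := by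
      have : 1 + 1/s ≤ Real.exp (1/s) := by linarith [Real.add_one_le_exp (1/s)]
      calc (1 + 1/s)^a ≤ (Real.exp (1/s))^a := Real.rpow_le_rpow (by positivity) this ha0.le
        _ = _ := by rw [← Real.exp_mul]; ring_nf
    have h2 : Real.exp (a/s) ≤ 1 + a/s + (a/s)^2 := by
      have hle : |a/s| ≤ 1 := by
        rw [abs_of_pos (by positivity), div_le_one hs0]; linarith
      have := Real.abs_exp_sub_one_sub_id_le hle
      have := (abs_le.mp this).2
      linarith
    have h3 : a/s + (a/s)^2 ≤ a*(1+η)*s/c^2 := by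
      have : a/s + (a/s)^2 = a * (s + a)/s^2 := by field_simp
      rw [this, div_le_div_iff₀ (by positivity) (by positivity)]
      have key : (s+a)*c^2 ≤ (1+η)*s^3 := by
        rw [hc]
        have h4 : 4 * d * s^2 ≤ η * s * s^2 := mul_le_mul_of_nonneg_right hx (by positivity)
        have h5 : (1 + 2*a)*s ≤ (1+2*a)*s^2 := mul_le_mul_of_nonneg_left (by nlinarith) (by positivity)
        have h6 : a ≤ a * s^2 := le_mul_of_one_le_right ha0.le (by nlinarith)
        have h7 : (3 + 4*a)*s^2 ≤ 4*d*s^2 := mul_le_mul_of_nonneg_right (by linarith) (by positivity)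
        nlinarith
      calc a * (s+a) * c^2 = a * ((s+a)*c^2) := by ring
        _ ≤ a * ((1+η)*s^3) := mul_le_mul_of_nonneg_left key ha0.le
        _ = _ := by ring
    linarith
  unfold lap
  rw [sub_nonneg]
  refine hfin.trans ?_
  rw [le_div_iff₀ (by linarith)]
  exact hsum

/-- truncated potential -/
noncomputable def Upot {d : ℕ} (r a : ℝ) (x : V d) : ℝ :=
  if r ≤ nsq x then (nsq x)^(-a) else r^(-a) - a * r^(-a-1) * (nsq x - r)

lemma Upot_lap {d : ℕ} (hd : 2 ≤ d) (η a ρ : ℝ) (hη : 0 < η) (hη1 : η ≤ 1) (ha : 2 * (a+1) = d * (1+η))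
    (hρ : 1 ≤ ρ) (hρη : 4 * d ≤ η * ρ^2) (x : V d) :
    (nsq x ≤ ρ^2 → - lap (Upot (ρ^2) a) x ≤ a * (ρ^2)^(-a-1)) ∧
    (nsq x ≤ (ρ+1)^2 → - lap (Upot (ρ^2) a) x ≤ (1 + 9*d) * (a * (ρ^2)^(-a-1))) ∧
    ((ρ+1)^2 < nsq x → - lap (Upot (ρ^2) a) x ≤ 0) := by
  have hd0 : 0 < d := by omega
  have hdR : (2:ℝ) ≤ d := by exact_mod_cast hd
  have ha0 : 0 < a := by nlinarith
  have had : a + 1 ≤ d := by nlinarith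
  set r := ρ^2 with hr
  have hr1 : 1 ≤ r := by rw [hr]; nlinarith
  have hr0 : 0 < r := by linarith
  set B := a * r^(-a-1) with hB
  have hB0 : 0 < B := by rw [hB]; have := Real.rpow_pos_of_pos hr0 (-a-1); positivity
  let Q : V d → ℝ := fun x => (r^(-a) + B * r) + (-B) * nsq x
  have hQ : ∀ x, Q x = r^(-a) - B * (nsq x - r) := fun x => by simp only [Q]; ring
  have hQlap : ∀ x, lap Q x = -B := by
    intro x
    rw [show Q = fun x => (fun _ => (r^(-a) + B * r)) x + (-B) * nsq x from rfl, lap_add (fun _ => (r^(-a) + B * r)), lap_const hd0, lap_const_mul, lap_nsq hd0]; ring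
  have hQU : ∀ y, Q y ≤ Upot r a y := by
    intro y
    unfold Upot
    rw [hQ]
    split_ifs with h
    · exact tangent_neg ha0.le hr0 (by linarith)
    · exact le_rfl
  have hsmall : nsq x ≤ r → - lap (Upot r a) x ≤ B := by
    intro hx
    have := lap_mono (Upot r a) Q x (by
      unfold Upot
      rw [hQ]
      split_ifs with h
      · have : nsq x = r := le_antisymm hx h
        rw [this]; ring
      · rfl) hQU
    rw [hQlap] at this; linarith
  refine ⟨hsmall, ?_, ?_⟩
  · intro hx
    rcases le_or_gt (nsq x) r with h | h
    · refine (hsmall h).trans ?_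
      nlinarith
    · have hFQ : (nsq x)^(-a) - Q x ≤ 9 * d * B := by
        have hs0 : 0 < nsq x := by linarith
        have t1 := tangent_neg ha0.le hs0 hr0
        have t2 := bern_neg (p := a+1) (v := (nsq x - r)/r) (by linarith) (by
          have : 0 ≤ (nsq x - r)/r := div_nonneg (by linarith) hr0.le
          linarith)
        have e1 : 1 + (nsq x - r)/r = nsq x / r := by field_simp; ring
        rw [e1, Real.div_rpow hs0.le hr0.le, show -(a+1) = -a-1 by ring] at t2
        have hrp : 0 < r^(-a-1) := Real.rpow_pos_of_pos hr0 _
        rw [le_div_iff₀ hrp] at t2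
        set t := nsq x - r with ht
        have ht0 : 0 ≤ t := by linarith
        have ht2 : t^2 ≤ 9 * r := by
          have : t ≤ 3 * ρ := by rw [ht, hr]; nlinarith
          rw [hr]; nlinarith
        rw [hQ]
        have h3 : a * t * ((1 - (a+1)*(t/r)) * r^(-a-1)) ≤ a * t * (nsq x)^(-a-1) := mul_le_mul_of_nonneg_left t2 (by positivity)
        have e2 : a * t * ((1 - (a+1)*(t/r)) * r^(-a-1)) = B * t - B * (a+1) * (t^2/r) := by
          rw [hB]; field_simp
        rw [e2] at h3
        have h4 : t^2/r ≤ 9 := by rw [div_le_iff₀ hr0]; exact ht2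
        have h5 : B * (a+1) * (t^2/r) ≤ B * d * 9 := by
          apply mul_le_mul (mul_le_mul_of_nonneg_left had hB0.le) h4 (by positivity) (by positivity)
        have e3 : a * (nsq x)^(-a-1) * (r - nsq x) = -(a * t * (nsq x)^(-a-1)) := by rw [ht]; ring
        rw [e3] at t1
        rw [← ht]
        linarith
      have hUx : Upot r a x = (nsq x)^(-a) := by unfold Upot; rw [if_pos h.le]
      have hl : lap Q x + Q x ≤ lap (Upot r a) x + Upot r a x := by
        unfold lap
        rw [sub_add_cancel, sub_add_cancel]
        gcongr with i
        · exact hQU _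
        · exact hQU _
      rw [hQlap, hUx] at hl
      linarith
  · intro hx
    have hnb : ∀ i, r ≤ nsq (x + E i) ∧ r ≤ nsq (x - E i) := by
      intro i
      constructor
      · by_contra hc
        push Not at hc
        have := (nsq_nbr_le (by linarith : 0 ≤ ρ) (x + E i) hc.le i).2
        rw [add_sub_cancel_right] at this; linarith
      · by_contra hc
        push Not at hc
        have := (nsq_nbr_le (by linarith : 0 ≤ ρ) (x - E i) hc.le i).1
        rw [sub_add_cancel] at this; linarith
    have hxr : r ≤ nsq x := by nlinarith
    have e : lap (Upot r a) x = lap (fun y => (nsq y)^(-a)) x := by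
      unfold lap Upot
      rw [if_pos hxr]
      congr 2
      refine Finset.sum_congr rfl fun i _ => ?_
      rw [if_pos (hnb i).1, if_pos (hnb i).2]
    rw [e]
    have := F_subharm hd η a hη hη1 ha x (hρη.trans (mul_le_mul_of_nonneg_left hxr hη.le))
    linarith

lemma green_lower {d : ℕ} (hd : 2 ≤ d) (η a ρ n : ℝ) (hη : 0 < η) (hη1 : η ≤ 1) (ha : 2 * (a+1) = d * (1+η))
    (hρ : 1 ≤ ρ) (hρη : 4 * d ≤ η * ρ^2) (hn : ρ ≤ n) (z : V d) (hz : z ∈ ball d n) (hzρ : ρ^2 ≤ nsq z)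
    (g : V d → ℝ) (hg : IsGreen (ball d n) z g) (M : ℝ) (hM : ∀ x ∈ ball d (ρ+1), g x ≤ M) :
    (nsq z)^(-a) - (n^2)^(-a) ≤ a * (ρ^2)^(-a-1) * M * ((1+9*d) * (ball d (ρ+1)).card - 9*d*(ball d ρ).card) := by
  classical
  have hd0 : 0 < d := by omega
  have hdR : (2:ℝ) ≤ d := by exact_mod_cast hd
  have ha0 : 0 < a := by nlinarith
  have hρ0 : 0 ≤ ρ := by linarith
  have hn0 : 0 ≤ n := by linarith
  set B := a * (ρ^2)^(-a-1) with hB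
  have hB0 : 0 < B := by rw [hB]; have := Real.rpow_pos_of_pos (by positivity : 0 < ρ^2) (-a-1); positivity
  set c := (n^2)^(-a) with hc
  have hgr := green (ball d n) g (fun x => Upot (ρ^2) a x - c) hg.1
  have hlapφ : ∀ x : V d, lap (fun x => Upot (ρ^2) a x - c) x = lap (Upot (ρ^2) a) x := by
    intro x; rw [lap_sub (Upot (ρ^2) a) (fun _ => c), lap_const hd0, sub_zero]
  simp only [hlapφ] at hgr
  have hlhs : ∑ x ∈ cl (ball d n), (Upot (ρ^2) a x - c) * lap g x ≤ -((nsq z)^(-a) - c) := by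
    have hzc : z ∈ cl (ball d n) := subset_cl _ hz
    rw [← Finset.add_sum_erase _ _ hzc, hg.2.2]
    have hUz : Upot (ρ^2) a z = (nsq z)^(-a) := by unfold Upot; rw [if_pos hzρ]
    rw [hUz]
    have : ∑ x ∈ (cl (ball d n)).erase z, (Upot (ρ^2) a x - c) * lap g x ≤ 0 := by
      refine Finset.sum_nonpos fun x hx => ?_
      rw [Finset.mem_erase] at hx
      by_cases hxb : x ∈ ball d n
      · rw [hg.2.1 x hxb hx.1, mul_zero]
      · refine mul_nonpos_of_nonpos_of_nonneg ?_ (green_lap_nonneg hd0 hg x hx.1)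
        rw [mem_ball hn0] at hxb
        push Not at hxb
        have hx2 : ρ^2 ≤ nsq x := by nlinarith
        unfold Upot
        rw [if_pos hx2, sub_nonpos, hc]
        exact Real.rpow_le_rpow_of_nonpos (by nlinarith) hxb.le (by linarith)
    linarith
  have hrhs : ∑ x ∈ ball d n, g x * (- lap (Upot (ρ^2) a) x) ≤ B * M * ((1+9*d) * (ball d (ρ+1)).card - 9*d*(ball d ρ).card) := by
    let wt : V d → ℝ := fun x => B * ((if x ∈ ball d (ρ+1) then (1+9*d:ℝ) else 0) - (if x ∈ ball d ρ then (9*d:ℝ) else 0))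
    have hsub : ball d ρ ⊆ ball d (ρ+1) := by
      intro x hx
      rw [mem_ball hρ0] at hx
      rw [mem_ball (by linarith)]; nlinarith
    have hw0 : ∀ x, 0 ≤ wt x := by
      intro x
      simp only [wt]
      by_cases h1 : x ∈ ball d ρ
      · rw [if_pos h1, if_pos (hsub h1)]; nlinarith
      · rw [if_neg h1]; split_ifs <;> simp <;> positivity
    have hw1 : ∀ x, - lap (Upot (ρ^2) a) x ≤ wt x := by
      intro x
      obtain ⟨u1, u2, u3⟩ := Upot_lap hd η a ρ hη hη1 ha hρ hρη x
      simp only [wt]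
      by_cases h1 : x ∈ ball d ρ
      · rw [if_pos h1, if_pos (hsub h1)]
        have := u1 ((mem_ball hρ0 _).mp h1); nlinarith
      · rw [if_neg h1]
        by_cases h2 : x ∈ ball d (ρ+1)
        · rw [if_pos h2]
          have := u2 ((mem_ball (by linarith) _).mp h2); linarith
        · rw [if_neg h2]
          rw [mem_ball (by linarith)] at h2
          have := u3 (by linarith); linarith
    have hg0 := fun x => green_nonneg hd0 hg x
    calc ∑ x ∈ ball d n, g x * (- lap (Upot (ρ^2) a) x) ≤ ∑ x ∈ ball d n, g x * wt x :=
          Finset.sum_le_sum fun x _ => mul_le_mul_of_nonneg_left (hw1 x) (hg0 x)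
      _ ≤ ∑ x ∈ ball d n ∪ ball d (ρ+1), g x * wt x :=
          Finset.sum_le_sum_of_subset_of_nonneg Finset.subset_union_left (fun x _ _ => mul_nonneg (hg0 x) (hw0 x))
      _ = ∑ x ∈ ball d (ρ+1), g x * wt x := by
          symm
          refine Finset.sum_subset Finset.subset_union_right fun x _ hx => ?_
          have : wt x = 0 := by
            simp only [wt]; rw [if_neg hx, if_neg (fun h => hx (hsub h))]; ring
          rw [this, mul_zero]
      _ ≤ ∑ x ∈ ball d (ρ+1), M * wt x :=
          Finset.sum_le_sum fun x hx => mul_le_mul_of_nonneg_right (hM x hx) (hw0 x)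
      _ = _ := by
          rw [← Finset.mul_sum]
          simp only [wt]
          rw [← Finset.mul_sum, Finset.sum_sub_distrib, ← Finset.sum_filter, ← Finset.sum_filter,
            Finset.filter_mem_eq_inter, Finset.filter_mem_eq_inter, Finset.inter_self,
            Finset.inter_eq_right.mpr hsub]
          simp only [Finset.sum_const, nsmul_eq_mul]
          ring
  have e : ∑ x ∈ ball d n, g x * (- lap (Upot (ρ^2) a) x) = - ∑ x ∈ ball d n, g x * lap (Upot (ρ^2) a) x := by
    rw [← Finset.sum_neg_distrib]; exact Finset.sum_congr rfl fun x _ => by ring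
  rw [e, ← hgr] at hrhs
  linarith

end IDLA

open MeasureTheory Filter
open scoped ENNReal

namespace IDLA

lemma l1_le {d : ℕ} (x : V d) (s : ℝ) (hs : 0 ≤ s) (hx : nsq x ≤ s^2) : (l1 x : ℝ) ≤ d * s := by
  unfold l1
  push_cast
  calc ∑ i, |(x i:ℝ)| ≤ ∑ i : Fin d, s := Finset.sum_le_sum fun i _ => abs_le_of_sq_le_sq ((coord_sq_le x i).trans hx) hs
    _ = d * s := by simp

lemma green_osc {d : ℕ} (hd : 2 ≤ d) (n : ℕ) (hn : 32 ≤ n) (z : V d) (hz1 : (n:ℝ)^2/16 ≤ nsq z)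
    (g : V d → ℝ) (hg : IsGreen (ball d n) z g) (M : ℝ)
    (hM : ∀ x, (n:ℝ)^2/64 ≤ nsq (x - z) → g x ≤ M) (s : ℝ) (hs0 : 0 ≤ s) (hs : d * s ≤ n/32) :
    ∀ x ∈ ball d s, |g x - g 0| ≤ d * s * (192 * d * M / n) := by
  intro x hx
  have hnR : (32:ℝ) ≤ n := by exact_mod_cast hn
  have hd0 : 0 < d := by omega
  rw [mem_ball hs0] at hx
  have hfar : ∀ x, nsq x ≤ 16 * ((n:ℝ)/32)^2 → (n:ℝ)^2/64 ≤ nsq (x - z) := by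
    intro x hx
    have := nsq_sub_le x (x - z)
    rw [sub_sub_cancel] at this
    nlinarith
  have hM0 : 0 ≤ M := (green_nonneg hd0 hg 0).trans (hM 0 (hfar 0 (by rw [nsq_zero]; positivity)))
  have hl0 := l1_nonneg x
  obtain ⟨m, hm⟩ := Int.eq_ofNat_of_zero_le hl0
  have hl := l1_le x s hs0 hx
  have hm' : (m:ℝ) ≤ d * s := by rw [hm] at hl; exact_mod_cast hl
  have := osc hd g M (n/32) (by linarith) (fun x hx => by
      refine hg.2.1 x ?_ ?_
      · rw [mem_ball (by positivity)]; nlinarith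
      · rintro rfl
        nlinarith) (fun x hx => ⟨green_nonneg hd0 hg x, hM x (hfar x hx)⟩) m x hm (by linarith)
  refine this.trans ?_
  have e : 6 * d * M / ((n:ℝ)/32) = 192 * d * M / n := by
    field_simp; ring
  rw [e]
  exact mul_le_mul_of_nonneg_right hm' (by positivity)

lemma log_lower {t : ℝ} (h0 : 0 < t) (h1 : t ≤ 1) : (1 - t) + (1-t)^2/2 ≤ Real.log (1/t) := by
  -- f(t) = -log t - (1-t) - (1-t)^2/2 is antitone, zero at 1
  have key : AntitoneOn (fun t : ℝ => -Real.log t - (1-t) - (1-t)^2/2) (Set.Icc t 1) := by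
    have hder : ∀ x ∈ Set.Icc t 1, HasDerivAt (fun t : ℝ => -Real.log t - (1-t) - (1-t)^2/2) (-(1-x)^2/x) x := by
      intro x hx
      have hx0 : x ≠ 0 := by linarith [hx.1]
      have h1 := (Real.hasDerivAt_log hx0).neg
      have h2 := (hasDerivAt_id x).const_sub 1
      have h3 := (h2.pow 2).div_const 2
      have := (h1.sub h2).sub h3
      refine this.congr_deriv ?_
      simp
      field_simp; ring
    refine antitoneOn_of_hasDerivWithinAt_nonpos (convex_Icc _ _) (fun x hx => (hder x hx).continuousAt.continuousWithinAt)
      (f' := fun x => -(1-x)^2/x) ?_ ?_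
    · intro x hx; rw [interior_Icc] at hx ⊢; exact (hder x ⟨hx.1.le, hx.2.le⟩).hasDerivWithinAt
    · intro x hx; rw [interior_Icc] at hx
      apply div_nonpos_of_nonpos_of_nonneg
      · nlinarith [sq_nonneg (1-x)]
      · linarith [hx.1]
  have := key ⟨le_rfl, h1⟩ ⟨h1, le_rfl⟩ h1
  simp at this
  rw [one_div, Real.log_inv]
  linarith

lemma pow_upper (d : ℕ) {u : ℝ} (h0 : 0 ≤ u) (h1 : u ≤ 1) : (1+u)^d ≤ 1 + 2^d * u := by
  have : (1+u)^d ≤ 1 + (2^d - 1) * u := by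
    induction d with
    | zero => simp
    | succ k ih =>
      have : (1:ℝ) ≤ 2^k := one_le_pow₀ (by norm_num)
      rw [pow_succ, pow_succ]
      have h3 := mul_le_mul_of_nonneg_right ih (by linarith : 0 ≤ 1 + u)
      nlinarith [mul_nonneg (by linarith : (0:ℝ) ≤ 2^k - 1) (mul_nonneg h0 (by linarith : 0 ≤ 1 - u))]
  linarith

/-- arithmetic core -/
lemma arith_core {q y L A c3 c4 : ℝ} (hq0 : 0 < q) (hq1 : q ≤ 1) (hy : q ≤ y) (hL : y + y^2/2 ≤ L)
    (hA : 1 - q/16 ≤ A) (h3 : c3 ≤ q^2/16) (h4 : c4 ≤ q^2/16) :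
    y + c4 ≤ (1 - q/8) * (L * A - c3) ∧ q ≤ L * A - c3 := by
  have hy0 : 0 < y := by linarith
  have hqy : q^2 ≤ y * q := by nlinarith
  have h1 : y * (1 + q/2) ≤ L := by nlinarith
  have h2 : y * (1 + q/2) * (1 - q/16) ≤ L * A := by
    apply mul_le_mul h1 hA (by linarith) 
    exact le_trans (by positivity) h1
  have h5 : y * (1 + 11/32*q) ≤ L * A - c3 := by
    nlinarith [mul_nonneg hy0.le (mul_nonneg hq0.le (by linarith : 0 ≤ 1 - q))]
  constructor
  · have h6 : (1 - q/8) * (y * (1 + 11/32*q)) ≤ (1 - q/8) * (L * A - c3) := 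
      mul_le_mul_of_nonneg_left h5 (by linarith)
    refine le_trans ?_ h6
    nlinarith [mul_nonneg hy0.le (mul_nonneg hq0.le (by linarith : 0 ≤ 1 - q))]
  · nlinarith


set_option maxHeartbeats 2000000 in
lemma g_main {d : ℕ} (hd : 2 ≤ d) (n : ℕ) (hn : 32 ≤ n) (w : ℝ) (hw : 0 < w)
    (hw1 : ∀ r : ℝ, 0 ≤ r → ((ball d r).card : ℝ) ≤ w * (r + d)^d)
    (hw2 : ∀ r : ℝ, d ≤ r → w * (r - d)^d ≤ (ball d r).card)
    (ρ η q ε1 D : ℝ) (hρ : d + 1 ≤ ρ) (hη0 : 0 < η) (hη1 : η ≤ 1) (E1 : 4 * d ≤ η * ρ^2)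
    (E3 : d * (ρ+1) ≤ n/32) (hq0 : 0 < q) (hq1 : q ≤ 1) (z : V d) (hz1 : (n:ℝ)^2/16 ≤ nsq z)
    (hz2 : nsq z ≤ ((n:ℝ) * (1-q))^2) (g : V d → ℝ) (hg : IsGreen (ball d n) z g)
    (hD : ∀ x ∈ ball d (ρ+1), |g x - g 0| ≤ D)
    (hε1 : 1 - ε1 ≤ (ρ/n)^((d:ℝ)*η)) (hε10 : 0 ≤ ε1)
    (E4 : ε1 + d^2/n + ((1+9*d)*(2^d*(1+d)) + 9*d*d^2)/ρ ≤ q/16)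
    (E5 : (ball d n).card * D ≤ (n:ℝ)^2 * (q^2/16)) (E6 : 3/(n:ℝ) ≤ q^2/16) :
    ∑ x ∈ ball d n, g x ≤ (1 - q/8) * ((ball d n).card * g 0) ∧ (n:ℝ)^2 * q ≤ (ball d n).card * g 0 := by
  have hd0 : 0 < d := by omega
  have hdR : (2:ℝ) ≤ d := by exact_mod_cast hd
  have hnR : (32:ℝ) ≤ n := by exact_mod_cast hn
  set N : ℝ := (n:ℝ) with hN
  have hN0 : 0 < N := by linarith
  have hρ0 : 0 < ρ := by linarith
  have hρN : ρ ≤ N/4 := by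
    clear * - hdR E3 hρ0 hN0
    nlinarith
  have hz : z ∈ ball d N := by
    rw [mem_ball hN0.le]; refine hz2.trans ?_
    apply pow_le_pow_left₀ (mul_nonneg hN0.le (by linarith))
    clear * - hq0 hN0
    nlinarith
  obtain ⟨a, ha⟩ : ∃ a : ℝ, 2 * (a+1) = d * (1+η) := ⟨d*(1+η)/2 - 1, by ring⟩
  have ha0 : 0 < a := by
    clear * - ha hdR hη0
    nlinarith
  have hgl := green_lower hd η a ρ N hη0 hη1 ha (by linarith) E1 (by linarith) z hz (by clear * - hz1 hρN hρ0 hN0; nlinarith) g hg (g 0 + D)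
    (fun x hx => by have := (abs_le.mp (hD x hx)).2; linarith)
  set M := g 0 + D with hM
  have hD0 : 0 ≤ D := (abs_nonneg _).trans (hD 0 (by rw [mem_ball (by linarith), nsq_zero]; positivity))
  have hM0 : 0 ≤ M := by have := green_nonneg hd0 hg 0; linarith
  set t := nsq z / N^2 with ht
  have hzt : nsq z = N^2 * t := by rw [ht]; field_simp
  have ht0 : 0 < t := by
    rw [ht]; apply div_pos _ (by positivity)
    have : 0 < N^2 := by positivity
    linarith
  have hty : t ≤ (1-q)^2 := by
    rw [ht, div_le_iff₀ (by positivity)]; rw [mul_pow] at hz2; linarith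
  have ht1 : t ≤ 1 := by
    clear * - hty hq0 hq1
    nlinarith
  have hL := log_lower ht0 ht1
  set L := Real.log (1/t) with hLdef
  have hL0 : 0 ≤ L := by have := sq_nonneg (1-t); linarith
  -- ball counts
  set ε2 := (d:ℝ)^2/N with hε2
  set ε3 := ((1+9*d)*(2^d*(1+d)) + 9*d*(d:ℝ)^2)/ρ with hε3
  have hW : (1+9*d) * ((ball d (ρ+1)).card:ℝ) - 9*d*(ball d ρ).card ≤ w * ρ^d * (1 + ε3) := by
    have h1 := hw1 (ρ+1) (by linarith)
    have h2 := hw2 ρ (by linarith)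
    have e1 : ρ + 1 + d = ρ * (1 + (1+d)/ρ) := by field_simp; ring
    have e2 : ρ - d = ρ * (1 + -(d/ρ)) := by field_simp; ring
    rw [e1, mul_pow] at h1
    rw [e2, mul_pow] at h2
    have h3 := pow_upper d (u := (1+d)/ρ) (by positivity) (by rw [div_le_one hρ0]; linarith)
    have h4 := one_add_mul_le_pow (a := -((d:ℝ)/ρ)) (by
      have : (d:ℝ)/ρ ≤ 1 := by rw [div_le_one hρ0]; linarith
      linarith) d
    have hwr : 0 < w * ρ^d := by positivity
    have h5 := mul_le_mul_of_nonneg_left h3 hwr.le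
    have h6 := mul_le_mul_of_nonneg_left h4 hwr.le
    have h7 : (1+9*d) * ((ball d (ρ+1)).card:ℝ) ≤ (1+9*d) * (w * ρ^d * (1 + 2^d * ((1+d)/ρ))) :=
      mul_le_mul_of_nonneg_left (by linarith) (by positivity)
    have h8 : 9*d*(w * ρ^d * (1 + d * -(d/ρ))) ≤ 9*d*((ball d ρ).card:ℝ) :=
      mul_le_mul_of_nonneg_left (by linarith) (by positivity)
    have e3 : w * ρ^d * (1 + ε3) = (1+9*d) * (w * ρ^d * (1 + 2^d * ((1+d)/ρ))) - 9*d*(w * ρ^d * (1 + d * -(d/ρ))) := by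
      rw [hε3]; field_simp; ring
    rw [e3]; linarith
  have hb : w * N^d * (1 - ε2) ≤ (ball d N).card := by
    have hdN : (d:ℝ) ≤ N := by linarith
    have h2 := hw2 N hdN
    have e2 : N - d = N * (1 + -(d/N)) := by field_simp; ring
    rw [e2, mul_pow] at h2
    have h4 := one_add_mul_le_pow (a := -((d:ℝ)/N)) (by
      have : (d:ℝ)/N ≤ 1 := by rw [div_le_one hN0]; exact hdN
      linarith) d
    have hwr : 0 < w * N^d := by positivity
    have h6 := mul_le_mul_of_nonneg_left h4 hwr.le
    have e3 : w * N^d * (1 - ε2) = w * N^d * (1 + d * -(d/N)) := by rw [hε2]; field_simp; ring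
    rw [e3]; linarith
  -- main chain
  have hchain : N^2 * L * (ρ/N)^((d:ℝ)*η) ≤ w * N^d * (1+ε3) * M := by
    have h1 : (N^2)^(-a) * (a * L) ≤ (nsq z)^(-a) - (N^2)^(-a) := by
      rw [hzt, Real.mul_rpow (by positivity) ht0.le]
      have : 1 + a * L ≤ t^(-a) := by
        rw [Real.rpow_def_of_pos ht0, hLdef, one_div, Real.log_inv]
        have := Real.add_one_le_exp (Real.log t * -a)
        linarith
      have h0 : 0 < (N^2)^(-a) := Real.rpow_pos_of_pos (by positivity) _
      clear * - this h0
      nlinarith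
    have hp0 : 0 < (ρ^2)^(-a-1) := Real.rpow_pos_of_pos (by positivity) _
    have h2 : a * (ρ^2)^(-a-1) * M * ((1+9*d) * (ball d (ρ+1)).card - 9*d*(ball d ρ).card) ≤ a * (ρ^2)^(-a-1) * M * (w * ρ^d * (1 + ε3)) :=
      mul_le_mul_of_nonneg_left hW (by positivity)
    have h3 : (N^2)^(-a) * L ≤ (ρ^2)^(-a-1) * M * (w * ρ^d * (1 + ε3)) := by
      have : a * ((N^2)^(-a) * L) ≤ a * ((ρ^2)^(-a-1) * M * (w * ρ^d * (1 + ε3))) := by linarith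
      exact le_of_mul_le_mul_left this ha0
    have e1 : (ρ^2)^(-a-1) = (ρ^d)⁻¹ * (ρ^((d:ℝ)*η))⁻¹ := by
      rw [← Real.rpow_natCast_mul hρ0.le, show ((2:ℕ):ℝ) * (-a-1) = -(d:ℝ) + -(d*η) by push_cast; linarith,
        Real.rpow_add hρ0, Real.rpow_neg hρ0.le, Real.rpow_neg hρ0.le, Real.rpow_natCast]
    have e2 : (N^2)^(-a) = N^2 * ((N^d)⁻¹ * (N^((d:ℝ)*η))⁻¹) := by
      rw [← Real.rpow_natCast_mul hN0.le, show ((2:ℕ):ℝ) * (-a) = ((2:ℕ):ℝ) + (-(d:ℝ) + -(d*η)) by push_cast; linarith,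
        Real.rpow_add hN0, Real.rpow_add hN0, Real.rpow_neg hN0.le, Real.rpow_neg hN0.le, Real.rpow_natCast, Real.rpow_natCast]
    rw [e1, e2] at h3
    rw [Real.div_rpow hρ0.le hN0.le]
    have hr1 : 0 < ρ^((d:ℝ)*η) := Real.rpow_pos_of_pos hρ0 _
    have hr2 : 0 < N^((d:ℝ)*η) := Real.rpow_pos_of_pos hN0 _
    have h4 := mul_le_mul_of_nonneg_left h3 (by positivity : 0 ≤ N^d * ρ^((d:ℝ)*η))
    calc _ = N ^ d * ρ ^ ((d:ℝ) * η) * (N ^ 2 * ((N ^ d)⁻¹ * (N ^ ((d:ℝ) * η))⁻¹) * L) := by field_simp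
      _ ≤ _ := h4
      _ = _ := by field_simp
  have hε20 : 0 ≤ ε2 := by positivity
  have hε30 : 0 ≤ ε3 := by positivity
  have hA : N^2 * L * (1 - q/16) ≤ (ball d N).card * M := by
    have hNL : 0 ≤ N^2 * L := by positivity
    have hpos : (0:ℝ) < 1 + ε3 := by linarith
    have k1 : (1 - q/16) * (1 + ε3) ≤ (1-ε1)*(1-ε2) := by
      clear * - hε10 hε20 hε30 E4 hq0
      nlinarith [mul_nonneg hε10 hε20]
    have k2 : 0 ≤ 1 - ε2 := by linarith
    have k3 : N^2 * L * ((1-ε1)*(1-ε2)) ≤ w * N^d * (1+ε3) * M * (1-ε2) := by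
      rw [← mul_assoc]
      exact mul_le_mul_of_nonneg_right ((mul_le_mul_of_nonneg_left hε1 hNL).trans hchain) k2
    have k4 : w * N^d * (1 - ε2) * ((1+ε3) * M) ≤ (ball d N).card * ((1+ε3)*M) :=
      mul_le_mul_of_nonneg_right hb (by positivity)
    have k5 := mul_le_mul_of_nonneg_left k1 hNL
    have : N^2 * L * (1 - q/16) * (1+ε3) ≤ (ball d N).card * M * (1 + ε3) := by linarith
    exact le_of_mul_le_mul_right this hpos
  have hmean : N^2 * (L * (1 - q/16) - q^2/16) ≤ (ball d N).card * g 0 := by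
    rw [hM] at hA
    clear * - hA E5
    nlinarith
  obtain ⟨c1, c2⟩ := arith_core (q := q) (y := 1 - t) (L := L) (A := 1 - q/16) (c3 := q^2/16) (c4 := 3/N) hq0 hq1
    (by clear * - hty hq0 hq1; nlinarith) hL le_rfl le_rfl E6
  have hmass := green_mass hd0 hN0.le hz hg
  constructor
  · have k1 : (N+1)^2 - nsq z ≤ N^2 * (1 - t + 3/N) := by
      have : N^2 * (1 - t + 3/N) = N^2 - N^2 * t + 3 * N := by field_simp
      rw [this, hzt]
      clear * - hnR
      nlinarith
    have k2 := mul_le_mul_of_nonneg_left c1 (by positivity : 0 ≤ N^2)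
    have k3 := mul_le_mul_of_nonneg_left hmean (by linarith : 0 ≤ 1 - q/8)
    linarith
  · have k2 := mul_le_mul_of_nonneg_left c2 (by positivity : 0 ≤ N^2)
    linarith

end IDLA

open MeasureTheory Filter
open scoped ENNReal

namespace IDLA

lemma ev_pow (C a b : ℝ) (h : a < b) : ∀ᶠ n : ℕ in atTop, C * (n:ℝ)^a ≤ (n:ℝ)^b := by
  have h1 : Tendsto (fun n : ℕ => (n:ℝ)^(b-a)) atTop atTop :=
    (tendsto_rpow_atTop (by linarith)).comp tendsto_natCast_atTop_atTop
  filter_upwards [h1.eventually_ge_atTop C, eventually_ge_atTop 1] with n hn hn1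
  have hn0 : (0:ℝ) < n := by exact_mod_cast hn1
  calc C * (n:ℝ)^a ≤ (n:ℝ)^(b-a) * (n:ℝ)^a := mul_le_mul_of_nonneg_right hn (by positivity)
    _ = (n:ℝ)^b := by rw [← Real.rpow_add hn0]; congr 1; ring

lemma ev_log (C b : ℝ) (h : 0 < b) : ∀ᶠ n : ℕ in atTop, C * Real.log n ≤ (n:ℝ)^b := by
  have h1 := (isLittleO_log_rpow_atTop h).comp_tendsto tendsto_natCast_atTop_atTop
  have h2 := h1.bound (c := 1/(|C|+1)) (by positivity)
  filter_upwards [h2, eventually_ge_atTop 1] with n hn hn1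
  have hn1' : (1:ℝ) ≤ n := by exact_mod_cast hn1
  have hl : 0 ≤ Real.log n := Real.log_nonneg hn1'
  simp only [Function.comp, Real.norm_eq_abs] at hn
  have hC : 0 < |C| + 1 := by positivity
  have hb : 0 ≤ (n:ℝ)^b := by positivity
  rw [abs_of_nonneg hl, abs_of_nonneg hb, div_mul_eq_mul_div, one_mul, le_div_iff₀ hC] at hn
  nlinarith [le_abs_self C, abs_nonneg C]

lemma h_fixed {d : ℕ} (hd : 2 ≤ d) (e : ℝ) (he0 : 0 < e) (n : ℕ) (hn : 32 ≤ n) (w : ℝ) (hw : 0 < w)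
    (hw1 : ∀ r : ℝ, 0 ≤ r → ((ball d r).card : ℝ) ≤ w * (r + d)^d)
    (hw2 : ∀ r : ℝ, d ≤ r → w * (r - d)^d ≤ (ball d r).card)
    (C1 : ℝ) (hC1 : 0 < C1)
    (F2 : (d:ℝ) + 1 ≤ (n:ℝ)^(1-4*e)) (F3 : 4 * (d:ℝ) ≤ (n:ℝ)^(2-10*e))
    (F4 : 64 * (d:ℝ) * (n:ℝ)^(1-4*e) ≤ n) 
    (F6 : 4*e*d*(n:ℝ)^(-(2*e)) * Real.log n + d^2/n + ((1+9*d)*(2^d*(1+d)) + 9*d*d^2)/(n:ℝ)^(1-4*e) ≤ (n:ℝ)^(-e)/16)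
    (F7 : (w*(1+d)^d*(384*d^2*C1)) * (n:ℝ)^(2-3*e) ≤ (n:ℝ)^(2-2*e)/16)
    (F8 : 3/(n:ℝ) ≤ (n:ℝ)^(-(2*e))/16)
    (z : V d) (hz1 : (n:ℝ)^2/16 ≤ nsq z)
    (hz2 : nsq z ≤ ((n:ℝ) * (1-(n:ℝ)^(-e)))^2) (g : V d → ℝ) (hg : IsGreen (ball d n) z g)
    (hg1 : ∀ x, g x ≤ C1 * (n:ℝ)^e)
    (hg2 : ∀ x, (n:ℝ)^2/64 ≤ nsq (x-z) → g x ≤ C1 * (n:ℝ)^(2-(d:ℝ)+e)) :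
    ∃ h : V d → ℝ, (∀ x, 0 ≤ h x) ∧ (∀ x, h x ≤ C1 * (w*(1+d)^d) * (n:ℝ)^((d:ℝ)-2+2*e)) ∧
      (∀ x, x ≠ z → 0 ≤ lap h x) ∧
      (∀ x ∈ ball d ((n:ℝ)^(1-4*e)), 1 - (w*(1+d)^d*(384*d^2*C1)) * (n:ℝ)^(-(2*e)) ≤ h x) ∧
      (∀ x, x ∉ ball d n → h x = 0) ∧ ∑ x ∈ ball d n, h x ≤ (1 - (n:ℝ)^(-e)/8) * (ball d n).card := by
  have hd0 : 0 < d := by omega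
  have hdR : (2:ℝ) ≤ d := by exact_mod_cast hd
  have hnR : (32:ℝ) ≤ n := by exact_mod_cast hn
  generalize hN : (n:ℝ) = N at *
  have hN0 : 0 < N := by linarith
  have hN1 : 1 ≤ N := by linarith
  set ρ := N^(1-4*e) with hρ
  have hρ0 : 0 < ρ := by linarith
  set q := N^(-e) with hq
  have hq0 : 0 < q := by positivity
  have hq1 : q ≤ 1 := Real.rpow_le_one_of_one_le_of_nonpos hN1 (by linarith)
  set η := N^(-(2*e)) with hη
  have hη0 : 0 < η := by positivity
  have hη1 : η ≤ 1 := Real.rpow_le_one_of_one_le_of_nonpos hN1 (by linarith)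
  have hqη : q^2 = η := by
    rw [hq, hη, ← Real.rpow_mul_natCast hN0.le]; congr 1; push_cast; ring
  set W := w*(1+d)^d with hW
  have hW0 : 0 < W := by positivity
  have hb : ((ball d N).card:ℝ) ≤ W * N^(d:ℝ) := by
    refine (hw1 N hN0.le).trans ?_
    rw [hW, mul_assoc, Real.rpow_natCast, ← mul_pow]
    gcongr
    nlinarith
  have hs : d * (ρ+1) ≤ N/32 := by nlinarith
  set D := d*(ρ+1)*(192*d*(C1 * N^(2-(d:ℝ)+e))/N) with hDdef
  have hD : ∀ x ∈ ball d (ρ+1), |g x - g 0| ≤ D := by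
    have := green_osc hd n hn z (by rw [hN]; exact hz1) g (by rw [hN]; exact hg) (C1 * N^(2-(d:ℝ)+e)) (by rw [hN]; exact hg2)
      (ρ+1) (by linarith) (by rw [hN]; exact hs)
    rw [hN] at this
    exact this
  have hDle : D ≤ 384*d^2*C1 * N^(2-(d:ℝ)-3*e) := by
    have e1 : N^(2-(d:ℝ)-3*e) = N^(2-(d:ℝ)+e) / N * ρ := by
      rw [hρ, div_mul_eq_mul_div, ← Real.rpow_add hN0, eq_div_iff hN0.ne']
      nth_rewrite 2 [← Real.rpow_one N]
      rw [← Real.rpow_add hN0]; congr 1; ring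
    rw [e1, hDdef]
    have : 0 < N^(2-(d:ℝ)+e) / N := by positivity
    calc d*(ρ+1)*(192*d*(C1 * N^(2-(d:ℝ)+e))/N) = 192*d^2*C1*(N^(2-(d:ℝ)+e) / N) * (ρ+1) := by ring
      _ ≤ 192*d^2*C1*(N^(2-(d:ℝ)+e) / N) * (2*ρ) := by
        apply mul_le_mul_of_nonneg_left _ (by positivity)
        linarith
      _ = _ := by ring
  have hD0 : 0 ≤ D := by positivity
  have hε1 : 1 - 4*e*d*η*Real.log N ≤ (ρ/N)^((d:ℝ)*η) := by
    have e1 : ρ/N = N^(-(4*e)) := by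
      rw [hρ, div_eq_iff hN0.ne']
      nth_rewrite 3 [← Real.rpow_one N]
      rw [← Real.rpow_add hN0]; congr 1; ring
    rw [e1, ← Real.rpow_mul hN0.le, Real.rpow_def_of_pos hN0]
    have := Real.add_one_le_exp (Real.log N * (-(4*e) * (d*η)))
    linarith
  have hlog : 0 ≤ Real.log N := Real.log_nonneg hN1
  obtain ⟨m1, m2⟩ := g_main hd n hn w hw hw1 hw2 ρ η q (4*e*d*η*Real.log N) D F2 hη0 hη1 (by
      have : η * ρ^2 = N^(2-10*e) := by
        rw [hη, hρ, ← Real.rpow_mul_natCast hN0.le, ← Real.rpow_add hN0]; congr 1; push_cast; ring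
      rw [this]; exact F3) (by rw [hN]; exact hs) hq0 hq1 z (by rw [hN]; exact hz1) (by rw [hN]; exact hz2) g (by rw [hN]; exact hg) hD
      (by rw [hN]; exact hε1) (by positivity) (by rw [hN]; exact F6) (by
        rw [hN, hqη]
        calc ((ball d N).card:ℝ) * D ≤ W * N^(d:ℝ) * (384*d^2*C1 * N^(2-(d:ℝ)-3*e)) := by gcongr
          _ = (W*(384*d^2*C1)) * (N^(d:ℝ) * N^(2-(d:ℝ)-3*e)) := by ring
          _ = (W*(384*d^2*C1)) * N^(2-3*e) := by rw [← Real.rpow_add hN0]; congr 2; ring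
          _ ≤ _ := F7
          _ = N^2 * (η/16) := by
            rw [hη, ← Real.rpow_natCast N 2, ← mul_div_assoc, ← Real.rpow_add hN0]; congr 2) (by rw [hN, hqη]; exact F8)
  rw [hN] at m1 m2
  have hcard : 0 < ((ball d N).card:ℝ) * g 0 := lt_of_lt_of_le (by positivity) m2
  have hg00 : 0 < g 0 := pos_of_mul_pos_right hcard (by positivity)
  have hinv : 1/g 0 ≤ W * N^((d:ℝ)-2+e) := by
    rw [div_le_iff₀ hg00]
    have h1 : N^2*q ≤ W * N^(d:ℝ) * g 0 := m2.trans (mul_le_mul_of_nonneg_right hb hg00.le)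
    have e1 : N^((d:ℝ)-2+e) * (N^2*q) = N^(d:ℝ) := by
      rw [hq, ← Real.rpow_natCast N 2, ← Real.rpow_add hN0, ← Real.rpow_add hN0]; congr 1; push_cast; ring
    have h0 : 0 < N^2*q := by positivity
    rw [← e1] at h1
    have : 1 * (N^2*q) ≤ (W * N^((d:ℝ)-2+e) * g 0) * (N^2*q) := by linarith
    exact le_of_mul_le_mul_right this h0
  have hinv0 : 0 < 1/g 0 := by positivity
  refine ⟨fun x => 1/g 0 * g x, fun x => mul_nonneg hinv0.le (green_nonneg hd0 hg x), fun x => ?_, fun x hx => ?_, fun x hx => ?_, fun x hx => ?_, ?_⟩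
  · calc 1/g 0 * g x ≤ (W * N^((d:ℝ)-2+e)) * (C1 * N^e) := by
          apply mul_le_mul hinv (hg1 x) (green_nonneg hd0 hg x) (by positivity)
      _ = C1 * W * (N^((d:ℝ)-2+e) * N^e) := by ring
      _ = _ := by rw [← Real.rpow_add hN0]; congr 2; ring
  · rw [lap_const_mul]
    exact mul_nonneg hinv0.le (green_lap_nonneg hd0 hg x hx)
  · have hx' : x ∈ ball d (ρ+1) := by
      rw [mem_ball (by linarith)] at hx ⊢
      refine hx.trans (pow_le_pow_left₀ hρ0.le (by linarith) 2)
    have h1 := (abs_le.mp (hD x hx')).1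
    have h2 : 1 - 1/g 0 * D ≤ 1/g 0 * g x := by
      have : 1 = 1/g 0 * g 0 := by field_simp
      nth_rewrite 1 [this]
      rw [← mul_sub]
      exact mul_le_mul_of_nonneg_left (by linarith) hinv0.le
    refine le_trans ?_ h2
    have : 1/g 0 * D ≤ (W*(384*d^2*C1)) * η := by
      calc 1/g 0 * D ≤ (W * N^((d:ℝ)-2+e)) * (384*d^2*C1 * N^(2-(d:ℝ)-3*e)) := by gcongr
        _ = (W*(384*d^2*C1)) * (N^((d:ℝ)-2+e) * N^(2-(d:ℝ)-3*e)) := by ring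
        _ = _ := by rw [hη, ← Real.rpow_add hN0]; congr 2; ring
    linarith
  · simp only; rw [hg.1 x hx, mul_zero]
  · rw [← Finset.mul_sum]
    calc 1/g 0 * ∑ x ∈ ball d N, g x ≤ 1/g 0 * ((1 - q/8) * ((ball d N).card * g 0)) := by gcongr
      _ = _ := by field_simp

lemma h_props {d : ℕ} (hd : 2 ≤ d) (e : ℝ) (he0 : 0 < e) (he : e ≤ 1/16) : ∃ C > 0, ∀ᶠ n : ℕ in atTop,
    ∀ z : V d, (n:ℝ)^2/16 ≤ nsq z → nsq z ≤ ((n:ℝ) * (1-(n:ℝ)^(-e)))^2 →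
    ∃ h : V d → ℝ, (∀ x, 0 ≤ h x) ∧ (∀ x, h x ≤ C * (n:ℝ)^((d:ℝ)-2+2*e)) ∧
      (∀ x, x ≠ z → 0 ≤ lap h x) ∧
      (∀ x ∈ ball d ((n:ℝ)^(1-4*e)), 1 - C * (n:ℝ)^(-(2*e)) ≤ h x) ∧
      (∀ x, x ∉ ball d n → h x = 0) ∧ ∑ x ∈ ball d n, h x ≤ (1 - (n:ℝ)^(-e)/8) * (ball d n).card := by
  obtain ⟨w, hw, hw1, hw2⟩ := count d
  obtain ⟨C1, hC1, hgu⟩ := green_upper hd e he0 (by linarith)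
  have hdR : (2:ℝ) ≤ d := by exact_mod_cast hd
  set c3 : ℝ := ((1+9*d)*(2^d*(1+d)) + 9*d*d^2) with hc3
  refine ⟨max (C1 * (w*(1+d)^d)) (w*(1+d)^d*(384*d^2*C1)), lt_max_of_lt_left (by positivity), ?_⟩
  filter_upwards [eventually_ge_atTop 32, ev_pow ((d:ℝ)+1) 0 (1-4*e) (by linarith), ev_pow (4*(d:ℝ)) 0 (2-10*e) (by linarith),
    ev_pow (64*(d:ℝ)) (1-4*e) 1 (by linarith), ev_log (48*(4*e*d)) e he0, ev_pow (48*(d:ℝ)^2) (-1) (-e) (by linarith),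
    ev_pow (48*c3) (-(1-4*e)) (-e) (by linarith), ev_pow (16*(w*(1+d)^d*(384*d^2*C1))) (2-3*e) (2-2*e) (by linarith),
    ev_pow 48 (-1) (-(2*e)) (by linarith)] with n hn a1 a2 a3 a4 a5 a6 a7 a8
  intro z hz1 hz2
  have hnR : (32:ℝ) ≤ n := by exact_mod_cast hn
  have hn0 : (0:ℝ) < n := by linarith
  rw [Real.rpow_zero, mul_one] at a1 a2
  rw [Real.rpow_one] at a3
  rw [Real.rpow_neg_one] at a5 a8
  rw [Real.rpow_neg hn0.le (1-4*e)] at a6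
  have hq1 : (n:ℝ)^(-e) ≤ 1 := Real.rpow_le_one_of_one_le_of_nonpos (by linarith) (by linarith)
  have hq0 : 0 < (n:ℝ)^(-e) := by positivity
  have hz : z ∈ ball d n := by
    rw [mem_ball hn0.le]; refine hz2.trans ?_
    apply pow_le_pow_left₀ (mul_nonneg hn0.le (by linarith))
    nlinarith
  obtain ⟨g, hg⟩ := green_exists (by omega) (ball d n) z hz
  obtain ⟨g1, g2⟩ := hgu n (by omega) z hz g hg
  obtain ⟨h, p1, p2, p3, p4, p5, p6⟩ := h_fixed hd e he0 n hn w hw hw1 hw2 C1 hC1 a1 a2 a3 (by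
      have k1 : 4*e*d*(n:ℝ)^(-(2*e)) * Real.log n ≤ (n:ℝ)^(-e)/48 := by
        have k : (n:ℝ)^(-(2*e)) * (n:ℝ)^e = (n:ℝ)^(-e) := by rw [← Real.rpow_add hn0]; congr 1; ring
        have := mul_le_mul_of_nonneg_left a4 (by positivity : 0 ≤ (n:ℝ)^(-(2*e)))
        rw [k] at this
        linarith
      have k2 : (d:ℝ)^2/n ≤ (n:ℝ)^(-e)/48 := by
        rw [div_eq_mul_inv]; linarith
      have k3 : c3/(n:ℝ)^(1-4*e) ≤ (n:ℝ)^(-e)/48 := by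
        rw [div_eq_mul_inv]; linarith
      linarith) (by linarith) (by rw [div_eq_mul_inv]; linarith) z hz1 hz2 g hg g1 g2
  refine ⟨h, p1, fun x => (p2 x).trans ?_, p3, fun x hx => le_trans ?_ (p4 x hx), p5, p6⟩
  · gcongr; exact le_max_left _ _
  · have : 0 < (n:ℝ)^(-(2*e)) := by positivity
    have := mul_le_mul_of_nonneg_right (le_max_right (C1 * (w*(1+d)^d)) (w*(1+d)^d*(384*d^2*C1))) this.le
    linarith

end IDLA

open MeasureTheory Filter
open scoped ENNReal

namespace IDLA

lemma sum_phi (b : ℝ) (hb : 1 < b) : Summable (fun k : ℤ => (1 + (k:ℝ)^2)^(-(b/2))) := by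
  have h1 := Real.summable_abs_int_rpow hb
  have h2 : Summable (fun k : ℤ => if k = 0 then (1:ℝ) else 0) :=
    summable_of_hasFiniteSupport ((Set.finite_singleton (0:ℤ)).subset (by
      intro k hk
      by_contra hne
      exact hk (if_neg hne)))
  refine Summable.of_nonneg_of_le (fun k => by positivity) (fun k => ?_) (h2.add h1)
  by_cases hk : k = 0
  · subst hk
    simp
    positivity
  · rw [if_neg hk, zero_add]
    have hk0 : 0 < |(k:ℝ)| := by simpa using hk
    calc (1 + (k:ℝ)^2)^(-(b/2)) ≤ (|(k:ℝ)|^2)^(-(b/2)) := by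
          apply Real.rpow_le_rpow_of_nonpos (by positivity)
          · rw [sq_abs]; linarith
          · linarith
      _ = |(k:ℝ)|^(-b) := by
          rw [← Real.rpow_natCast_mul hk0.le]; congr 1; push_cast; ring

lemma prod_sum_le {d : ℕ} (φ : ℤ → ℝ) (h0 : ∀ k, 0 ≤ φ k) (hs : Summable φ) (B : Finset (V d)) :
    ∑ y ∈ B, ∏ i, φ (y i) ≤ (∑' k, φ k)^d := by
  classical
  have hsub : B ⊆ Fintype.piFinset (fun i : Fin d => B.image (fun y => y i)) := by
    intro y hy
    rw [Fintype.mem_piFinset]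
    intro i
    exact Finset.mem_image_of_mem _ hy
  calc ∑ y ∈ B, ∏ i, φ (y i) ≤ ∑ y ∈ Fintype.piFinset (fun i : Fin d => B.image (fun y => y i)), ∏ i, φ (y i) :=
        Finset.sum_le_sum_of_subset_of_nonneg hsub (fun y _ _ => Finset.prod_nonneg fun i _ => h0 _)
    _ = ∏ i, ∑ k ∈ B.image (fun y => y i), φ k := by rw [Finset.prod_univ_sum]
    _ ≤ ∏ i : Fin d, ∑' k, φ k := by
        apply Finset.prod_le_prod (fun i _ => Finset.sum_nonneg fun k _ => h0 k)
        intro i _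
        exact hs.sum_le_tsum _ (fun k _ => h0 k)
    _ = _ := by simp

lemma interp {f ε p : ℝ} (hf : 0 < f) (hε : 0 < ε) (hp : 1 ≤ p) : f ≤ ε + ε^(1-p) * f^p := by
  rcases le_or_gt f ε with h | h
  · have : 0 ≤ ε^(1-p) * f^p := by positivity
    linarith
  · have h1 : f^(1-p) ≤ ε^(1-p) := Real.rpow_le_rpow_of_nonpos hε h.le (by linarith)
    have h2 : f^(1-p) * f^p = f := by rw [← Real.rpow_add hf]; simp
    have := mul_le_mul_of_nonneg_right h1 (by positivity : 0 ≤ f^p)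
    linarith

lemma kernel_sum {d : ℕ} (hd : 0 < d) (s p R : ℝ) (hR : 1 ≤ R) (hs : 0 < s) (hp : 1 ≤ p) (hsp : d < 2*s*p) :
    ∃ C > 0, ∀ B : Finset (V d), ∀ x, ∑ y ∈ B, (nsq (x-y) + R)^(-s) ≤ C * (B.card:ℝ)^(1-1/p) := by
  classical
  have hdR : (0:ℝ) < d := by exact_mod_cast hd
  set b : ℝ := 2*s*p/d with hb
  have hb1 : 1 < b := by rw [hb, lt_div_iff₀ hdR]; linarith
  have hsum := sum_phi b hb1
  set φ : ℤ → ℝ := fun k => (1 + (k:ℝ)^2)^(-(b/2)) with hφ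
  have hφ0 : ∀ k, 0 ≤ φ k := fun k => by simp only [hφ]; positivity
  set Z := (∑' k, φ k)^d with hZ
  have hZ0 : 0 ≤ Z := pow_nonneg (tsum_nonneg hφ0) d
  refine ⟨1 + Z, by positivity, fun B x => ?_⟩
  rcases B.eq_empty_or_nonempty with rfl | hB
  · simp only [Finset.sum_empty]; positivity
  have hc : (0:ℝ) < B.card := by exact_mod_cast Finset.card_pos.mpr hB
  have hp0 : 0 < p := by linarith
  set ε := (B.card:ℝ)^(-(1/p)) with hε
  have hε0 : 0 < ε := by positivity
  have hterm : ∀ v : V d, ((nsq v + R)^(-s))^p ≤ ∏ i, φ (v i) := by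
    intro v
    have hv := nsq_nonneg v
    have e : ((nsq v + R)^(-s))^p = ∏ i : Fin d, (nsq v + R)^(-(b/2)) := by
      rw [Finset.prod_const, Finset.card_univ, Fintype.card_fin, ← Real.rpow_mul (by linarith), ← Real.rpow_mul_natCast (by linarith)]
      congr 1
      rw [hb]; field_simp
    rw [e]
    apply Finset.prod_le_prod (fun i _ => by positivity)
    intro i _
    apply Real.rpow_le_rpow_of_nonpos (by positivity)
    · have := coord_sq_le v i; linarith
    · linarith
  have hpow : ∑ y ∈ B, ((nsq (x-y) + R)^(-s))^p ≤ Z := by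
    have h1 : ∑ y ∈ B, ((nsq (x-y) + R)^(-s))^p ≤ ∑ y ∈ B, ∏ i, φ ((x-y) i) := Finset.sum_le_sum fun y _ => hterm _
    refine h1.trans ?_
    have h2 : ∑ y ∈ B, ∏ i, φ ((x-y) i) = ∑ v ∈ B.image (fun y => x - y), ∏ i, φ (v i) := by
      rw [Finset.sum_image]
      intro a _ c _ hac
      simpa using hac
    rw [h2]
    exact prod_sum_le φ hφ0 hsum _
  calc ∑ y ∈ B, (nsq (x-y) + R)^(-s) ≤ ∑ y ∈ B, (ε + ε^(1-p) * ((nsq (x-y) + R)^(-s))^p) :=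
        Finset.sum_le_sum fun y _ => interp (by have := nsq_nonneg (x-y); positivity) hε0 hp
    _ = B.card * ε + ε^(1-p) * ∑ y ∈ B, ((nsq (x-y) + R)^(-s))^p := by
        rw [Finset.sum_add_distrib, Finset.sum_const, nsmul_eq_mul, Finset.mul_sum]
    _ ≤ B.card * ε + ε^(1-p) * Z := by gcongr
    _ = (1+Z) * (B.card:ℝ)^(1-1/p) := by
        have e1 : (B.card:ℝ) * ε = (B.card:ℝ)^(1-1/p) := by
          rw [hε, sub_eq_add_neg, Real.rpow_add hc, Real.rpow_one]
        have e2 : ε^(1-p) = (B.card:ℝ)^(1-1/p) := by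
          rw [hε, ← Real.rpow_mul hc.le]; congr 1; field_simp; ring
        rw [e1, e2]; ring

lemma torsion {d : ℕ} (hd : 3 ≤ d) (e : ℝ) (he0 : 0 < e) (he : 2*e < 1) :
    ∃ C > 0, ∀ B : Finset (V d), ∃ T : V d → ℝ, (∀ x, x ∉ B → T x = 0) ∧ (∀ x ∈ B, lap T x = -1) ∧
      (∀ x ∈ B, T x ≤ C * (B.card:ℝ)^((2+2*e)/d)) := by
  have hd0 : 0 < d := by omega
  have hdR : (3:ℝ) ≤ d := by exact_mod_cast hd
  obtain ⟨R, hR, hK, hK0⟩ := kernel (d := d) (by omega) 1 ((d-2-e)/2) (by linarith) (by linarith) (by linarith)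
  obtain ⟨C, hC, hsum⟩ := kernel_sum hd0 ((d-2-e)/2) (d/(d-2-2*e)) R hR (by linarith) (by
    rw [le_div_iff₀ (by linarith)]; linarith) (by
    have : (d:ℝ)-2-2*e > 0 := by linarith
    rw [← mul_div_assoc, lt_div_iff₀ this]; nlinarith)
  set L : V d → ℝ := fun x => 1 * (nsq x + R)^(-(((d:ℝ)-2-e)/2)) with hL
  set κ := 1/(-lap L 0) with hκ
  have hκ0 : 0 < κ := by rw [hκ]; apply div_pos one_pos; linarith
  refine ⟨κ * C, by positivity, fun B => ?_⟩
  obtain ⟨T, hT0, hT1⟩ := dirichlet hd0 B (fun _ => 0) (fun _ => -1)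
  refine ⟨T, hT0, hT1, ?_⟩
  have hα : 1 - 1/((d:ℝ)/(d-2-2*e)) = (2+2*e)/d := by
    field_simp; ring
  rw [hα] at hsum
  have hLpos : ∀ x, 0 ≤ L x := fun x => by
    have := nsq_nonneg x
    simp only [hL]; positivity
  set u : V d → ℝ := fun x => κ * ∑ y ∈ B, L (x - y) with hu
  have hlap : ∀ x, lap u x = κ * ∑ y ∈ B, lap L (x-y) := by
    intro x
    rw [hu, lap_const_mul (κ) (fun x => ∑ y ∈ B, L (x - y)), lap_sum B (fun y x => L (x - y))]
    simp only [lap_translate]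
  have hle : ∀ x ∈ B, T x ≤ u x := by
    apply max_principle' hd0 B u T
    · intro x hx
      rw [hT1 x hx, hlap]
      have h1 : ∑ y ∈ B, lap L (x-y) ≤ lap L 0 := by
        classical
        rw [← Finset.add_sum_erase _ _ hx, sub_self]
        have : ∑ y ∈ B.erase x, lap L (x-y) ≤ 0 := Finset.sum_nonpos fun y _ => hK _
        linarith
      have h2 := mul_le_mul_of_nonneg_left h1 hκ0.le
      have h3 : κ * lap L 0 = -1 := by
        rw [hκ]
        have : lap L 0 ≠ 0 := hK0.ne
        field_simp
      linarith
    · intro x hx _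
      rw [hT0 x hx]
      exact mul_nonneg hκ0.le (Finset.sum_nonneg fun y _ => hLpos _)
  intro x hx
  refine (hle x hx).trans ?_
  rw [mul_assoc]
  apply mul_le_mul_of_nonneg_left _ hκ0.le
  have := hsum B x
  simpa only [hL, one_mul] using this

noncomputable def ch {d : ℕ} (θ : ℝ) (x : V d) : ℝ := ∑ i, Real.cosh (θ * x i)

lemma ch_nonneg {d : ℕ} (θ : ℝ) (x : V d) : 0 ≤ ch θ x := Finset.sum_nonneg fun _ _ => (Real.cosh_pos _).le

lemma lap_coord {d : ℕ} (hd : 0 < d) (i : Fin d) (f : ℤ → ℝ) (x : V d) :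
    lap (fun x : V d => f (x i)) x = (f (x i + 1) + f (x i - 1) - 2 * f (x i)) / (2*d) := by
  have hdR : (0:ℝ) < d := by exact_mod_cast hd
  unfold lap
  have h1 : ∑ j : Fin d, (f ((x + E j) i) + f ((x - E j) i)) = (f (x i + 1) + f (x i - 1) - 2 * f (x i)) + d * (2 * f (x i)) := by
    have : ∀ j : Fin d, f ((x + E j) i) + f ((x - E j) i) = (if j = i then (f (x i + 1) + f (x i - 1) - 2 * f (x i)) else 0) + 2 * f (x i) := by
      intro j
      by_cases hj : j = i
      · subst hj
        simp [E_same]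
      · have : (E j : V d) i = 0 := E_ne (Ne.symm hj)
        simp [this, hj]; ring
    rw [Finset.sum_congr rfl fun j _ => this j, Finset.sum_add_distrib]
    simp
  rw [h1]
  field_simp
  ring

lemma lap_ch {d : ℕ} (hd : 0 < d) (θ : ℝ) (x : V d) : lap (ch θ) x = (Real.cosh θ - 1)/d * ch θ x := by
  have hdR : (0:ℝ) < d := by exact_mod_cast hd
  have : (ch θ : V d → ℝ) = fun x => ∑ i, Real.cosh (θ * x i) := rfl
  rw [this, lap_sum Finset.univ (fun i (x : V d) => Real.cosh (θ * x i))]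
  beta_reduce
  rw [Finset.mul_sum]
  refine Finset.sum_congr rfl fun i _ => ?_
  rw [lap_coord hd i (fun k => Real.cosh (θ * k))]
  push_cast
  rw [mul_add, mul_sub, Real.cosh_add, Real.cosh_sub, mul_one]
  field_simp
  ring

lemma ch_step {d : ℕ} (hd : 0 < d) (θ : ℝ) (B : Finset (V d)) (hB : B.Nonempty) (T : V d → ℝ) (hT0 : ∀ x, x ∉ B → T x = 0)
    (hT1 : ∀ x ∈ B, lap T x = -1) (M : ℝ) (hTM : ∀ x ∈ B, T x ≤ M) (hM : (Real.cosh θ - 1)/d * M ≤ 1) :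
    ∑ y ∈ cl B \ B, q B y * ch θ y ≤ 2 * (∑ x ∈ B, ch θ x) / B.card := by
  have hdR : (0:ℝ) < d := by exact_mod_cast hd
  have hc : (0:ℝ) < B.card := by exact_mod_cast Finset.card_pos.mpr hB
  obtain ⟨w, hw0, hw1⟩ := dirichlet hd B (ch θ) (fun _ => 0)
  rw [q_sum hd B (ch θ) w hw0 hw1]
  apply div_le_div_of_nonneg_right _ hc.le
  have hμ : 0 ≤ (Real.cosh θ - 1)/d := div_nonneg (by linarith [Real.one_le_cosh θ]) hdR.le
  have hg := green' B T (fun x => w x - ch θ x) hT0 (fun x hx => by rw [hw0 x hx, sub_self])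
  have h1 : ∑ x ∈ B, (w x - ch θ x) * lap T x = -∑ x ∈ B, (w x - ch θ x) := by
    rw [← Finset.sum_neg_distrib]
    exact Finset.sum_congr rfl fun x hx => by rw [hT1 x hx]; ring
  have h2 : ∑ x ∈ B, T x * lap (fun x => w x - ch θ x) x = -∑ x ∈ B, T x * ((Real.cosh θ - 1)/d * ch θ x) := by
    rw [← Finset.sum_neg_distrib]
    exact Finset.sum_congr rfl fun x hx => by rw [lap_sub, hw1 x hx, lap_ch hd]; ring
  have h3 : ∑ x ∈ B, T x * ((Real.cosh θ - 1)/d * ch θ x) ≤ ∑ x ∈ B, ch θ x := by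
    refine Finset.sum_le_sum fun x hx => ?_
    have k := mul_le_mul_of_nonneg_left (hTM x hx) hμ
    have := mul_le_mul_of_nonneg_right (k.trans hM) (ch_nonneg θ x)
    linarith
  rw [Finset.sum_sub_distrib] at h1
  linarith

lemma ch_mean {d : ℕ} (hd : 0 < d) (θ C α : ℝ) (hC : 0 < C) (hα : 0 ≤ α) (hT : ∀ B : Finset (V d), ∃ T : V d → ℝ, (∀ x, x ∉ B → T x = 0) ∧ (∀ x ∈ B, lap T x = -1) ∧
      (∀ x ∈ B, T x ≤ C * (B.card:ℝ)^α)) (j : ℕ) (hj : (Real.cosh θ - 1)/d * (C * ((j:ℝ)+1)^α) ≤ 1) :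
    ∀ k ≤ j, ∫⁻ ω, ENNReal.ofReal (∑ x ∈ A d ω k, ch θ x) ∂μ0 ≤ ENNReal.ofReal (d * ((k+1)*(k+2)/2)) := by
  have hdR : (0:ℝ) < d := by exact_mod_cast hd
  have hμ : 0 ≤ (Real.cosh θ - 1)/d := div_nonneg (by linarith [Real.one_le_cosh θ]) hdR.le
  intro k
  induction k with
  | zero =>
    intro _
    have : ∀ ω, ∑ x ∈ A d ω 0, ch θ x = d := by
      intro ω
      change ∑ x ∈ ({0} : Finset (V d)), ch θ x = d
      simp [ch]
    simp [this]
  | succ k ih =>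
    intro hk
    have ih := ih (by omega)
    rw [step_agg hd (by simp) k (fun B => ENNReal.ofReal (∑ x ∈ B, ch θ x))]
    have hk0 : (0:ℝ) < (k:ℝ)+1 := by positivity
    calc _ ≤ ∫⁻ ω, ENNReal.ofReal (1 + 2/((k:ℝ)+1)) * ENNReal.ofReal (∑ x ∈ A d ω k, ch θ x) ∂μ0 := by
          apply lintegral_mono_ae
          filter_upwards [ae_struct hd] with ω hω
          obtain ⟨hcard, hzero, -⟩ := hω k
          change ∑ y ∈ cl (A d ω k) \ (A d ω k), ENNReal.ofReal (q (A d ω k) y) * ENNReal.ofReal (∑ x ∈ insert y (A d ω k), ch θ x) ≤ _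
          change (A d ω k).card = k+1 at hcard
          set B := A d ω k with hB
          have hBn : B.Nonempty := ⟨0, hzero⟩
          obtain ⟨T, t0, t1, t2⟩ := hT B
          have hkj : (k:ℝ) + 1 ≤ j + 1 := by
            have : (k:ℝ) ≤ j := by exact_mod_cast (by omega : k ≤ j)
            linarith
          have hs := ch_step hd θ B hBn T t0 t1 _ t2 (by
            rw [hcard]
            refine le_trans ?_ hj
            push_cast
            gcongr)
          have hΦ : 0 ≤ ∑ x ∈ B, ch θ x := Finset.sum_nonneg fun x _ => ch_nonneg θ x
          calc _ = ∑ y ∈ cl B \ B, ENNReal.ofReal (q B y * (ch θ y + ∑ x ∈ B, ch θ x)) := by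
                refine Finset.sum_congr rfl fun y hy => ?_
                rw [Finset.sum_insert (Finset.mem_sdiff.mp hy).2, ENNReal.ofReal_mul (q_nonneg B y)]
            _ = ENNReal.ofReal (∑ y ∈ cl B \ B, q B y * (ch θ y + ∑ x ∈ B, ch θ x)) := by
                rw [ENNReal.ofReal_sum_of_nonneg]
                exact fun y _ => mul_nonneg (q_nonneg B y) (add_nonneg (ch_nonneg θ y) hΦ)
            _ ≤ ENNReal.ofReal ((1 + 2/((k:ℝ)+1)) * ∑ x ∈ B, ch θ x) := by
                apply ENNReal.ofReal_le_ofReal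
                simp only [mul_add, Finset.sum_add_distrib]
                rw [← Finset.sum_mul, q_total hd hBn]
                rw [hcard] at hs
                push_cast at hs
                have : (1 + 2/((k:ℝ)+1)) * ∑ x ∈ B, ch θ x = 2 * (∑ x ∈ B, ch θ x) / ((k:ℝ)+1) + 1 * ∑ x ∈ B, ch θ x := by
                  field_simp
                  ring
                linarith
            _ = _ := ENNReal.ofReal_mul (by positivity)
      _ = ENNReal.ofReal (1 + 2/((k:ℝ)+1)) * ∫⁻ ω, ENNReal.ofReal (∑ x ∈ A d ω k, ch θ x) ∂μ0 := by
          rw [lintegral_const_mul]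
          exact (Measurable.of_discrete (f := fun B : Finset (V d) => ENNReal.ofReal (∑ x ∈ B, ch θ x))).comp (measurable_agg' {0} k)
      _ ≤ ENNReal.ofReal (1 + 2/((k:ℝ)+1)) * ENNReal.ofReal (d * ((k+1)*(k+2)/2)) := by gcongr
      _ = _ := by
          rw [← ENNReal.ofReal_mul (by positivity)]
          congr 1
          push_cast
          field_simp
          ring

lemma outer {d : ℕ} (hd : 0 < d) (θ C α ρ : ℝ) (hθ : 0 ≤ θ) (hρ : 0 ≤ ρ) (hC : 0 < C) (hα : 0 ≤ α) (hT : ∀ B : Finset (V d), ∃ T : V d → ℝ, (∀ x, x ∉ B → T x = 0) ∧ (∀ x ∈ B, lap T x = -1) ∧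
      (∀ x ∈ B, T x ≤ C * (B.card:ℝ)^α)) (j : ℕ) (hj : (Real.cosh θ - 1)/d * (C * ((j:ℝ)+1)^α) ≤ 1) :
    μ0 {ω | ¬ A d ω j ⊆ ball d ρ} ≤ ENNReal.ofReal (d * ((j+1)*(j+2)) * Real.exp (-(θ*(ρ/d)))) := by
  have hdR : (1:ℝ) ≤ d := by exact_mod_cast hd
  have hm := ch_mean hd θ C α hC hα hT j hj j le_rfl
  have hms : MeasurableSet {ω | ¬ A d ω j ⊆ ball d ρ} := measurable_agg' {0} j (t := {B | ¬ B ⊆ ball d ρ}) trivial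
  have h1 : ENNReal.ofReal (Real.exp (θ*(ρ/d)) / 2) * μ0 {ω | ¬ A d ω j ⊆ ball d ρ} ≤ ∫⁻ ω, ENNReal.ofReal (∑ x ∈ A d ω j, ch θ x) ∂μ0 := by
    rw [← setLIntegral_const, ← lintegral_indicator hms]
    apply lintegral_mono
    intro ω
    simp only [Set.indicator_apply, Set.mem_ofPred_eq]
    split_ifs with hc
    · exact zero_le
    · apply ENNReal.ofReal_le_ofReal
      rw [Finset.not_subset] at hc
      obtain ⟨x, hx, hxb⟩ := hc
      refine le_trans ?_ (Finset.single_le_sum (fun x _ => ch_nonneg θ x) hx)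
      rw [mem_ball hρ] at hxb
      have : ∃ i, ρ/d < |(x i:ℝ)| := by
        by_contra hcon
        push Not at hcon
        apply hxb
        calc nsq x ≤ ∑ i : Fin d, (ρ/d)^2 := Finset.sum_le_sum fun i _ => by
              rw [← sq_abs]; exact pow_le_pow_left₀ (abs_nonneg _) (hcon i) 2
          _ = ρ^2/d := by simp; field_simp
          _ ≤ ρ^2 := div_le_self (by positivity) hdR
      obtain ⟨i, hi⟩ := this
      refine le_trans ?_ (Finset.single_le_sum (fun i _ => (Real.cosh_pos (θ * x i)).le) (Finset.mem_univ i))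
      rw [← Real.cosh_abs, abs_mul, abs_of_nonneg hθ, Real.cosh_eq]
      have k1 : Real.exp (θ*(ρ/d)) ≤ Real.exp (θ * |(x i:ℝ)|) := Real.exp_le_exp.mpr (mul_le_mul_of_nonneg_left hi.le hθ)
      have k2 := Real.exp_pos (-(θ * |(x i:ℝ)|))
      linarith
  have h2 := mul_le_mul_right (h1.trans hm) (ENNReal.ofReal (2 * Real.exp (-(θ*(ρ/d)))))
  rw [← mul_assoc, ← ENNReal.ofReal_mul (by positivity), ← ENNReal.ofReal_mul (by positivity)] at h2
  have e1 : 2 * Real.exp (-(θ*(ρ/d))) * (Real.exp (θ*(ρ/d)) / 2) = 1 := by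
    rw [Real.exp_neg]; field_simp
  rw [e1, ENNReal.ofReal_one, one_mul] at h2
  refine h2.trans (le_of_eq ?_)
  congr 1
  ring

end IDLA

open MeasureTheory Filter
open scoped ENNReal

namespace IDLA

lemma cosh_small {θ : ℝ} (h0 : 0 ≤ θ) (h1 : θ ≤ 1) : Real.cosh θ - 1 ≤ θ^2 := by
  have h := Real.cosh_le_exp_half_sq θ
  have h2 : Real.exp (θ^2/2) ≤ 1/(1 - θ^2/2) := by
    have hpos : 0 < 1 - θ^2/2 := by nlinarith
    rw [le_div_iff₀ hpos]
    have := Real.add_one_le_exp (-(θ^2/2))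
    rw [Real.exp_neg] at this
    have he := Real.exp_pos (θ^2/2)
    have := mul_le_mul_of_nonneg_left this he.le
    rw [mul_inv_cancel₀ he.ne'] at this
    linarith
  have h3 : 1/(1 - θ^2/2) ≤ 1 + θ^2 := by
    have hpos : 0 < 1 - θ^2/2 := by nlinarith
    rw [div_le_iff₀ hpos]; nlinarith [mul_nonneg (sq_nonneg θ) (by nlinarith : 0 ≤ 1 - θ^2)]
  linarith

/-- early time index -/
noncomputable def jt (d : ℕ) (e : ℝ) (n : ℕ) : ℕ := ⌊(n:ℝ)^((d:ℝ)-2+6*e)⌋₊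

lemma out_prob {d : ℕ} (hd : 2 ≤ d) (e : ℝ) (he : e * d = 1/8) : ∀ᶠ n : ℕ in atTop,
    μ0 {ω | ¬ A d ω (jt d e n) ⊆ ball d ((n:ℝ)^(1-4*e))} ≤ ENNReal.ofReal (Real.exp (-(n:ℝ)^e)) := by
  have hd0 : 0 < d := by omega
  have hdR : (2:ℝ) ≤ d := by exact_mod_cast hd
  have he0 : 0 < e := by
    by_contra hcon
    push Not at hcon
    nlinarith
  have he16 : e ≤ 1/16 := by nlinarith
  rcases eq_or_lt_of_le hd with hd2 | hd3
  · filter_upwards [eventually_ge_atTop 1] with n hn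
    have hn1 : (1:ℝ) ≤ n := by exact_mod_cast hn
    have : μ0 {ω | ¬ A d ω (jt d e n) ⊆ ball d ((n:ℝ)^(1-4*e))} = 0 := by
      have hae : ∀ᵐ ω ∂μ0, A d ω (jt d e n) ⊆ ball d ((n:ℝ)^(1-4*e)) := by
        filter_upwards [ae_struct hd0] with ω hω x hx
        rw [mem_ball (by positivity)]
        have h1 := (hω (jt d e n)).2.2 x hx
        have h2 : (l1 x : ℝ) ≤ (jt d e n : ℝ) := by exact_mod_cast h1
        have h3 : (jt d e n : ℝ) ≤ (n:ℝ)^((d:ℝ)-2+6*e) := Nat.floor_le (by positivity)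
        have h4 : (n:ℝ)^((d:ℝ)-2+6*e) ≤ (n:ℝ)^(1-4*e) := by
          apply Real.rpow_le_rpow_of_exponent_le hn1
          rw [← hd2]; push_cast; linarith
        have h5 : (0:ℝ) ≤ l1 x := by exact_mod_cast l1_nonneg x
        exact (l1_sq x).trans (pow_le_pow_left₀ h5 (by linarith) 2)
      exact hae
    rw [this]; exact zero_le
  · have hd3R : (3:ℝ) ≤ d := by exact_mod_cast hd3
    obtain ⟨C, hC, hT⟩ := torsion (d := d) hd3 e he0 (by linarith)
    set α : ℝ := (2+2*e)/d with hα
    have hα0 : 0 ≤ α := by positivity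
    have hexp : ((d:ℝ)-2+6*e)*α < 2*(1-11*e) := by
      rw [hα, ← mul_div_assoc, div_lt_iff₀ (by linarith)]
      nlinarith
    filter_upwards [eventually_ge_atTop 1, ev_pow (C*2^α) (((d:ℝ)-2+6*e)*α) (2*(1-11*e)) hexp,
      ev_pow ((d:ℝ)*6) (2*((d:ℝ)-2+6*e)) (2*d) (by linarith), ev_pow (2*(d:ℝ)) e (7*e) (by linarith),
      ev_log (2*d) e he0] with n hn a1 a2 a3 a4
    have hn1 : (1:ℝ) ≤ n := by exact_mod_cast hn
    have hn0 : (0:ℝ) < n := by linarith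
    set N : ℝ := (n:ℝ) with hN
    set κ : ℝ := N^((d:ℝ)-2+6*e) with hκ
    have hκ1 : 1 ≤ κ := Real.one_le_rpow hn1 (by linarith)
    have hj : (jt d e n : ℝ) ≤ κ := Nat.floor_le (by positivity)
    set θ : ℝ := N^(-(1-11*e)) with hθ
    have hθ0 : 0 < θ := by positivity
    have hθ1 : θ ≤ 1 := Real.rpow_le_one_of_one_le_of_nonpos hn1 (by linarith)
    have ho := outer hd0 θ C α (N^(1-4*e)) hθ0.le (by positivity) hC hα0 hT (jt d e n) (by
      have k1 := cosh_small hθ0.le hθ1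
      have k2 : (Real.cosh θ - 1)/d ≤ θ^2 := by
        refine le_trans (div_le_self (by linarith [Real.one_le_cosh θ]) (by linarith)) k1
      have k3 : ((jt d e n : ℝ)+1)^α ≤ 2^α * N^(((d:ℝ)-2+6*e)*α) := by
        rw [Real.rpow_mul hn0.le, ← Real.mul_rpow (by norm_num) (by positivity)]
        apply Real.rpow_le_rpow (by positivity) (by linarith) hα0
      have k4 : θ^2 * N^(2*(1-11*e)) = 1 := by
        rw [hθ, ← Real.rpow_mul_natCast hn0.le, ← Real.rpow_add hn0]
        rw [show -(1-11*e) * ((2:ℕ):ℝ) + 2*(1-11*e) = 0 by push_cast; ring, Real.rpow_zero]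
      calc (Real.cosh θ - 1)/d * (C * ((jt d e n : ℝ)+1)^α) ≤ θ^2 * (C * (2^α * N^(((d:ℝ)-2+6*e)*α))) := by gcongr
        _ = θ^2 * (C * 2^α * N^(((d:ℝ)-2+6*e)*α)) := by ring
        _ ≤ θ^2 * N^(2*(1-11*e)) := by gcongr
        _ = 1 := k4)
    refine ho.trans (ENNReal.ofReal_le_ofReal ?_)
    have e1 : θ * (N^(1-4*e)/d) = N^(7*e)/d := by
      rw [← mul_div_assoc, hθ, ← Real.rpow_add hn0]; congr 2; ring
    rw [e1]
    have m1 : (d:ℝ) * (((jt d e n:ℝ)+1)*((jt d e n:ℝ)+2)) ≤ Real.exp (2*d*Real.log N) := by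
      have : Real.exp (2*d*Real.log N) = N^(2*(d:ℝ)) := by
        rw [Real.rpow_def_of_pos hn0]; congr 1; ring
      rw [this]
      refine le_trans ?_ a2
      have e2 : N^(2*((d:ℝ)-2+6*e)) = κ * κ := by
        rw [hκ, ← Real.rpow_add hn0]; congr 1; ring
      rw [e2, mul_assoc]
      apply mul_le_mul_of_nonneg_left _ (by positivity)
      have hj0 : (0:ℝ) ≤ (jt d e n:ℝ) := by positivity
      nlinarith
    have m2 : 2*d*Real.log N - N^(7*e)/d ≤ -N^e := by
      have : 2 * N^e ≤ N^(7*e)/d := by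
        rw [le_div_iff₀ (by linarith)]; linarith
      linarith
    calc _ ≤ Real.exp (2*d*Real.log N) * Real.exp (-(N^(7*e)/d)) := by gcongr
      _ = Real.exp (2*d*Real.log N - N^(7*e)/d) := by rw [← Real.exp_add]; congr 1
      _ ≤ _ := Real.exp_le_exp.mpr m2

lemma conc_prob {d : ℕ} (hd : 2 ≤ d) (e : ℝ) (he0 : 0 < e) (he : e ≤ 1/16) : ∀ᶠ n : ℕ in atTop,
    ∀ z : V d, (n:ℝ)^2/16 ≤ nsq z → nsq z ≤ ((n:ℝ) * (1-(n:ℝ)^(-e)))^2 →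
    μ0 {ω | A d ω (jt d e n) ⊆ ball d ((n:ℝ)^(1-4*e)) ∧ z ∉ A d ω (bn d n - 1)} ≤
      ENNReal.ofReal (Real.exp (-(n:ℝ)^(e/2))) := by
  have hd0 : 0 < d := by omega
  have hdR : (2:ℝ) ≤ d := by exact_mod_cast hd
  obtain ⟨C, hC, hprops⟩ := h_props hd e he0 he
  obtain ⟨w, hw, hw1, hw2⟩ := count d
  filter_upwards [hprops, eventually_ge_atTop (2*d), ev_pow C ((d:ℝ)-2+4*e) ((d:ℝ)-2+6*e) (by linarith),
    ev_pow (2*2^d/w) ((d:ℝ)-2+6*e) d (by linarith), ev_pow 16 (e/2) e (by linarith), ev_pow (32*C) 0 e (by linarith)] with n hn hnd a1 a2 a3 a4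
  intro z hz1 hz2
  obtain ⟨h, p1, p2, p3, p4, p5, p6⟩ := hn z hz1 hz2
  have hn2d : 2 * (d:ℝ) ≤ n := by exact_mod_cast hnd
  have hn1 : (1:ℝ) ≤ n := by linarith
  have hn0 : (0:ℝ) < n := by linarith
  have hbn1 : 1 ≤ bn d n := Finset.card_pos.mpr ⟨0, by rw [mem_ball hn0.le, nsq_zero]; positivity⟩
  have hbn : ((bn d n - 1 : ℕ):ℝ) + 1 = (ball d n).card := by
    have : bn d n - 1 + 1 = (ball d n).card := Nat.sub_add_cancel hbn1
    exact_mod_cast this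
  set N : ℝ := (n:ℝ) with hN
  set κ : ℝ := N^((d:ℝ)-2+6*e) with hκ
  have hκ1 : 1 ≤ κ := Real.one_le_rpow hn1 (by linarith)
  have hj : (jt d e n : ℝ) ≤ κ := Nat.floor_le (by positivity)
  have hj2 : κ ≤ jt d e n + 1 := (Nat.lt_floor_add_one _).le
  have hbig : 2 * κ ≤ (ball d N).card := by
    refine le_trans ?_ (hw2 N (by linarith))
    have k1 : (N/2)^d ≤ (N-d)^d := pow_le_pow_left₀ (by positivity) (by linarith) d
    rw [Real.rpow_natCast, div_mul_eq_mul_div, div_le_iff₀ hw] at a2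
    rw [div_pow] at k1
    have k2 : 2 * κ ≤ w * (N^d/2^d) := by
      rw [← mul_div_assoc, le_div_iff₀ (by positivity)]; linarith
    exact k2.trans (mul_le_mul_of_nonneg_left k1 hw.le)
  have hjm : jt d e n ≤ bn d n - 1 := by
    have : (jt d e n:ℝ) ≤ ((bn d n - 1 : ℕ):ℝ) := by linarith
    exact_mod_cast this
  have hθH : N^(2*e) * (C * N^((d:ℝ)-2+2*e)) = C * N^((d:ℝ)-2+4*e) := by
    rw [mul_left_comm, ← Real.rpow_add hn0]; congr 2; ring
  have hc := conc hd0 z h (C * N^((d:ℝ)-2+2*e)) p1 p2 p3 (fun B => B ⊆ ball d (N^(1-4*e))) (jt d e n) (bn d n - 1) hjm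
    (N^(2*e)) (C * N^(-(2*e))) (N^(-e)/8) (by positivity) (by rw [hθH]; linarith) (by positivity) (by
      intro B hB hcard
      have : ∑ x ∈ B, (1 - C * N^(-(2*e))) ≤ ∑ x ∈ B, h x := Finset.sum_le_sum fun x hx => p4 x (hB hx)
      rw [Finset.sum_const, nsmul_eq_mul, hcard] at this
      push_cast at this
      linarith) (by
      intro B _
      rw [hbn]
      refine le_trans ?_ p6
      classical
      rw [← Finset.sum_filter_add_sum_filter_not B (fun x => x ∈ ball d N)]
      have z0 : ∑ x ∈ B with ¬ x ∈ ball d N, h x = 0 := Finset.sum_eq_zero fun x hx => p5 x (Finset.mem_filter.mp hx).2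
      rw [z0, add_zero]
      exact Finset.sum_le_sum_of_subset_of_nonneg (fun x hx => (Finset.mem_filter.mp hx).2) (fun x _ _ => p1 x))
  refine hc.trans (ENNReal.ofReal_le_ofReal (Real.exp_le_exp.mpr (neg_le_neg ?_)))
  rw [hθH]
  have k1 : C * N^((d:ℝ)-2+4*e) / (jt d e n + 1) ≤ C * N^(-(2*e)) := by
    rw [div_le_iff₀ (by positivity)]
    calc C * N^((d:ℝ)-2+4*e) = C * N^(-(2*e)) * κ := by
          rw [hκ, mul_assoc, ← Real.rpow_add hn0]; congr 2; ring
      _ ≤ _ := by gcongr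
  have k2 : N^(2*e) * (N^(-e)/8 - C * N^(-(2*e)) - C * N^((d:ℝ)-2+4*e) / (jt d e n + 1)) ≥ N^(2*e) * (N^(-e)/8 - 2 * (C * N^(-(2*e)))) := by
    apply mul_le_mul_of_nonneg_left _ (by positivity)
    linarith
  have k3 : N^(2*e) * (N^(-e)/8 - 2 * (C * N^(-(2*e)))) = N^e/8 - 2*C := by
    have l1 : N^(2*e) * N^(-e) = N^e := by rw [← Real.rpow_add hn0]; congr 1; ring
    have l2 : N^(2*e) * N^(-(2*e)) = 1 := by rw [← Real.rpow_add hn0, add_neg_cancel, Real.rpow_zero]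
    calc _ = (N^(2*e) * N^(-e))/8 - 2*C*(N^(2*e) * N^(-(2*e))) := by ring
      _ = _ := by rw [l1, l2]; ring
  rw [Real.rpow_zero, mul_one] at a4
  linarith

/-- the bad event at scale `n` -/
def Bad (d : ℕ) (e : ℝ) (n : ℕ) : Set ℝ :=
  {ω | ∃ z : V d, (n:ℝ)^2/16 ≤ nsq z ∧ nsq z ≤ ((n:ℝ) * (1-(n:ℝ)^(-e)))^2 ∧ z ∉ A d ω (bn d n - 1)}

lemma bad_prob {d : ℕ} (hd : 2 ≤ d) (e : ℝ) (he : e * d = 1/8) : ∀ᶠ n : ℕ in atTop,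
    μ0 (Bad d e n) ≤ ENNReal.ofReal (1/(n:ℝ)^2) := by
  have hd0 : 0 < d := by omega
  have hdR : (2:ℝ) ≤ d := by exact_mod_cast hd
  have he0 : 0 < e := by
    by_contra hcon
    push Not at hcon
    nlinarith
  have he16 : e ≤ 1/16 := by nlinarith
  obtain ⟨w, hw, hw1, hw2⟩ := count d
  filter_upwards [out_prob hd e he, conc_prob hd e he0 he16, eventually_ge_atTop (1+d),
    ev_pow (1+w*2^d) d (d+1) (by linarith), ev_log (d+1+2) (e/2) (by linarith)] with n h1 h2 hn a1 a2
  have hnd : 1 + (d:ℝ) ≤ n := by exact_mod_cast hn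
  have hn1 : (1:ℝ) ≤ n := by linarith
  have hn0 : (0:ℝ) < n := by linarith
  have hq0 : (0:ℝ) < (n:ℝ)^(-e) := by positivity
  have hq1 : (n:ℝ)^(-e) ≤ 1 := Real.rpow_le_one_of_one_le_of_nonpos hn1 (by linarith)
  classical
  set Z := (ball d n).filter (fun z => (n:ℝ)^2/16 ≤ nsq z ∧ nsq z ≤ ((n:ℝ) * (1-(n:ℝ)^(-e)))^2) with hZ
  have hsub : Bad d e n ⊆ {ω | ¬ A d ω (jt d e n) ⊆ ball d ((n:ℝ)^(1-4*e))} ∪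
      ⋃ z ∈ Z, {ω | A d ω (jt d e n) ⊆ ball d ((n:ℝ)^(1-4*e)) ∧ z ∉ A d ω (bn d n - 1)} := by
    rintro ω ⟨z, b1, b2, b3⟩
    by_cases hA : A d ω (jt d e n) ⊆ ball d ((n:ℝ)^(1-4*e))
    · right
      simp only [Set.mem_iUnion]
      refine ⟨z, ?_, hA, b3⟩
      rw [hZ, Finset.mem_filter]
      refine ⟨?_, b1, b2⟩
      rw [mem_ball hn0.le]
      refine b2.trans (pow_le_pow_left₀ (mul_nonneg hn0.le (by linarith)) ?_ 2)
      nlinarith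
    · left; exact hA
  have hexp : Real.exp (-(n:ℝ)^e) ≤ Real.exp (-(n:ℝ)^(e/2)) := by
    apply Real.exp_le_exp.mpr
    apply neg_le_neg
    exact Real.rpow_le_rpow_of_exponent_le hn1 (by linarith)
  calc μ0 (Bad d e n) ≤ _ := measure_mono hsub
    _ ≤ μ0 {ω | ¬ A d ω (jt d e n) ⊆ ball d ((n:ℝ)^(1-4*e))} + ∑ z ∈ Z, μ0 {ω | A d ω (jt d e n) ⊆ ball d ((n:ℝ)^(1-4*e)) ∧ z ∉ A d ω (bn d n - 1)} :=
        (measure_union_le _ _).trans (add_le_add le_rfl (measure_biUnion_finset_le _ _))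
    _ ≤ ENNReal.ofReal (Real.exp (-(n:ℝ)^(e/2))) + ∑ z ∈ Z, ENNReal.ofReal (Real.exp (-(n:ℝ)^(e/2))) := by
        apply add_le_add (h1.trans (ENNReal.ofReal_le_ofReal hexp))
        apply Finset.sum_le_sum
        intro z hz
        rw [hZ, Finset.mem_filter] at hz
        exact h2 z hz.2.1 hz.2.2
    _ = ENNReal.ofReal ((1 + Z.card) * Real.exp (-(n:ℝ)^(e/2))) := by
        rw [Finset.sum_const, nsmul_eq_mul, ENNReal.ofReal_mul (by positivity), ENNReal.ofReal_add zero_le_one (by positivity),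
          ENNReal.ofReal_one, ENNReal.ofReal_natCast]
        ring
    _ ≤ _ := by
        apply ENNReal.ofReal_le_ofReal
        have c1 : (Z.card:ℝ) ≤ w * 2^d * (n:ℝ)^d := by
          have : (Z.card:ℝ) ≤ (ball d n).card := by exact_mod_cast Finset.card_filter_le _ _
          refine this.trans ((hw1 n hn0.le).trans ?_)
          rw [mul_assoc, ← mul_pow]
          gcongr
          linarith
        have c2 : 1 + (Z.card:ℝ) ≤ (n:ℝ)^((d:ℝ)+1) := by
          refine le_trans ?_ a1
          rw [Real.rpow_natCast]
          have : (1:ℝ) ≤ (n:ℝ)^d := one_le_pow₀ hn1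
          nlinarith
        have c3 : Real.exp (-(n:ℝ)^(e/2)) ≤ (n:ℝ)^(-((d:ℝ)+1+2)) := by
          rw [Real.rpow_def_of_pos hn0 (-((d:ℝ)+1+2))]
          apply Real.exp_le_exp.mpr
          linarith
        calc _ ≤ (n:ℝ)^((d:ℝ)+1) * (n:ℝ)^(-((d:ℝ)+1+2)) := by gcongr
          _ = (n:ℝ)^(-2:ℝ) := by rw [← Real.rpow_add hn0]; congr 1; ring
          _ = _ := by rw [Real.rpow_neg hn0.le, one_div]; norm_num

lemma ae_not_bad {d : ℕ} (hd : 2 ≤ d) (e : ℝ) (he : e * d = 1/8) :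
    ∀ᵐ ω ∂μ0, ∃ n0 : ℕ, ∀ n ≥ n0, ω ∉ Bad d e n := by
  obtain ⟨N0, hN0⟩ := eventually_atTop.mp (bad_prob hd e he)
  have hs : Summable (fun n : ℕ => 1/((n + 1 + N0 : ℕ):ℝ)^2) := by
    have := (summable_nat_add_iff (1 + N0)).mpr (Real.summable_one_div_nat_pow (p := 2).mpr one_lt_two)
    simpa [add_assoc] using this
  have hfin : ∑' n, μ0 (Bad d e (n + 1 + N0)) ≠ ∞ := by
    refine ne_top_of_le_ne_top hs.tsum_ofReal_ne_top (ENNReal.tsum_le_tsum fun n => hN0 _ (by omega))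
  filter_upwards [ae_eventually_notMem hfin] with ω hω
  obtain ⟨n1, hn1⟩ := eventually_atTop.mp hω
  refine ⟨n1 + 1 + N0, fun n hn => ?_⟩
  have := hn1 (n - 1 - N0) (by omega)
  rwa [show n - 1 - N0 + 1 + N0 = n by omega] at this

lemma bn_mono (d : ℕ) : Monotone (bn d) := by
  intro a b hab
  apply Finset.card_le_card
  intro x hx
  rw [mem_ball (by positivity)] at hx ⊢
  refine hx.trans (pow_le_pow_left₀ (by positivity) (by exact_mod_cast hab) 2)

lemma bn_tendsto {d : ℕ} (hd : 2 ≤ d) (k : ℕ) : ∀ᶠ n : ℕ in atTop, k ≤ bn d n - 1 := by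
  obtain ⟨w, hw, hw1, hw2⟩ := count d
  have hdR : (2:ℝ) ≤ d := by exact_mod_cast hd
  filter_upwards [eventually_ge_atTop (d + 1 + ⌈((k:ℝ)+1)/w⌉₊)] with n hn
  have hnR : (d:ℝ) + 1 + (⌈((k:ℝ)+1)/w⌉₊:ℝ) ≤ n := by exact_mod_cast hn
  have h1 := Nat.le_ceil (((k:ℝ)+1)/w)
  have h2 : ((k:ℝ)+1)/w ≤ n - d := by linarith
  rw [div_le_iff₀ hw] at h2
  have h0 : (0:ℝ) ≤ (⌈((k:ℝ)+1)/w⌉₊:ℝ) := by positivity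
  have h3 := hw2 n (by linarith)
  have h4 : (n:ℝ) - d ≤ ((n:ℝ)-d)^d := le_self_pow₀ (by linarith) (by omega)
  have h5 : ((k + 1 : ℕ):ℝ) ≤ (bn d n : ℝ) := by
    have := mul_le_mul_of_nonneg_left h4 hw.le
    push_cast
    unfold bn
    linarith
  have : k + 1 ≤ bn d n := by exact_mod_cast h5
  omega

lemma final {d : ℕ} (hd : 2 ≤ d) : ∀ᵐ ω ∂μ0, ∀ᶠ n : ℕ in atTop,
    ball d ((n : ℝ) * (1 - 1 * (n : ℝ) ^ (-(1/(8*(d:ℝ)))))) ⊆ A d ω (bn d n - 1) := by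
  have hd0 : 0 < d := by omega
  have hdR : (2:ℝ) ≤ d := by exact_mod_cast hd
  set e : ℝ := 1/(8*(d:ℝ)) with he
  have he0 : 0 < e := by positivity
  have hed : e * d = 1/8 := by rw [he]; field_simp
  filter_upwards [ae_not_bad hd e hed, cover_all hd0] with ω h1 hcov
  obtain ⟨n0', hn0'⟩ := h1
  obtain ⟨n1, hn1⟩ := eventually_atTop.mp (ev_pow 2 (-e) 0 (by linarith))
  set n0 := n0' + n1 + 1 with hn0
  choose kz hkz using hcov
  filter_upwards [bn_tendsto hd ((ball d n0).sup kz), eventually_ge_atTop (n0 + 2)] with n hk hn z hz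
  rw [one_mul] at hz
  have hnR : (n0:ℝ) + 2 ≤ n := by exact_mod_cast hn
  have hn0R : (1:ℝ) ≤ n0 := by
    have : 1 ≤ n0 := by omega
    exact_mod_cast this
  have hnpos : (0:ℝ) < n := by linarith
  have hq1 : (n:ℝ)^(-e) ≤ 1 := Real.rpow_le_one_of_one_le_of_nonpos (by linarith) (by linarith)
  rw [mem_ball (mul_nonneg hnpos.le (by linarith))] at hz
  by_cases hsmall : z ∈ ball d n0
  · exact agg_mono {0} ω ((Finset.le_sup hsmall).trans hk) (hkz z)
  · rw [mem_ball (by positivity)] at hsmall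
    push Not at hsmall
    by_contra hnot
    rcases le_or_gt ((n:ℝ)^2/16) (nsq z) with hbig | hsm
    · exact hn0' n (by omega) ⟨z, hbig, hz, hnot⟩
    · set r := Real.sqrt (nsq z) with hr
      have hr0 : 0 ≤ r := Real.sqrt_nonneg _
      have hr2 : r^2 = nsq z := Real.sq_sqrt (nsq_nonneg z)
      have hrn0 : (n0:ℝ) < r := by
        rw [← hr2] at hsmall
        exact lt_of_pow_lt_pow_left₀ 2 hr0 hsmall
      have hrn : r < n/4 := by
        have : r^2 < ((n:ℝ)/4)^2 := by rw [hr2]; linarith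
        exact lt_of_pow_lt_pow_left₀ 2 (by positivity) this
      set m := ⌈2*r⌉₊ with hm
      have hm1 : 2*r ≤ m := Nat.le_ceil _
      have hm2 : (m:ℝ) < 2*r + 1 := Nat.ceil_lt_add_one (by positivity)
      have hmn0 : n0 ≤ m := by
        have : (n0:ℝ) ≤ m := by linarith
        exact_mod_cast this
      have hmn : m ≤ n := by
        have : (m:ℝ) ≤ n := by linarith
        exact_mod_cast this
      have hm0 : (0:ℝ) < m := by linarith
      have hqm := hn1 m (by omega)
      rw [Real.rpow_zero] at hqm
      refine hn0' m (by omega) ⟨z, ?_, ?_, fun hmem => hnot (agg_mono {0} ω (Nat.sub_le_sub_right (bn_mono d hmn) 1) hmem)⟩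
      · rw [← hr2]; nlinarith
      · rw [← hr2]
        apply pow_le_pow_left₀ hr0
        nlinarith

end IDLA

theorem statement18 (d : ℕ) (hd : 2 ≤ d) :
    ∃ c₁ C₁ : ℝ, 0 < c₁ ∧ 0 < C₁ ∧
      ∀ᵐ ω ∂μ0, ∀ᶠ n : ℕ in atTop,
        ball d ((n : ℝ) * (1 - C₁ * (n : ℝ) ^ (-c₁))) ⊆
          uAggFrom ({0} : Finset (V d)) ω (bn d n - 1) := by
  have hdR : (0:ℝ) < d := by
    have : 0 < d := by omega
    exact_mod_cast this
  exact ⟨1/(8*(d:ℝ)), 1, by positivity, one_pos, IDLA.final hd⟩
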